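/- arXiv:2411.11462 — 2 statements merged into one kernel-verified Lean document; each statement's English description precedes it below -/
import Mathlib

section
/- Let K ⊂ S² be a convex body of width w with 0 < w ≤ π/2, and let B = B(p,r) ⊆ K be an incircle of K with incenter p and radius r = r(K). Then there exist points q₁, q₂, q₃ ∈ K with d(p,qᵢ) = w − r for i = 1,2,3 such that the three caps (conv(B ∪ {qᵢ})) \ B, i = 1,2,3, have pairwise disjoint interiors. -/
open scoped RealInnerProductSpace
open Real MeasureTheory

noncomputable section

namespace SphericalPal

/-- Ambient Euclidean space of the sphere `Sⁿ`. -/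
abbrev E (n : ℕ) := EuclideanSpace ℝ (Fin (n + 1))

/-- The unit sphere `Sⁿ ⊂ ℝⁿ⁺¹`. -/
def unitSphere (n : ℕ) : Set (E n) := Metric.sphere 0 1

variable {n : ℕ}

/-- Geodesic (angular) distance on the unit sphere. -/
def gdist (x y : E n) : ℝ := Real.arccos ⟪x, y⟫

/-- The geodesic segment joining `x` and `y` on the sphere. -/
def seg (x y : E n) : Set (E n) :=
  {z ∈ unitSphere n | gdist x z + gdist z y = gdist x y}

/-- A subset of the sphere is spherically convex if it lies on the sphere, is contained
in an open hemisphere and contains the geodesic segment joining any two of its points. -/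
def SConvex (X : Set (E n)) : Prop :=
  X ⊆ unitSphere n ∧
  (∃ u ∈ unitSphere n, ∀ x ∈ X, 0 < ⟪u, x⟫) ∧
  ∀ x ∈ X, ∀ y ∈ X, seg x y ⊆ X

/-- Spherical convex hull. -/
def sconv (X : Set (E n)) : Set (E n) := ⋂₀ {C | SConvex C ∧ X ⊆ C}

/-- Relative (spherical) interior of a subset of the sphere. -/
def sInterior (X : Set (E n)) : Set (E n) :=
  {x ∈ X | ∃ ε > 0, ∀ y ∈ unitSphere n, gdist x y < ε → y ∈ X}

/-- A spherical convex body: compact, spherically convex, with nonempty relative interior. -/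
def IsConvexBody (K : Set (E n)) : Prop :=
  SConvex K ∧ IsCompact K ∧ (sInterior K).Nonempty

/-- The lune determined by `u` and `v` (intersection of the closed hemispheres
opposite to `u` and to `v`). -/
def lune (u v : E n) : Set (E n) := {x ∈ unitSphere n | ⟪x, u⟫ ≤ 0 ∧ ⟪x, v⟫ ≤ 0}

/-- The bounding hemisphere of `lune u v` contained in the great sphere orthogonal to `u`. -/
def luneFace (u v : E n) : Set (E n) := {x ∈ unitSphere n | ⟪x, u⟫ = 0 ∧ ⟪x, v⟫ ≤ 0}

/-- The center (midpoint) of the bounding hemisphere `luneFace u v`. -/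
def luneFaceCenter (u v : E n) : E n :=
  ‖(⟪u, v⟫ • u - v : E n)‖⁻¹ • (⟪u, v⟫ • u - v)

/-- The breadth of the lune `lune u v`: the geodesic distance of the centers of the
two bounding hemispheres. -/
def breadth (u v : E n) : ℝ := gdist (luneFaceCenter u v) (luneFaceCenter v u)

/-- `lune u v` is a supporting lune of `K`. -/
def IsSupportingLune (K : Set (E n)) (u v : E n) : Prop :=
  u ∈ unitSphere n ∧ v ∈ unitSphere n ∧ u ≠ v ∧ u ≠ -v ∧
  K ⊆ lune u v ∧ (K ∩ luneFace u v).Nonempty ∧ (K ∩ luneFace v u).Nonempty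

/-- The (minimal) width of a spherical convex body. -/
def width (K : Set (E n)) : ℝ :=
  sInf {b | ∃ u v : E n, IsSupportingLune K u v ∧ b = breadth u v}

/-- The width of `K` with respect to the supporting great hypersphere orthogonal to `u`:
the minimal breadth among supporting lunes of `K` having one bounding hemisphere
contained in that great hypersphere. -/
def widthAt (K : Set (E n)) (u : E n) : ℝ :=
  sInf {b | ∃ v : E n, IsSupportingLune K u v ∧ b = breadth u v}

/-- The great hypersphere orthogonal to `u` supports `K`. -/
def IsSupportingSphere (K : Set (E n)) (u : E n) : Prop :=
  u ∈ unitSphere n ∧ (∀ x ∈ K, ⟪x, u⟫ ≤ 0) ∧ ∃ x ∈ K, ⟪x, u⟫ = 0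

/-- `K` is of constant width `w`. -/
def HasConstantWidth (K : Set (E n)) (w : ℝ) : Prop :=
  ∀ u : E n, IsSupportingSphere K u → widthAt K u = w

/-- `K` is a reduced convex body. -/
def IsReduced (K : Set (E n)) : Prop :=
  IsConvexBody K ∧ ∀ L : Set (E n), IsConvexBody L → L ⊆ K → L ≠ K → width L < width K

/-- The spherical polar set. -/
def polar (A : Set (E n)) : Set (E n) := {u ∈ unitSphere n | ∀ a ∈ A, ⟪a, u⟫ ≤ 0}

/-- Closed geodesic ball on the sphere. -/
def gball (p : E n) (r : ℝ) : Set (E n) := {x ∈ unitSphere n | gdist p x ≤ r}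

/-- The inradius of `K`: the largest `r` such that some geodesic ball of radius `r`
is contained in `K`. -/
def inradius (K : Set (E n)) : ℝ :=
  sSup {r | 0 ≤ r ∧ ∃ p ∈ unitSphere n, gball p r ⊆ K}

/-- Geodesic distance from a point to a set. -/
def sdist (x : E n) (A : Set (E n)) : ℝ := sInf (gdist x '' A)

/-- Hausdorff distance with respect to the geodesic metric. -/
def hausdorffG (A B : Set (E n)) : ℝ :=
  max (sSup ((fun x => sdist x B) '' A)) (sSup ((fun y => sdist y A) '' B))

/-- Two subsets of the sphere are congruent, i.e., isometric by an orthogonal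
transformation of the ambient Euclidean space. -/
def Congruent (A B : Set (E n)) : Prop :=
  ∃ f : E n ≃ₗᵢ[ℝ] E n, f '' A = B

/-- Spherical surface measure on `S²` (2-dimensional Hausdorff measure). -/
def area (X : Set (E 2)) : ℝ := (μH[2] X).toReal

/-- The spherical angle `∠(x, p, y)` at `p` between the geodesic segments `[p,x]`, `[p,y]`. -/
def sangle (x p y : E 2) : ℝ :=
  InnerProductGeometry.angle (x - ⟪p, x⟫ • p) (y - ⟪p, y⟫ • p)

/-- `T` is a regular spherical triangle: the spherical convex hull of three points
with equal pairwise geodesic distances, not lying on a common great circle. -/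
def IsRegularTriangle (T : Set (E 2)) : Prop :=
  ∃ v₁ v₂ v₃ : E 2, v₁ ∈ unitSphere 2 ∧ v₂ ∈ unitSphere 2 ∧ v₃ ∈ unitSphere 2 ∧
    LinearIndependent ℝ ![v₁, v₂, v₃] ∧
    gdist v₁ v₂ = gdist v₂ v₃ ∧ gdist v₂ v₃ = gdist v₁ v₃ ∧
    T = sconv {v₁, v₂, v₃}

/-- Three points on the sphere with equal pairwise geodesic distance `a`
(the vertices of a regular spherical triangle of side length `a`). -/
def IsRegularCenters (x₁ x₂ x₃ : E 2) (a : ℝ) : Prop :=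
  x₁ ∈ unitSphere 2 ∧ x₂ ∈ unitSphere 2 ∧ x₃ ∈ unitSphere 2 ∧
  gdist x₁ x₂ = a ∧ gdist x₂ x₃ = a ∧ gdist x₁ x₃ = a

/-- `U` is a spherical Reuleaux triangle: intersection of three geodesic balls of radius `r`
whose centers have pairwise geodesic distance `r`. -/
def IsReuleaux (U : Set (E 2)) (r : ℝ) : Prop :=
  ∃ x₁ x₂ x₃ : E 2, IsRegularCenters x₁ x₂ x₃ r ∧
    U = gball x₁ r ∩ gball x₂ r ∩ gball x₃ r

/-- The body `U°_{π-w}` for `w > π/2`: the spherical convex hull of three geodesic balls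
of radius `w - π/2` (whose centers are meant to form a regular triangle of side `π - w`). -/
def polarReuleaux (x₁ x₂ x₃ : E 2) (w : ℝ) : Set (E 2) :=
  sconv (gball x₁ (w - π / 2) ∪ gball x₂ (w - π / 2) ∪ gball x₃ (w - π / 2))

end SphericalPal

open SphericalPal

open InnerProductGeometry in
lemma us_iff (x : E 2) : x ∈ unitSphere 2 ↔ ‖x‖ = 1 := by
  simp [unitSphere]

open InnerProductGeometry in
lemma gdist_eq_angle {x y : E 2} (hx : ‖x‖ = 1) (hy : ‖y‖ = 1) : gdist x y = angle x y := by
  simp [gdist, angle, hx, hy]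

lemma inner_self_one {x : E 2} (hx : ‖x‖ = 1) : ⟪x, x⟫ = 1 := by
  rw [real_inner_self_eq_norm_sq, hx]; norm_num

open InnerProductGeometry in
lemma seg_iff {x y z : E 2} (hx : ‖x‖ = 1) (hy : ‖y‖ = 1) (hz : ‖z‖ = 1)
    (hxy : angle x y ≠ π) :
    z ∈ seg x y ↔ ∃ a b : ℝ, 0 ≤ a ∧ 0 ≤ b ∧ z = a • x + b • y := by
  have hz0 : z ≠ 0 := by rintro rfl; simp at hz
  have h1 : z ∈ seg x y ↔ angle x y = angle x z + angle z y := by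
    unfold seg
    simp only [Set.mem_ofPred_eq, us_iff, hz, true_and]
    rw [gdist_eq_angle hx hy, gdist_eq_angle hx hz, gdist_eq_angle hz hy, eq_comm]
  rw [h1, angle_eq_angle_add_angle_iff hz0, or_iff_right hxy, Submodule.mem_span_pair]
  constructor
  · rintro ⟨a, b, h⟩
    exact ⟨a, b, a.2, b.2, h.symm⟩
  · rintro ⟨a, b, ha, hb, h⟩
    exact ⟨⟨a, ha⟩, ⟨b, hb⟩, h.symm⟩

open InnerProductGeometry in
lemma angle_ne_pi_of_pos {x y u : E 2} (hx : 0 < ⟪u, x⟫) (hy : 0 < ⟪u, y⟫) :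
    angle x y ≠ π := by
  intro h
  rw [angle_eq_pi_iff] at h
  obtain ⟨_, r, hr, rfl⟩ := h
  rw [inner_smul_right] at hy
  nlinarith

lemma sconvex_of_cone (P : E 2 → Prop) (hadd : ∀ x y, P x → P y → P (x + y))
    (hsmul : ∀ (a : ℝ) x, 0 ≤ a → P x → P (a • x)) (u : E 2) (hu : ‖u‖ = 1)
    (hpos : ∀ x, ‖x‖ = 1 → P x → 0 < ⟪u, x⟫) :
    SConvex {x ∈ unitSphere 2 | P x} := by
  refine ⟨fun x hx => hx.1, ⟨u, (us_iff u).2 hu, fun x hx => hpos x ((us_iff x).1 hx.1) hx.2⟩, ?_⟩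
  rintro x ⟨hx, hPx⟩ y ⟨hy, hPy⟩ z hz
  have hz1 := hz.1
  rw [us_iff] at hx hy hz1
  rw [seg_iff hx hy hz1 (angle_ne_pi_of_pos (hpos x hx hPx) (hpos y hy hPy))] at hz
  obtain ⟨a, b, ha, hb, rfl⟩ := hz
  exact ⟨(us_iff _).2 hz1, hadd _ _ (hsmul _ _ ha hPx) (hsmul _ _ hb hPy)⟩

lemma bipolar {K : Set (E 2)} (hS : SConvex K) (hc : IsCompact K) (hne : K.Nonempty)
    {x : E 2} (hx : ‖x‖ = 1)
    (h : ∀ u : E 2, ‖u‖ = 1 → (∀ y ∈ K, ⟪y, u⟫ ≤ 0) → ⟪x, u⟫ ≤ 0) : x ∈ K := by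
  obtain ⟨hSu, ⟨u₀, hu₀, hu₀K⟩, hseg⟩ := hS
  have hn : ∀ k ∈ K, ‖k‖ = 1 := fun k hk => (us_iff k).1 (hSu hk)
  let C : ProperCone ℝ (E 2) :=
    { carrier := {z | ∃ t : ℝ, 0 ≤ t ∧ ∃ k ∈ K, z = t • k}
      add_mem' := by
        rintro a b ⟨t, ht, k, hk, rfl⟩ ⟨s, hs, l, hl, rfl⟩
        rcases ht.eq_or_lt with rfl | ht
        · exact ⟨s, hs, l, hl, by simp⟩
        refine ⟨‖t • k + s • l‖, norm_nonneg _, ‖t • k + s • l‖⁻¹ • (t • k + s • l), ?_, ?_⟩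
        · have h0 : t • k + s • l ≠ 0 := by
            intro h0
            have h1 : 0 < ⟪u₀, t • k + s • l⟫ := by
              rw [inner_add_right, inner_smul_right, inner_smul_right]
              have := mul_pos ht (hu₀K k hk)
              have := mul_nonneg hs (hu₀K l hl).le
              linarith
            rw [h0] at h1; simp at h1
          have h2 : ‖t • k + s • l‖ ≠ 0 := norm_ne_zero_iff.2 h0
          apply hseg k hk l hl
          rw [seg_iff (hn k hk) (hn l hl) (by rw [norm_smul, norm_inv, norm_norm]; field_simp)
            (angle_ne_pi_of_pos (hu₀K k hk) (hu₀K l hl))]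
          exact ⟨‖t • k + s • l‖⁻¹ * t, ‖t • k + s • l‖⁻¹ * s, by positivity, by positivity,
            by rw [smul_add, smul_smul, smul_smul]⟩
        · by_cases h0 : ‖t • k + s • l‖ = 0
          · rw [h0, zero_smul]; exact norm_eq_zero.1 h0
          · rw [smul_smul, mul_inv_cancel₀ h0, one_smul]
      zero_mem' := by
        obtain ⟨k, hk⟩ := hne
        exact ⟨0, le_rfl, k, hk, by simp⟩
      smul_mem' := by
        rintro ⟨c, hc⟩ z ⟨t, ht, k, hk, rfl⟩
        exact ⟨c * t, mul_nonneg hc ht, k, hk, by rw [mul_smul]; rfl⟩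
      isClosed' := by
        apply isClosed_of_closure_subset
        intro z hz
        rw [mem_closure_iff_seq_limit] at hz
        obtain ⟨f, hf, hlim⟩ := hz
        choose t ht k hk hfk using hf
        obtain ⟨k0, hk0, φ, hφ, hφl⟩ := hc.tendsto_subseq hk
        refine ⟨‖z‖, norm_nonneg _, k0, hk0, ?_⟩
        have h1 : Filter.Tendsto (fun n => ‖f (φ n)‖ • k (φ n)) Filter.atTop (nhds (‖z‖ • k0)) :=
          ((hlim.comp hφ.tendsto_atTop).norm).smul hφl
        have h2 : (fun n => ‖f (φ n)‖ • k (φ n)) = f ∘ φ := by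
          funext n
          have h3 : ‖f (φ n)‖ = t (φ n) := by
            rw [hfk, norm_smul, hn _ (hk _), mul_one, Real.norm_of_nonneg (ht _)]
          simp only [Function.comp]
          rw [h3, ← hfk]
        rw [h2] at h1
        exact tendsto_nhds_unique (hlim.comp hφ.tendsto_atTop) h1 }
  by_contra hxK
  have hxC : x ∉ C := by
    rintro ⟨t, ht, k, hk, hxk⟩
    have : t = 1 := by
      have h1 := hx
      rw [hxk, norm_smul, hn k hk, mul_one, Real.norm_of_nonneg ht] at h1
      exact h1
    rw [this, one_smul] at hxk
    exact hxK (hxk ▸ hk)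
  obtain ⟨y, hy, hxy⟩ := ProperCone.hyperplane_separation' C hxC
  have hy0 : y ≠ 0 := by rintro rfl; simp at hxy
  have hyn : 0 < ‖y‖ := norm_pos_iff.2 hy0
  have := h (-(‖y‖⁻¹ • y)) (by rw [norm_neg, norm_smul, norm_inv, norm_norm]; field_simp) (by
    intro k hk
    rw [inner_neg_right, inner_smul_right]
    have := hy k ⟨1, zero_le_one, k, hk, by simp⟩
    have := mul_nonneg (inv_nonneg.2 hyn.le) this
    linarith)
  rw [inner_neg_right, inner_smul_right] at this
  have := mul_neg_of_pos_of_neg (inv_pos.2 hyn) hxy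
  linarith

lemma inner_sq_lt {u v : E 2} (hu : ‖u‖ = 1) (hv : ‖v‖ = 1) (h1 : u ≠ v) (h2 : u ≠ -v) :
    ⟪u, v⟫ ^ 2 < 1 := by
  have a : ⟪u, v⟫ < 1 := inner_lt_one_iff_real_of_norm_eq_one hu hv |>.2 h1
  have b : ⟪u, -v⟫ < 1 := inner_lt_one_iff_real_of_norm_eq_one hu (by simpa using hv) |>.2 h2
  rw [inner_neg_right] at b
  nlinarith

lemma breadth_eq {u v : E 2} (hu : ‖u‖ = 1) (hv : ‖v‖ = 1) (h1 : u ≠ v) (h2 : u ≠ -v) :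
    breadth u v = Real.arccos (-⟪u, v⟫) := by
  have hlt := inner_sq_lt hu hv h1 h2
  have key : ∀ u v : E 2, ‖u‖ = 1 → ‖v‖ = 1 → ‖(⟪u, v⟫ • u - v : E 2)‖ ^ 2 = 1 - ⟪u, v⟫ ^ 2 := by
    intro u v hu hv
    rw [norm_sub_sq_real, norm_smul, hu, hv, inner_smul_left]
    simp; ring
  have k1 := key u v hu hv
  have k2 := key v u hv hu
  rw [real_inner_comm] at k2
  have k3 : ‖(⟪v, u⟫ • v - u : E 2)‖ = ‖(⟪u, v⟫ • u - v : E 2)‖ := by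
    rw [← sq_eq_sq₀ (norm_nonneg _) (norm_nonneg _), k1, real_inner_comm, k2]
  unfold breadth gdist luneFaceCenter
  congr 1
  rw [inner_smul_left, inner_smul_right, k3, inner_sub_left, inner_sub_right, inner_sub_right,
    inner_smul_left, inner_smul_right, inner_smul_left, inner_smul_right, inner_self_one hu,
    inner_self_one hv, real_inner_comm u v]
  set N := ‖(⟪u, v⟫ • u - v : E 2)‖
  have hN : N ≠ 0 := by
    intro h; rw [h] at k1; nlinarith
  simp only [conj_trivial]
  field_simp
  rw [k1]; ring

/-- `p, m₁, m₂` is an orthonormal frame (expressed through coordinates). -/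
def Frame (p m₁ m₂ : E 2) : Prop :=
  (∀ x y : E 2, ⟪x, y⟫ = ⟪p, x⟫ * ⟪p, y⟫ + ⟪m₁, x⟫ * ⟪m₁, y⟫ + ⟪m₂, x⟫ * ⟪m₂, y⟫) ∧
  ∀ a b c : ℝ, ∃ x : E 2, ⟪p, x⟫ = a ∧ ⟪m₁, x⟫ = b ∧ ⟪m₂, x⟫ = c

lemma exists_frame {p : E 2} (hp : ‖p‖ = 1) : ∃ m₁ m₂ : E 2, Frame p m₁ m₂ := by
  obtain ⟨b, hb⟩ := Orthonormal.exists_orthonormalBasis_extension_of_card_eq (𝕜 := ℝ) (E := E 2)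
    (ι := Fin 3) (by simp) (v := fun _ => p) (s := {0}) (by
      constructor
      · intro i; simpa using hp
      · intro i j hij
        exact absurd (Subsingleton.elim i j) hij)
  have h0 : b 0 = p := hb 0 rfl
  have h01 : ⟪p, b 1⟫ = 0 := by rw [← h0]; exact b.orthonormal.2 (by decide)
  have h02 : ⟪p, b 2⟫ = 0 := by rw [← h0]; exact b.orthonormal.2 (by decide)
  have h12 : ⟪b 1, b 2⟫ = 0 := b.orthonormal.2 (by decide)
  refine ⟨b 1, b 2, ?_, ?_⟩
  · intro x y
    rw [← b.sum_inner_mul_inner x y, Fin.sum_univ_three, h0]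
    rw [real_inner_comm p x, real_inner_comm (b 1) x, real_inner_comm (b 2) x]
  · intro x y z
    refine ⟨x • p + y • b 1 + z • b 2, ?_, ?_, ?_⟩
    · simp only [inner_add_right, inner_smul_right, inner_self_one hp, h01, h02]; ring
    · simp only [inner_add_right, inner_smul_right, inner_self_one (b.orthonormal.1 1), h12]
      rw [real_inner_comm, h01]; ring
    · simp only [inner_add_right, inner_smul_right, inner_self_one (b.orthonormal.1 2)]
      rw [real_inner_comm, h02, real_inner_comm, h12]; ring

lemma Frame.norm_iff {p m₁ m₂ : E 2} (F : Frame p m₁ m₂) (x : E 2) :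
    ‖x‖ = 1 ↔ ⟪p, x⟫ ^ 2 + ⟪m₁, x⟫ ^ 2 + ⟪m₂, x⟫ ^ 2 = 1 := by
  have h := F.1 x x
  rw [real_inner_self_eq_norm_sq] at h
  constructor
  · intro h1; rw [h1] at h; linarith
  · intro h1
    have h2 : ‖x‖ ^ 2 = 1 := by linarith
    nlinarith [norm_nonneg x]

lemma isCompact_hull {U : Set (E 2)} (hU : IsCompact U) : IsCompact (convexHull ℝ U) := by
  have : convexHull ℝ U = ⋃ n ∈ (Finset.range 5 : Finset ℕ),
      (fun q : (Fin n → ℝ) × (Fin n → E 2) => ∑ i, q.1 i • q.2 i) ''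
        (stdSimplex ℝ (Fin n) ×ˢ Set.univ.pi (fun _ => U)) := by
    ext x
    simp only [Set.mem_iUnion]
    constructor
    · intro hx
      obtain ⟨ι, _, z, w, hz, haff, hw, hw1, hx⟩ := eq_pos_convex_span_of_mem_convexHull hx
      have hcard : Fintype.card ι ≤ 4 := by
        have h1 := haff.card_le_finrank_succ
        have h2 := Submodule.finrank_le (vectorSpan ℝ (Set.range z))
        have h3 : Module.finrank ℝ (E 2) = 3 := by simp
        omega
      let e := Fintype.equivFin ι
      refine ⟨Fintype.card ι, by simp; omega, (w ∘ e.symm, z ∘ e.symm), ⟨⟨fun i => (hw _).le, ?_⟩, ?_⟩, ?_⟩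
      · simp only [Function.comp]
        rw [Equiv.sum_comp e.symm w, hw1]
      · intro i _
        exact hz ⟨_, rfl⟩
      · simp only [Function.comp]
        rw [Equiv.sum_comp e.symm (fun i => w i • z i), hx]
    · rintro ⟨n, _, q, ⟨hq1, hq2⟩, rfl⟩
      exact (convex_convexHull ℝ U).sum_mem (fun i _ => hq1.1 i) hq1.2
        (fun i _ => subset_convexHull ℝ U (hq2 i trivial))
  rw [this]
  apply Set.Finite.isCompact_biUnion (Finset.finite_toSet _)
  intro n _
  apply IsCompact.image
  · exact (isCompact_stdSimplex ℝ (Fin n)).prod (isCompact_univ_pi fun _ => hU)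
  · fun_prop

/-- `u` is a unit vector of the polar of `K`. -/
def PolK (K : Set (E 2)) (u : E 2) : Prop := ‖u‖ = 1 ∧ ∀ y ∈ K, ⟪y, u⟫ ≤ 0

lemma inner_mem_Icc {x y : E 2} (hx : ‖x‖ = 1) (hy : ‖y‖ = 1) : -1 ≤ ⟪x, y⟫ ∧ ⟪x, y⟫ ≤ 1 := by
  have := abs_real_inner_le_norm x y
  rw [hx, hy, one_mul, abs_le] at this
  exact this

lemma gdist_le_iff {x y : E 2} (hx : ‖x‖ = 1) (hy : ‖y‖ = 1) {r : ℝ} (h0 : 0 ≤ r) (h1 : r ≤ π) :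
    gdist x y ≤ r ↔ Real.cos r ≤ ⟪x, y⟫ := by
  obtain ⟨ha, hb⟩ := inner_mem_Icc hx hy
  unfold gdist
  constructor
  · intro h
    rw [← Real.cos_arccos ha hb]
    exact Real.cos_le_cos_of_nonneg_of_le_pi (Real.arccos_nonneg _) h1 h
  · intro h
    rw [← Real.arccos_cos h0 h1]
    exact Real.arccos_le_arccos h

lemma mem_gball_iff {p x : E 2} (hp : ‖p‖ = 1) {r : ℝ} (h0 : 0 ≤ r) (h1 : r ≤ π) :
    x ∈ gball p r ↔ ‖x‖ = 1 ∧ Real.cos r ≤ ⟪p, x⟫ := by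
  unfold gball
  simp only [Set.mem_ofPred_eq, us_iff]
  constructor
  · rintro ⟨a, b⟩; exact ⟨a, (gdist_le_iff hp a h0 h1).1 b⟩
  · rintro ⟨a, b⟩; exact ⟨a, (gdist_le_iff hp a h0 h1).2 b⟩

lemma radius_lt {K : Set (E 2)} (hS : SConvex K) {p : E 2} (hp : ‖p‖ = 1) {r : ℝ}
    (hb : gball p r ⊆ K) : r < π / 2 := by
  by_contra hr
  push Not at hr
  obtain ⟨m₁, m₂, F⟩ := exists_frame hp
  obtain ⟨_, ⟨u, _, hu⟩, _⟩ := hS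
  have key : ∀ s : ℝ, s ^ 2 = 1 → 0 < s * ⟪m₁, u⟫ := by
    intro s hs
    obtain ⟨x, hx0, hx1, hx2⟩ := F.2 0 s 0
    have hxn : ‖x‖ = 1 := by rw [F.norm_iff, hx0, hx1, hx2, hs]; norm_num
    have hxK : x ∈ K := by
      apply hb
      refine ⟨(us_iff x).2 hxn, ?_⟩
      rw [gdist, hx0, Real.arccos_zero]; exact hr
    have := hu x hxK
    rw [F.1, hx0, hx1, hx2] at this
    linarith
  have h1 := key 1 (by norm_num)
  have h2 := key (-1) (by norm_num)
  linarith

lemma le_inradius {K : Set (E 2)} (hS : SConvex K) {p : E 2} (hp : ‖p‖ = 1) {r : ℝ}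
    (h0 : 0 ≤ r) (hb : gball p r ⊆ K) : r ≤ inradius K := by
  apply le_csSup
  · refine ⟨π / 2, ?_⟩
    rintro s ⟨_, q, hq, hs⟩
    exact (radius_lt hS ((us_iff q).1 hq) hs).le
  · exact ⟨h0, p, (us_iff p).2 hp, hb⟩

lemma inradius_pos {K : Set (E 2)} (hK : IsConvexBody K) : 0 < inradius K := by
  obtain ⟨hS, _, x, hx, ε, hε, h⟩ := hK
  have : gball x (ε / 2) ⊆ K := by
    rintro y ⟨hy, hd⟩
    exact h y hy (by linarith)
  have := le_inradius hS ((us_iff x).1 (hS.1 hx)) (by positivity) this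
  linarith

lemma ball_polar {K : Set (E 2)} {p : E 2} (hp : ‖p‖ = 1) {r : ℝ}
    (h0 : 0 < r) (h1 : r < π / 2) (hb : gball p r ⊆ K) {u : E 2} (hu : PolK K u) :
    ⟪p, u⟫ ≤ -Real.sin r := by
  obtain ⟨m₁, m₂, F⟩ := exists_frame hp
  have hun := (F.norm_iff u).1 hu.1
  have hpu : ⟪p, u⟫ ≤ 0 := hu.2 p (hb ((mem_gball_iff hp h0.le (by linarith [pi_pos])).2
    ⟨hp, by rw [inner_self_one hp]; exact Real.cos_le_one r⟩))
  have hs := Real.sin_pos_of_pos_of_lt_pi h0 (by linarith [pi_pos])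
  have hc := Real.cos_pos_of_mem_Ioo ⟨by linarith, h1⟩
  have hsc := Real.sin_sq_add_cos_sq r
  set D := Real.sqrt (⟪m₁, u⟫ ^ 2 + ⟪m₂, u⟫ ^ 2) with hD
  have hD2 : D ^ 2 = ⟪m₁, u⟫ ^ 2 + ⟪m₂, u⟫ ^ 2 := Real.sq_sqrt (by positivity)
  have hD0 : 0 ≤ D := Real.sqrt_nonneg _
  rcases hD0.eq_or_lt with hD0 | hD0
  · rw [← hD0] at hD2
    have : ⟪p, u⟫ = -1 := by nlinarith
    rw [this]
    linarith [Real.sin_le_one r]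
  · obtain ⟨x, hx0, hx1, hx2⟩ := F.2 (Real.cos r) (Real.sin r * (⟪m₁, u⟫ / D))
      (Real.sin r * (⟪m₂, u⟫ / D))
    have hxn : ‖x‖ = 1 := by
      rw [F.norm_iff, hx0, hx1, hx2]
      have : (⟪m₁, u⟫ / D) ^ 2 + (⟪m₂, u⟫ / D) ^ 2 = 1 := by
        field_simp; linarith
      nlinarith
    have hxK : x ∈ K := hb ((mem_gball_iff hp h0.le (by linarith [pi_pos])).2
      ⟨hxn, hx0.ge⟩)
    have h2 := hu.2 x hxK
    rw [F.1, hx0, hx1, hx2] at h2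
    have h3 : Real.sin r * (⟪m₁, u⟫ / D) * ⟪m₁, u⟫ + Real.sin r * (⟪m₂, u⟫ / D) * ⟪m₂, u⟫
        = Real.sin r * D := by
      field_simp; rw [hD2]
    have h4 : Real.sin r * D ≤ Real.cos r * (-⟪p, u⟫) := by linarith
    have h5 : (Real.sin r * D) ^ 2 ≤ (Real.cos r * (-⟪p, u⟫)) ^ 2 :=
      pow_le_pow_left₀ (by positivity) h4 2
    have h6 : Real.sin r ^ 2 ≤ (-⟪p, u⟫) ^ 2 := by
      have : D ^ 2 = 1 - ⟪p, u⟫ ^ 2 := by linarith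
      rw [mul_pow, mul_pow, this] at h5
      nlinarith
    have := abs_le_of_sq_le_sq h6 (by linarith)
    linarith [le_abs_self (Real.sin r)]

open InnerProductGeometry in
lemma ball_of_polar {K : Set (E 2)} (hS : SConvex K) (hc : IsCompact K) (hne : K.Nonempty)
    {p : E 2} (hp : ‖p‖ = 1) {δ : ℝ}
    (h : ∀ u, PolK K u → ⟪p, u⟫ ≤ -δ) : gball p (Real.arcsin δ) ⊆ K := by
  rintro x ⟨hx, hd⟩
  rw [us_iff] at hx
  apply bipolar hS hc hne hx
  intro u hu huK
  have hu' : ‖-u‖ = 1 := by rwa [norm_neg]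
  have h2 : gdist p (-u) ≤ Real.arccos δ := by
    apply Real.arccos_le_arccos
    rw [inner_neg_right]; linarith [h u ⟨hu, huK⟩]
  have h3 := angle_le_angle_add_angle x p (-u)
  rw [angle_comm x p, ← gdist_eq_angle hp hx, ← gdist_eq_angle hp hu', ← gdist_eq_angle hx hu'] at h3
  rw [Real.arccos] at h2
  have h4 : gdist x (-u) ≤ π / 2 := by linarith
  rw [gdist_le_iff hx hu' (by positivity) (by linarith [pi_pos]), Real.cos_pi_div_two,
    inner_neg_right] at h4
  linarith

lemma hull_mem {K : Set (E 2)} (hK : IsConvexBody K) {p : E 2} (hp : ‖p‖ = 1)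
    (hb : gball p (inradius K) ⊆ K) :
    -(Real.sin (inradius K)) • p ∈ convexHull ℝ {u | PolK K u} := by
  have hr0 := inradius_pos hK
  obtain ⟨hS, hc, hi⟩ := hK
  have hr1 := radius_lt hS hp hb
  have hne : K.Nonempty := by obtain ⟨x, hx⟩ := hi; exact ⟨x, hx.1⟩
  set r := inradius K with hr
  have hU : IsCompact {u | PolK K u} := by
    have : {u | PolK K u} = Metric.sphere (0 : E 2) 1 ∩ ⋂ y ∈ K, {u | ⟪y, u⟫ ≤ 0} := by
      ext u; simp [PolK]
    rw [this]
    apply (isCompact_sphere _ _).inter_right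
    apply isClosed_biInter
    intro y _
    exact isClosed_le (by fun_prop) continuous_const
  have hUne : {u | PolK K u}.Nonempty := by
    obtain ⟨_, ⟨u, hu, h⟩, _⟩ := hS
    refine ⟨-u, by rw [norm_neg]; exact (us_iff u).1 hu, fun y hy => ?_⟩
    rw [inner_neg_right, real_inner_comm]; linarith [h y hy]
  have hC := isCompact_hull hU
  have hconv := convex_convexHull ℝ {u | PolK K u}
  obtain ⟨c, hcC, hmin⟩ := exists_norm_eq_iInf_of_complete_convex
    (hUne.mono (subset_convexHull ℝ _)) hC.isComplete hconv 0
  rw [norm_eq_iInf_iff_real_inner_le_zero hconv hcC] at hmin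
  have hs := Real.sin_pos_of_pos_of_lt_pi hr0 (by linarith [pi_pos])
  have hpc : ∀ d ∈ convexHull ℝ {u | PolK K u}, ⟪p, d⟫ ≤ -Real.sin r := by
    intro d hd
    have hcv : Convex ℝ {d : E 2 | ⟪p, d⟫ ≤ -Real.sin r} :=
      convex_halfSpace_le (f := fun d : E 2 => ⟪p, d⟫) ⟨fun x y => inner_add_right _ _ _, fun a x => by
        simp [inner_smul_right]⟩ _
    exact convexHull_min (fun u hu => ball_polar hp hr0 hr1 hb hu) hcv hd
  have hpc0 := hpc c hcC
  have hcs : -⟪p, c⟫ ≤ ‖c‖ := by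
    have := abs_real_inner_le_norm p c
    rw [hp, one_mul] at this
    exact (neg_le_abs _).trans this
  have hδ : 0 < ‖c‖ := by linarith
  have hge : ∀ u, PolK K u → ‖c‖ ^ 2 ≤ ⟪c, u⟫ := by
    intro u hu
    have := hmin u (subset_convexHull ℝ _ hu)
    rw [zero_sub, inner_neg_left, inner_sub_right, real_inner_self_eq_norm_sq] at this
    linarith
  have hδ1 : ‖c‖ ≤ 1 := by
    obtain ⟨u, hu⟩ := hUne
    have h1 := hge u hu
    have h2 := real_inner_le_norm c u
    rw [hu.1] at h2
    nlinarith
  have hball : gball (-(‖c‖⁻¹ • c)) (Real.arcsin ‖c‖) ⊆ K := by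
    refine ball_of_polar hS hc hne ?_ ?_
    swap
    · intro u hu
      rw [inner_neg_left, inner_smul_left]
      have := hge u hu
      simp only [conj_trivial]
      have h3 : ‖c‖ ≤ ‖c‖⁻¹ * ⟪c, u⟫ := by
        rw [inv_mul_eq_div, le_div_iff₀ hδ]; linarith
      linarith
    · rw [norm_neg, norm_smul, norm_inv, norm_norm]; field_simp
  have hle := le_inradius hS (by rw [norm_neg, norm_smul, norm_inv, norm_norm]; field_simp)
    (Real.arcsin_nonneg.2 hδ.le) hball
  have hle2 : ‖c‖ ≤ Real.sin r := by
    rw [← Real.sin_arcsin (by linarith) hδ1]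
    exact Real.sin_le_sin_of_le_of_le_pi_div_two (by linarith [Real.arcsin_nonneg.2 hδ.le, pi_pos])
      hr1.le hle
  have heq : ‖c‖ = Real.sin r := by linarith
  have : c = -(Real.sin r) • p := by
    rw [← sub_eq_zero, ← norm_eq_zero, ← sq_eq_zero_iff]
    have h1 : ‖c - -(Real.sin r) • p‖ ^ 2 = 2 * Real.sin r ^ 2 + 2 * Real.sin r * ⟪p, c⟫ := by
      rw [norm_sub_sq_real, inner_smul_right, norm_smul, hp, heq, real_inner_comm]
      simp; ring
    have h2 : 0 ≤ ‖c - -(Real.sin r) • p‖ ^ 2 := by positivity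
    nlinarith
  rw [← this]; exact hcC

lemma width_le {K : Set (E 2)} {u v : E 2} (hu : PolK K u) (hv : PolK K v) (h1 : u ≠ v)
    (h2 : u ≠ -v) (hKs : K ⊆ unitSphere 2) (hKu : ∃ x ∈ K, ⟪x, u⟫ = 0)
    (hKv : ∃ x ∈ K, ⟪x, v⟫ = 0) : width K ≤ Real.arccos (-⟪u, v⟫) := by
  rw [← breadth_eq hu.1 hv.1 h1 h2]
  apply csInf_le
  · refine ⟨0, ?_⟩
    rintro b ⟨u, v, _, rfl⟩
    exact Real.arccos_nonneg _
  · refine ⟨u, v, ⟨(us_iff u).2 hu.1, (us_iff v).2 hv.1, h1, h2, ?_, ?_, ?_⟩, rfl⟩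
    · intro x hx; exact ⟨hKs hx, hu.2 x hx, hv.2 x hx⟩
    · obtain ⟨x, hx, h⟩ := hKu
      exact ⟨x, hx, hKs hx, h, hv.2 x hx⟩
    · obtain ⟨x, hx, h⟩ := hKv
      exact ⟨x, hx, hKs hx, h, hu.2 x hx⟩

lemma two_r_le_width {K : Set (E 2)} {p : E 2} (hp : ‖p‖ = 1) {r : ℝ}
    (h0 : 0 < r) (h1 : r < π / 2) (hb : gball p r ⊆ K) (hw : 0 < width K) : 2 * r ≤ width K := by
  apply le_csInf
  · by_contra hne
    rw [Set.not_nonempty_iff_eq_empty] at hne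
    rw [width, hne, Real.sInf_empty] at hw
    exact lt_irrefl _ hw
  · rintro b ⟨u, v, ⟨hu, hv, huv, huv', hKl, _, _⟩, rfl⟩
    rw [us_iff] at hu hv
    rw [breadth_eq hu hv huv huv', ← Real.arccos_cos (x := 2 * r) (by linarith) (by linarith)]
    apply Real.arccos_le_arccos
    have a1 := ball_polar hp h0 h1 hb (u := u) ⟨hu, fun y hy => (hKl hy).2.1⟩
    have a2 := ball_polar hp h0 h1 hb (u := v) ⟨hv, fun y hy => (hKl hy).2.2⟩
    have hs := Real.sin_pos_of_pos_of_lt_pi h0 (by linarith [pi_pos])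
    have a3 := abs_real_inner_le_norm p (u + v)
    rw [hp, one_mul, inner_add_right] at a3
    have a4 := neg_le_of_abs_le a3
    have a5 : ‖u + v‖ ^ 2 = 2 + 2 * ⟪u, v⟫ := by
      rw [norm_add_sq_real, hu, hv]; ring
    have a6 : 2 * Real.sin r ≤ ‖u + v‖ := by linarith
    have a7 : (2 * Real.sin r) ^ 2 ≤ ‖u + v‖ ^ 2 := pow_le_pow_left₀ (by positivity) a6 2
    rw [Real.cos_two_mul]
    nlinarith [Real.sin_sq_add_cos_sq r]

lemma far_point {K : Set (E 2)} (hS : SConvex K) (hc : IsCompact K)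
    {w : ℝ} (hw0 : 0 < w) (hw : w ≤ π / 2) (hKw : width K = w) {u : E 2} (hu : PolK K u)
    (ht : ∃ x ∈ K, ⟪x, u⟫ = 0) (hneg : ∃ x ∈ K, ⟪x, u⟫ < 0) :
    ∃ q ∈ K, Real.sin w ≤ -⟪q, u⟫ := by
  have hne : K.Nonempty := by obtain ⟨x, hx, _⟩ := ht; exact ⟨x, hx⟩
  obtain ⟨x, hxK, hx⟩ := hc.exists_isMinOn hne (f := fun x : E 2 => ⟪x, u⟫) (by fun_prop)
  rw [isMinOn_iff] at hx
  refine ⟨x, hxK, ?_⟩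
  by_contra hlt
  push Not at hlt
  set σ := -⟪x, u⟫ with hσ
  have hσ0 : 0 < σ := by
    obtain ⟨y, hy, h⟩ := hneg
    have := hx y hy
    linarith
  have hσ1 : σ < 1 := lt_of_lt_of_le hlt (Real.sin_le_one w)
  have hxn := (us_iff x).1 (hS.1 hxK)
  have key : ∀ y ∈ K, 0 ≤ σ * ⟪x, y⟫ + ⟪y, u⟫ := by
    intro y hy
    have hyn := (us_iff y).1 (hS.1 hy)
    by_contra hη
    push Not at hη
    set g := ⟪x, y⟫ with hg
    obtain ⟨η, hηd⟩ : ∃ η, η = -(σ * g + ⟪y, u⟫) := ⟨_, rfl⟩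
    have hη0 : 0 < η := by linarith
    obtain ⟨hg1, hg2⟩ := inner_mem_Icc hxn hyn
    rw [← hg] at hg1 hg2
    set t := η / (1 + 2 * η) with ht
    have ht0 : 0 < t := by positivity
    have ht1 : t * (1 + 2 * η) = η := by rw [ht]; field_simp
    have ht2 : t < 1 := by nlinarith
    have hz2 : ‖x + t • y‖ ^ 2 = 1 + 2 * t * g + t ^ 2 := by
      rw [norm_add_sq_real, norm_smul, hxn, hyn, inner_smul_right, Real.norm_of_nonneg ht0.le, ← hg]
      ring
    have hzp : 0 < ‖x + t • y‖ := by
      rw [norm_pos_iff]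
      intro h0
      rw [h0] at hz2
      simp at hz2
      nlinarith
    have hzK : ‖x + t • y‖⁻¹ • (x + t • y) ∈ K := by
      apply bipolar hS hc hne
      · rw [norm_smul, norm_inv, norm_norm]; field_simp
      · intro v hv hvK
        rw [inner_smul_left, inner_add_left, inner_smul_left]
        simp only [conj_trivial]
        have := hvK x hxK
        have := mul_nonneg ht0.le (neg_nonneg.2 (hvK y hy))
        have := mul_nonneg (inv_nonneg.2 hzp.le) (show 0 ≤ -(⟪x, v⟫ + t * ⟪y, v⟫) by linarith)
        linarith
    have h1 := hx _ hzK
    rw [inner_smul_left, inner_add_left, inner_smul_left] at h1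
    simp only [conj_trivial] at h1
    rw [inv_mul_eq_div, le_div_iff₀ hzp] at h1
    have h2 : σ * (1 + t * g) + t * η ≤ σ * ‖x + t • y‖ := by
      have : ⟪y, u⟫ = -η - σ * g := by linarith
      rw [this] at h1
      have h3 : ⟪x, u⟫ = -σ := by linarith
      rw [h3] at h1
      nlinarith
    have htg : 0 < 1 + t * g := by nlinarith
    have h3 : (σ * (1 + t * g) + t * η) ^ 2 ≤ (σ * ‖x + t • y‖) ^ 2 :=
      pow_le_pow_left₀ (by positivity) h2 2
    rw [mul_pow, hz2] at h3
    have h4 : t * (σ * (2 * (1 + t * g) * η)) ≤ t * (σ * (σ * t)) := by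
      have := sq_nonneg (t * η)
      have := sq_nonneg (σ * t * g)
      nlinarith
    have h5 := le_of_mul_le_mul_left (le_of_mul_le_mul_left h4 ht0) hσ0
    have h6 : 2 * (1 - t) * η ≤ 2 * (1 + t * g) * η := by
      apply mul_le_mul_of_nonneg_right _ hη0.le
      nlinarith
    have h7 : σ * t ≤ t := by nlinarith
    nlinarith
  set C := Real.sqrt (1 - σ ^ 2) with hC
  have hσ2 : 0 < 1 - σ ^ 2 := by nlinarith
  have hC2 : C ^ 2 = 1 - σ ^ 2 := Real.sq_sqrt hσ2.le
  have hC0 : 0 < C := Real.sqrt_pos.2 hσ2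
  obtain ⟨v, hv⟩ : ∃ v : E 2, v = -(C⁻¹ • (u + σ • x)) := ⟨_, rfl⟩
  have hin : ∀ y : E 2, ⟪y, v⟫ = -(C⁻¹ * (⟪y, u⟫ + σ * ⟪y, x⟫)) := by
    intro y
    rw [hv, inner_neg_right, inner_smul_right, inner_add_right, inner_smul_right]
  have hxu : ⟪x, u⟫ = -σ := by linarith
  have hux : ⟪u, x⟫ = -σ := by rw [real_inner_comm]; exact hxu
  have hvn : ‖v‖ = 1 := by
    have h1 : ‖u + σ • x‖ ^ 2 = C ^ 2 := by
      rw [norm_add_sq_real, norm_smul, hxn, hu.1, inner_smul_right, hux, Real.norm_of_nonneg hσ0.le,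
        hC2]
      ring
    have h2 : ‖u + σ • x‖ = C := by
      rwa [sq_eq_sq₀ (norm_nonneg _) hC0.le] at h1
    rw [hv, norm_neg, norm_smul, h2, norm_inv, Real.norm_of_nonneg hC0.le]
    field_simp
  have huv : ⟪u, v⟫ = -C := by
    rw [hin, inner_self_one hu.1, hux]
    field_simp
    rw [hC2]; ring
  have hvP : PolK K v := by
    refine ⟨hvn, fun y hy => ?_⟩
    rw [hin, real_inner_comm]
    have := key y hy
    rw [real_inner_comm] at this
    have := mul_nonneg (inv_nonneg.2 hC0.le) this
    rw [real_inner_comm] at this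
    rw [real_inner_comm x y, real_inner_comm y u] at *
    nlinarith
  have hC1 : C < 1 := by nlinarith
  have hne1 : u ≠ v := by
    rintro h; rw [← h, inner_self_one hu.1] at huv; linarith
  have hne2 : u ≠ -v := by
    intro h
    have : v = -u := by rw [h, neg_neg]
    rw [this, inner_neg_right, inner_self_one hu.1] at huv; linarith
  have hle := width_le hu hvP hne1 hne2 hS.1 ht ⟨x, hxK, by
    rw [hin, hxu, inner_self_one hxn]; ring⟩
  rw [huv, neg_neg, hKw] at hle
  have h1 : Real.cos (Real.arccos C) ≤ Real.cos w :=
    Real.cos_le_cos_of_nonneg_of_le_pi hw0.le (Real.arccos_le_pi _) hle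
  rw [Real.cos_arccos (by linarith) hC1.le] at h1
  have h2 : C ^ 2 ≤ Real.cos w ^ 2 := pow_le_pow_left₀ hC0.le h1 2
  have h3 : σ ^ 2 < Real.sin w ^ 2 := pow_lt_pow_left₀ hlt hσ0.le (by norm_num)
  nlinarith [Real.sin_sq_add_cos_sq w]

lemma planar_aux {C κ A₁ A₂ f₁ f₂ L : ℝ} (hC : 0 < C) (hκ : 0 < κ) (hκ1 : κ < 1) (hA1 : 0 ≤ A₁)
    (hA2 : 0 ≤ A₂) (hA : A₁ ≤ κ * C) (hAC : A₁ ^ 2 + A₂ ^ 2 = C ^ 2) (hf : κ * L < f₁) (hL : 0 < L)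
    (hfL : f₁ ^ 2 + f₂ ^ 2 = L ^ 2) : A₁ * f₂ < A₂ * f₁ := by
  have hf0 : 0 < f₁ := lt_trans (by positivity) hf
  apply lt_of_pow_lt_pow_left₀ 2 (by positivity)
  have h1 : A₁ ^ 2 ≤ (κ * C) ^ 2 := pow_le_pow_left₀ hA1 hA 2
  have h2 : (κ * L) ^ 2 < f₁ ^ 2 := pow_lt_pow_left₀ hf (by positivity) (by norm_num)
  have hk : 0 < 1 - κ ^ 2 := by nlinarith
  rw [mul_pow, mul_pow]
  have h3 : C ^ 2 * (1 - κ ^ 2) ≤ A₂ ^ 2 := by nlinarith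
  have h4 : f₂ ^ 2 < L ^ 2 * (1 - κ ^ 2) := by nlinarith
  calc A₁ ^ 2 * f₂ ^ 2 ≤ (κ * C) ^ 2 * f₂ ^ 2 := by gcongr
    _ < (κ * C) ^ 2 * (L ^ 2 * (1 - κ ^ 2)) := by gcongr
    _ = (C ^ 2 * (1 - κ ^ 2)) * (κ * L) ^ 2 := by ring
    _ ≤ A₂ ^ 2 * f₁ ^ 2 := by gcongr

lemma planar_aux2 {C κ A₁ A₂ B₁ B₂ f₁ f₂ L : ℝ} (hC : 0 < C) (hκ : 0 < κ) (hκ1 : κ < 1)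
    (hA2 : 0 ≤ A₂) (hA : A₁ ≤ κ * C) (hAC : A₁ ^ 2 + A₂ ^ 2 = C ^ 2)
    (hB2 : 0 ≤ B₂) (hB : B₁ ≤ κ * C) (hBC : B₁ ^ 2 + B₂ ^ 2 = C ^ 2)
    (hAB : 0 < A₁ * B₂ + A₂ * B₁)
    (hf : κ * L < f₁) (hL : 0 < L) (hfL : f₁ ^ 2 + f₂ ^ 2 = L ^ 2) : 0 < A₁ * f₂ + A₂ * f₁ := by
  have hf0 : 0 < f₁ := lt_trans (by positivity) hf
  rcases le_or_gt 0 A₁ with h | h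
  · have := planar_aux (f₂ := -f₂) hC hκ hκ1 h hA2 hA hAC hf hL (by rw [neg_sq]; exact hfL)
    linarith
  · have hA2' : 0 < A₂ := by
      rcases hA2.eq_or_lt with h0 | h0
      · rw [← h0] at hAB; nlinarith
      · exact h0
    have hB1 : 0 < B₁ := by
      by_contra hB1; push Not at hB1; nlinarith
    rcases le_or_gt f₂ 0 with h2 | h2
    · nlinarith [mul_pos hA2' hf0]
    · have h3 := planar_aux (f₂ := f₂) hC hκ hκ1 hB1.le hB2 hB hBC hf hL hfL
      have h4 : 0 < B₁ * (A₁ * f₂ + A₂ * f₁) := by nlinarith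
      exact (mul_pos_iff_of_pos_left hB1).1 h4

/-- planar separation: directions of the cap stay in the open cone. -/
lemma planar_cap {C κ a₁ a₂ b₁ b₂ e₁ e₂ f₁ f₂ L : ℝ} (hC : 0 < C) (hκ : 0 < κ) (hκ1 : κ < 1)
    (he : e₁ ^ 2 + e₂ ^ 2 = 1) (ha : a₁ ^ 2 + a₂ ^ 2 = C ^ 2) (hb : b₁ ^ 2 + b₂ ^ 2 = C ^ 2)
    (hab : 0 < a₁ * b₂ - a₂ * b₁) (hae : 0 ≤ a₁ * e₂ - a₂ * e₁) (heb : 0 ≤ e₁ * b₂ - e₂ * b₁)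
    (ha' : a₁ * e₁ + a₂ * e₂ ≤ κ * C) (hb' : b₁ * e₁ + b₂ * e₂ ≤ κ * C)
    (hL : 0 < L) (hfL : f₁ ^ 2 + f₂ ^ 2 = L ^ 2) (hf : κ * L < f₁ * e₁ + f₂ * e₂) :
    0 < a₁ * f₂ - a₂ * f₁ ∧ 0 < f₁ * b₂ - f₂ * b₁ := by
  have lag : ∀ x y : ℝ, (x * e₁ + y * e₂) ^ 2 + (x * e₂ - y * e₁) ^ 2 = x ^ 2 + y ^ 2 := by
    intro x y
    calc _ = (x ^ 2 + y ^ 2) * (e₁ ^ 2 + e₂ ^ 2) := by ring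
      _ = _ := by rw [he, mul_one]
  have dt : ∀ x y z t : ℝ, x * t - y * z = (x * e₁ + y * e₂) * (e₁ * t - e₂ * z) +
      (x * e₂ - y * e₁) * (z * e₁ + t * e₂) := by
    intro x y z t
    calc _ = (x * t - y * z) * (e₁ ^ 2 + e₂ ^ 2) := by rw [he, mul_one]
      _ = _ := by ring
  have hAC := (lag a₁ a₂).trans ha
  have hBC : (b₁ * e₁ + b₂ * e₂) ^ 2 + (e₁ * b₂ - e₂ * b₁) ^ 2 = C ^ 2 := by
    rw [← hb, ← lag b₁ b₂]; ring
  have hF : (f₁ * e₁ + f₂ * e₂) ^ 2 + (e₁ * f₂ - e₂ * f₁) ^ 2 = L ^ 2 := by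
    rw [← hfL, ← lag f₁ f₂]; ring
  have hAB := hab
  rw [dt a₁ a₂ b₁ b₂] at hAB
  constructor
  · rw [dt a₁ a₂ f₁ f₂]
    exact planar_aux2 hC hκ hκ1 hae ha' hAC heb hb' hBC hAB hf hL hF
  · have := planar_aux2 (f₂ := -(e₁ * f₂ - e₂ * f₁)) hC hκ hκ1 heb hb' hBC hae ha' hAC
      (by linarith) hf hL (by rw [neg_sq]; exact hF)
    rw [dt f₁ f₂ b₁ b₂]
    nlinarith

lemma cone_sum {C a₁ a₂ b₁ b₂ y₁ y₂ : ℝ} (ha : a₁ ^ 2 + a₂ ^ 2 = C ^ 2)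
    (hb : b₁ ^ 2 + b₂ ^ 2 = C ^ 2)
    (hab : 0 < a₁ * b₂ - a₂ * b₁) (hay : 0 ≤ a₁ * y₂ - a₂ * y₁) (hyb : 0 ≤ y₁ * b₂ - y₂ * b₁) :
    0 ≤ (y₁ * a₁ + y₂ * a₂) + (y₁ * b₁ + y₂ * b₂) := by
  have hG : 0 ≤ C ^ 2 + (a₁ * b₁ + a₂ * b₂) := by
    nlinarith [sq_nonneg (a₁ + b₁), sq_nonneg (a₂ + b₂)]
  have h : (a₁ * b₂ - a₂ * b₁) * ((y₁ * a₁ + y₂ * a₂) + (y₁ * b₁ + y₂ * b₂)) =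
      ((a₁ * y₂ - a₂ * y₁) + (y₁ * b₂ - y₂ * b₁)) * (C ^ 2 + (a₁ * b₁ + a₂ * b₂)) := by
    have h1 : (a₁ * b₂ - a₂ * b₁) * ((y₁ * a₁ + y₂ * a₂) + (y₁ * b₁ + y₂ * b₂)) =
      (y₁ * b₂ - y₂ * b₁) * ((a₁ ^ 2 + a₂ ^ 2) + (a₁ * b₁ + a₂ * b₂)) +
      (a₁ * y₂ - a₂ * y₁) * ((b₁ ^ 2 + b₂ ^ 2) + (a₁ * b₁ + a₂ * b₂)) := by ring
    rw [h1, ha, hb]; ring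
  by_contra hneg
  push Not at hneg
  have h2 := mul_neg_of_pos_of_neg hab hneg
  have h3 := mul_nonneg (add_nonneg hay hyb) hG
  linarith

lemma cone_third {C a₁ a₂ b₁ b₂ c₁ c₂ y₁ y₂ l m n : ℝ} (ha : a₁ ^ 2 + a₂ ^ 2 = C ^ 2)
    (hb : b₁ ^ 2 + b₂ ^ 2 = C ^ 2) (hc : c₁ ^ 2 + c₂ ^ 2 = C ^ 2)
    (hl : 0 < l) (hm : 0 < m) (hn : 0 < n)
    (h1 : l * a₁ + m * b₁ + n * c₁ = 0) (h2 : l * a₂ + m * b₂ + n * c₂ = 0)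
    (hab : 0 < a₁ * b₂ - a₂ * b₁) (hca : 0 < c₁ * a₂ - c₂ * a₁)
    (hyab : (y₁ * a₁ + y₂ * a₂) + (y₁ * b₁ + y₂ * b₂) < 0)
    (hyac : (y₁ * c₁ + y₂ * c₂) + (y₁ * a₁ + y₂ * a₂) < 0) :
    0 ≤ b₁ * y₂ - b₂ * y₁ ∧ 0 ≤ y₁ * c₂ - y₂ * c₁ := by
  have hdep : l * (y₁ * a₂ - y₂ * a₁) + m * (y₁ * b₂ - y₂ * b₁) + n * (y₁ * c₂ - y₂ * c₁) = 0 := by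
    linear_combination y₁ * h2 - y₂ * h1
  have nab : ¬ (0 ≤ a₁ * y₂ - a₂ * y₁ ∧ 0 ≤ y₁ * b₂ - y₂ * b₁) := by
    rintro ⟨u, v⟩
    linarith [cone_sum ha hb hab u v]
  have nca : ¬ (0 ≤ c₁ * y₂ - c₂ * y₁ ∧ 0 ≤ y₁ * a₂ - y₂ * a₁) := by
    rintro ⟨u, v⟩
    linarith [cone_sum hc ha hca u v]
  constructor
  · by_contra h
    push Not at h
    have p1 : 0 < y₁ * b₂ - y₂ * b₁ := by linarith
    have p2 : 0 < y₁ * a₂ - y₂ * a₁ := by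
      by_contra h'; exact nab ⟨by linarith, p1.le⟩
    have p3 : 0 < y₁ * c₂ - y₂ * c₁ := by
      by_contra h'; exact nca ⟨by linarith, p2.le⟩
    nlinarith [mul_pos hl p2, mul_pos hm p1, mul_pos hn p3]
  · by_contra h
    push Not at h
    have p2 : y₁ * a₂ - y₂ * a₁ < 0 := by
      by_contra h'; exact nca ⟨by linarith, by linarith⟩
    have p1 : y₁ * b₂ - y₂ * b₁ < 0 := by
      by_contra h'; exact nab ⟨by linarith, by linarith⟩
    nlinarith [mul_neg_of_pos_of_neg hl p2, mul_neg_of_pos_of_neg hm p1, mul_neg_of_pos_of_neg hn h]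

lemma contact_mem {K : Set (E 2)} {p : E 2} (hp : ‖p‖ = 1) {r : ℝ} (h0 : 0 < r) (h1 : r < π / 2)
    (hb : gball p r ⊆ K) {u : E 2} (hu : ‖u‖ = 1) (hpu : ⟪p, u⟫ = -Real.sin r) :
    ∃ x ∈ K, ⟪x, u⟫ = 0 := by
  have hc := Real.cos_pos_of_mem_Ioo ⟨by linarith, h1⟩
  have hsc := Real.sin_sq_add_cos_sq r
  have hup : ⟪u, p⟫ = -Real.sin r := by rw [real_inner_comm]; exact hpu
  refine ⟨(Real.cos r)⁻¹ • (p + Real.sin r • u), ?_, ?_⟩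
  · apply hb
    rw [mem_gball_iff hp h0.le (by linarith [pi_pos])]
    have h2 : ‖p + Real.sin r • u‖ ^ 2 = Real.cos r ^ 2 := by
      rw [norm_add_sq_real, norm_smul, hu, hp, inner_smul_right, hpu, Real.norm_eq_abs, mul_one,
        sq_abs]
      linarith
    rw [sq_eq_sq₀ (norm_nonneg _) hc.le] at h2
    constructor
    · rw [norm_smul, h2, norm_inv, Real.norm_of_nonneg hc.le]; field_simp
    · rw [inner_smul_right, inner_add_right, inner_smul_right, inner_self_one hp, hpu]
      rw [inv_mul_eq_div, le_div_iff₀ hc]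
      nlinarith
  · rw [inner_smul_left, inner_add_left, inner_smul_left, inner_self_one hu, hpu]
    simp

lemma Frame.p_coord {p m₁ m₂ : E 2} (F : Frame p m₁ m₂) (hp : ‖p‖ = 1) :
    ⟪m₁, p⟫ = 0 ∧ ⟪m₂, p⟫ = 0 := by
  have h := (F.norm_iff p).1 hp
  rw [inner_self_one hp] at h
  constructor <;> nlinarith [sq_nonneg ⟪m₁, p⟫, sq_nonneg ⟪m₂, p⟫]

/-- `u` is the outer unit normal of a common supporting great circle of `K` and `B(p,r)`. -/
def Contact (K : Set (E 2)) (p : E 2) (r : ℝ) (u : E 2) : Prop :=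
  PolK K u ∧ ⟪p, u⟫ = -Real.sin r

lemma no_antipodal {K : Set (E 2)} {p m₁ m₂ : E 2} (F : Frame p m₁ m₂) (hp : ‖p‖ = 1) {r : ℝ}
    (h0 : 0 < r) (h1 : r < π / 2) (hKs : K ⊆ unitSphere 2)
    (hb : gball p r ⊆ K) (hw : 2 * r < width K) {u v : E 2} (hu : Contact K p r u)
    (hv : Contact K p r v) (e1 : ⟪m₁, u⟫ = -⟪m₁, v⟫) (e2 : ⟪m₂, u⟫ = -⟪m₂, v⟫) : False := by
  have hc := Real.cos_pos_of_mem_Ioo ⟨by linarith, h1⟩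
  have hs := Real.sin_pos_of_pos_of_lt_pi h0 (by linarith [pi_pos])
  have hsc := Real.sin_sq_add_cos_sq r
  have hvn := (F.norm_iff v).1 hv.1.1
  rw [hv.2] at hvn
  have huv : ⟪u, v⟫ = -Real.cos (2 * r) := by
    rw [F.1, hu.2, hv.2, e1, e2, Real.cos_two_mul]
    nlinarith
  have hne1 : u ≠ v := by
    rintro rfl
    have a : ⟪m₁, u⟫ = 0 := by linarith
    have b : ⟪m₂, u⟫ = 0 := by linarith
    rw [a, b] at hvn
    nlinarith
  have hne2 : u ≠ -v := by
    rintro rfl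
    have := hu.2
    rw [inner_neg_right, hv.2] at this
    linarith
  have := width_le hu.1 hv.1 hne1 hne2 hKs (contact_mem hp h0 h1 hb hu.1.1 hu.2)
    (contact_mem hp h0 h1 hb hv.1.1 hv.2)
  rw [huv, neg_neg, Real.arccos_cos (by linarith) (by linarith)] at this
  linarith

lemma hull_contact {K : Set (E 2)} (hK : IsConvexBody K) {p : E 2} (hp : ‖p‖ = 1)
    (hb : gball p (inradius K) ⊆ K) :
    -(Real.sin (inradius K)) • p ∈ convexHull ℝ {u | Contact K p (inradius K) u} := by
  obtain ⟨ι, _, z, w, hz, _, hw, hw1, hx⟩ :=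
    eq_pos_convex_span_of_mem_convexHull (hull_mem hK hp hb)
  have hr0 := inradius_pos hK
  have hr1 := radius_lt hK.1 hp hb
  set r := inradius K
  have hzP : ∀ i, PolK K (z i) := fun i => hz ⟨i, rfl⟩
  have hle : ∀ i, ⟪p, z i⟫ ≤ -Real.sin r := fun i => ball_polar hp hr0 hr1 hb (hzP i)
  have hsum : ∑ i, w i * ⟪p, z i⟫ = ∑ i, w i * (-Real.sin r) := by
    rw [← Finset.sum_mul, hw1, one_mul]
    have : ⟪p, ∑ i, w i • z i⟫ = -Real.sin r := by
      rw [hx, inner_smul_right, inner_self_one hp, mul_one]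
    rw [inner_sum] at this
    simpa only [inner_smul_right] using this
  rw [Finset.sum_eq_sum_iff_of_le (fun i _ => mul_le_mul_of_nonneg_left (hle i) (hw i).le)] at hsum
  rw [← hx]
  apply (convex_convexHull ℝ _).sum_mem (fun i _ => (hw i).le) hw1
  intro i _
  exact subset_convexHull ℝ _ ⟨hzP i, mul_left_cancel₀ (hw i).ne' (hsum i (Finset.mem_univ i))⟩

lemma pos_aux {a b : ℝ} (h : 0 < a * b) (ha : 0 ≤ a) : 0 < b := by
  by_contra hb
  push Not at hb
  linarith [mul_nonpos_of_nonneg_of_nonpos ha hb]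

lemma sq_add_sq_zero {a b : ℝ} (h : a ^ 2 + b ^ 2 = 0) : a = 0 ∧ b = 0 := by
  constructor
  · exact pow_eq_zero_iff (two_ne_zero) |>.1 (by linarith [sq_nonneg a, sq_nonneg b])
  · exact pow_eq_zero_iff (two_ne_zero) |>.1 (by linarith [sq_nonneg a, sq_nonneg b])

lemma cap_fin {C L γ ss x S cs : ℝ}
    (h : C ^ 2 * (L ^ 2 - 2 * γ * ss * x + γ ^ 2 * ss ^ 2) < (C * L - S * (γ * cs)) ^ 2) :
    γ ^ 2 * ((C * ss - S * cs) * (C * ss + S * cs)) <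
      2 * (γ * C) * (C * ss * x - S * cs * L) := by
  rw [← sub_pos] at h ⊢
  refine lt_of_lt_of_eq h ?_
  ring

set_option maxHeartbeats 1000000 in
lemma three_contacts {K : Set (E 2)} (hK : IsConvexBody K) {p m₁ m₂ : E 2} (F : Frame p m₁ m₂)
    (hp : ‖p‖ = 1) (hb : gball p (inradius K) ⊆ K) (hw : 2 * inradius K < width K) :
    ∃ u₁ u₂ u₃ : E 2, Contact K p (inradius K) u₁ ∧ Contact K p (inradius K) u₂ ∧
      Contact K p (inradius K) u₃ ∧
      ∃ l m n : ℝ, 0 < l ∧ 0 < m ∧ 0 < n ∧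
        l * ⟪m₁, u₁⟫ + m * ⟪m₁, u₂⟫ + n * ⟪m₁, u₃⟫ = 0 ∧
        l * ⟪m₂, u₁⟫ + m * ⟪m₂, u₂⟫ + n * ⟪m₂, u₃⟫ = 0 ∧
        0 < ⟪m₁, u₁⟫ * ⟪m₂, u₂⟫ - ⟪m₂, u₁⟫ * ⟪m₁, u₂⟫ := by
  have hr0 := inradius_pos hK
  have hr1 := radius_lt hK.1 hp hb
  have hh := hull_contact hK hp hb
  set r := inradius K
  have hc := Real.cos_pos_of_mem_Ioo ⟨by linarith, hr1⟩
  have hsc := Real.sin_sq_add_cos_sq r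
  have hnorm : ∀ u, Contact K p r u → ⟪m₁, u⟫ ^ 2 + ⟪m₂, u⟫ ^ 2 = Real.cos r ^ 2 := by
    intro u hu
    have := (F.norm_iff u).1 hu.1.1
    rw [hu.2] at this
    linarith
  let prj : E 2 →ₗ[ℝ] ℝ × ℝ := (innerSL ℝ m₁).toLinearMap.prod (innerSL ℝ m₂).toLinearMap
  have hπ : ∀ x, prj x = (⟪m₁, x⟫, ⟪m₂, x⟫) := fun x => rfl
  have h0 : (0 : ℝ × ℝ) ∈ convexHull ℝ (prj '' {u | Contact K p r u}) := by
    rw [← LinearMap.image_convexHull]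
    refine ⟨_, hh, ?_⟩
    rw [map_smul, hπ, (F.p_coord hp).1, (F.p_coord hp).2]
    simp
  obtain ⟨ι, _, z, w, hz, haff, hw0, hw1, hx⟩ := eq_pos_convex_span_of_mem_convexHull h0
  have hcard : Fintype.card ι ≤ 3 := by
    have h1 := haff.card_le_finrank_succ
    have h2 := Submodule.finrank_le (vectorSpan ℝ (Set.range z))
    have h3 : Module.finrank ℝ (ℝ × ℝ) = 2 := by simp
    omega
  have hinj := haff.injective
  have hz' : ∀ i, ∃ u, Contact K p r u ∧ prj u = z i := fun i => hz ⟨i, rfl⟩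
  choose u hu huz using hz'
  have hx1 : ∑ i, w i * ⟪m₁, u i⟫ = 0 := by
    have := congrArg Prod.fst hx
    rw [Prod.fst_sum] at this
    simpa [← huz, hπ] using this
  have hx2 : ∑ i, w i * ⟪m₂, u i⟫ = 0 := by
    have := congrArg Prod.snd hx
    rw [Prod.snd_sum] at this
    simpa [← huz, hπ] using this
  have hanti : ∀ i j, ⟪m₁, u i⟫ = -⟪m₁, u j⟫ → ⟪m₂, u i⟫ = -⟪m₂, u j⟫ → False :=
    fun i j e1 e2 => no_antipodal F hp hr0 hr1 hK.1.1 hb hw (hu i) (hu j) e1 e2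
  have hinj' : ∀ i j, ⟪m₁, u i⟫ = ⟪m₁, u j⟫ → ⟪m₂, u i⟫ = ⟪m₂, u j⟫ → i = j := by
    intro i j e1 e2
    apply hinj
    rw [← huz, ← huz, hπ, hπ, e1, e2]
  have hcases : Fintype.card ι = 0 ∨ Fintype.card ι = 1 ∨ Fintype.card ι = 2 ∨
    Fintype.card ι = 3 := by omega
  rcases hcases with h | h | h | h
  · rw [Fintype.card_eq_zero_iff] at h
    simp at hw1
  · let e := Fintype.equivFinOfCardEq h
    rw [← Equiv.sum_comp e.symm, Fin.sum_univ_one] at hx1 hx2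
    have a := hnorm _ (hu (e.symm 0))
    have hp0 := hw0 (e.symm 0)
    rw [(mul_eq_zero.1 hx1).resolve_left hp0.ne', (mul_eq_zero.1 hx2).resolve_left hp0.ne'] at a
    nlinarith
  · exfalso
    let e := Fintype.equivFinOfCardEq h
    rw [← Equiv.sum_comp e.symm, Fin.sum_univ_two] at hx1 hx2
    have a := hnorm _ (hu (e.symm 0))
    have b := hnorm _ (hu (e.symm 1))
    have p0 := hw0 (e.symm 0)
    have p1 := hw0 (e.symm 1)
    have hww : w (e.symm 0) = w (e.symm 1) := by
      have h1 : w (e.symm 0) ^ 2 * Real.cos r ^ 2 = w (e.symm 1) ^ 2 * Real.cos r ^ 2 := by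
        rw [← a]
        nth_rewrite 2 [a]
        rw [← b]
        linear_combination (w (e.symm 0) * ⟪m₁, u (e.symm 0)⟫ - w (e.symm 1) * ⟪m₁, u (e.symm 1)⟫) * hx1
          + (w (e.symm 0) * ⟪m₂, u (e.symm 0)⟫ - w (e.symm 1) * ⟪m₂, u (e.symm 1)⟫) * hx2
      have h2 := mul_right_cancel₀ (by positivity) h1
      rwa [sq_eq_sq₀ p0.le p1.le] at h2
    rw [hww] at hx1 hx2
    apply hanti (e.symm 0) (e.symm 1)
    · apply mul_left_cancel₀ p1.ne'; linarith
    · apply mul_left_cancel₀ p1.ne'; linarith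
  · let e := Fintype.equivFinOfCardEq h
    rw [← Equiv.sum_comp e.symm, Fin.sum_univ_three] at hx1 hx2
    have a := hnorm _ (hu (e.symm 0))
    have b := hnorm _ (hu (e.symm 1))
    rcases lt_trichotomy 0 (⟪m₁, u (e.symm 0)⟫ * ⟪m₂, u (e.symm 1)⟫ -
      ⟪m₂, u (e.symm 0)⟫ * ⟪m₁, u (e.symm 1)⟫) with hd | hd | hd
    · exact ⟨_, _, _, hu (e.symm 0), hu (e.symm 1), hu (e.symm 2), _, _, _, hw0 _, hw0 _, hw0 _,
        hx1, hx2, hd⟩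
    · exfalso
      have hne : e.symm 0 ≠ e.symm 1 := by simp
      set x := ⟪m₁, u (e.symm 0)⟫
      set y := ⟪m₂, u (e.symm 0)⟫
      set x' := ⟪m₁, u (e.symm 1)⟫
      set y' := ⟪m₂, u (e.symm 1)⟫
      have hg : (x * x' + y * y') ^ 2 = (Real.cos r ^ 2) ^ 2 := by
        have : (x * x' + y * y') ^ 2 = (x ^ 2 + y ^ 2) * (x' ^ 2 + y' ^ 2) - (x * y' - y * x') ^ 2 := by
          ring
        rw [this, ← hd, a, b]; ring
      rcases sq_eq_sq_iff_eq_or_eq_neg.1 hg with hg | hg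
      · apply hne
        have : (x - x') ^ 2 + (y - y') ^ 2 = 0 := by
          linear_combination a + b - 2 * hg
        have h0 := sq_add_sq_zero this
        exact hinj' _ _ (sub_eq_zero.1 h0.1) (sub_eq_zero.1 h0.2)
      · have : (x + x') ^ 2 + (y + y') ^ 2 = 0 := by
          linear_combination a + b + 2 * hg
        have h0 := sq_add_sq_zero this
        exact hanti (e.symm 0) (e.symm 1) (eq_neg_of_add_eq_zero_left h0.1)
          (eq_neg_of_add_eq_zero_left h0.2)
    · exact ⟨_, _, _, hu (e.symm 1), hu (e.symm 0), hu (e.symm 2), _, _, _, hw0 (e.symm 1),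
        hw0 (e.symm 0), hw0 (e.symm 2), by linarith, by linarith, by linarith⟩

lemma ball_sconvex {p : E 2} (hp : ‖p‖ = 1) {r : ℝ} (h0 : 0 < r) (h1 : r < π / 2) :
    SConvex (gball p r) := by
  have hc := Real.cos_pos_of_mem_Ioo ⟨by linarith, h1⟩
  have : gball p r = {x ∈ unitSphere 2 | Real.cos r * ‖x‖ ≤ ⟪p, x⟫} := by
    ext x
    rw [mem_gball_iff hp h0.le (by linarith [pi_pos])]
    simp only [Set.mem_ofPred_eq, us_iff]
    constructor
    · rintro ⟨a, b⟩; exact ⟨a, by rw [a, mul_one]; exact b⟩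
    · rintro ⟨a, b⟩; exact ⟨a, by rw [a, mul_one] at b; exact b⟩
  rw [this]
  refine sconvex_of_cone _ ?_ ?_ p hp ?_
  · intro x y hx hy
    rw [inner_add_right]
    have := mul_le_mul_of_nonneg_left (norm_add_le x y) hc.le
    linarith
  · intro a x ha hx
    rw [inner_smul_right, norm_smul, Real.norm_of_nonneg ha]
    have := mul_le_mul_of_nonneg_left hx ha
    linarith
  · intro x hx h
    rw [hx, mul_one] at h
    linarith

set_option maxHeartbeats 1000000 in
/-- Directions of points in a cap. -/
lemma cap_dir {p m₁ m₂ : E 2} (F : Frame p m₁ m₂) (hp : ‖p‖ = 1) {r s : ℝ} (h0 : 0 < r)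
    (hrs : r < s) (hs : s < π / 2) {q : E 2} {e₁ e₂ : ℝ} (he : e₁ ^ 2 + e₂ ^ 2 = 1)
    (hq0 : ⟪p, q⟫ = Real.cos s) (hq1 : ⟪m₁, q⟫ = Real.sin s * e₁) (hq2 : ⟪m₂, q⟫ = Real.sin s * e₂)
    {z : E 2} (hz : z ∈ sconv (gball p r ∪ {q}) \ gball p r) :
    ∃ L : ℝ, 0 < L ∧ ⟪m₁, z⟫ ^ 2 + ⟪m₂, z⟫ ^ 2 = L ^ 2 ∧
      Real.sin r * Real.cos s * L < Real.cos r * Real.sin s * (⟪m₁, z⟫ * e₁ + ⟪m₂, z⟫ * e₂) := by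
  have hc := Real.cos_pos_of_mem_Ioo (x := r) ⟨by linarith, by linarith⟩
  have hcs := Real.cos_pos_of_mem_Ioo (x := s) ⟨by linarith, by linarith⟩
  have hsr := Real.sin_pos_of_pos_of_lt_pi h0 (by linarith [pi_pos])
  have hss := Real.sin_pos_of_pos_of_lt_pi (h0.trans hrs) (by linarith [pi_pos])
  have hsc := Real.sin_sq_add_cos_sq r
  have hscs := Real.sin_sq_add_cos_sq s
  have hq : ‖q‖ = 1 := by
    rw [F.norm_iff, hq0, hq1, hq2]
    have : Real.cos s ^ 2 + (Real.sin s * e₁) ^ 2 + (Real.sin s * e₂) ^ 2 =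
      Real.cos s ^ 2 + Real.sin s ^ 2 * (e₁ ^ 2 + e₂ ^ 2) := by ring
    rw [this, he]; linarith
  have hconv : SConvex {x ∈ unitSphere 2 | ∃ γ : ℝ, 0 ≤ γ ∧
      Real.cos r * ‖x - γ • q‖ ≤ ⟪p, x - γ • q⟫} := by
    refine sconvex_of_cone _ ?_ ?_ p hp ?_
    · rintro x y ⟨γ, hγ, hx⟩ ⟨γ', hγ', hy⟩
      refine ⟨γ + γ', add_nonneg hγ hγ', ?_⟩
      have : x + y - (γ + γ') • q = (x - γ • q) + (y - γ' • q) := by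
        rw [add_smul]; abel
      rw [this, inner_add_right]
      have := mul_le_mul_of_nonneg_left (norm_add_le (x - γ • q) (y - γ' • q)) hc.le
      linarith
    · rintro a x ha ⟨γ, hγ, hx⟩
      refine ⟨a * γ, mul_nonneg ha hγ, ?_⟩
      have : a • x - (a * γ) • q = a • (x - γ • q) := by
        rw [smul_sub, smul_smul]
      rw [this, inner_smul_right, norm_smul, Real.norm_of_nonneg ha]
      have := mul_le_mul_of_nonneg_left hx ha
      linarith
    · rintro x hx ⟨γ, hγ, h⟩
      rw [inner_sub_right, inner_smul_right, hq0] at h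
      rcases hγ.eq_or_lt with rfl | hγ
      · simp only [zero_smul, sub_zero, zero_mul, hx, mul_one] at h
        linarith
      · have := mul_pos hγ hcs
        have := mul_nonneg hc.le (norm_nonneg (x - γ • q))
        linarith
  have hmem := hz.1 _ ⟨hconv, by
    rintro x (hx | hx)
    · rw [mem_gball_iff hp h0.le (by linarith [pi_pos])] at hx
      exact ⟨(us_iff x).2 hx.1, 0, le_rfl, by simpa [hx.1] using hx.2⟩
    · rw [Set.mem_singleton_iff] at hx
      subst hx
      exact ⟨(us_iff x).2 hq, 1, zero_le_one, by simp⟩⟩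
  obtain ⟨hzn, γ, hγ, hb⟩ := hmem
  rw [us_iff] at hzn
  have hzB : ⟪p, z⟫ < Real.cos r := by
    by_contra h
    push Not at h
    exact hz.2 ((mem_gball_iff hp h0.le (by linarith [pi_pos])).2 ⟨hzn, h⟩)
  have hzc := (F.norm_iff z).1 hzn
  -- coordinates of `b = z - γ q`
  have hbn : ‖z - γ • q‖ ^ 2 = (⟪p, z⟫ - γ * Real.cos s) ^ 2 + (⟪m₁, z⟫ - γ * (Real.sin s * e₁)) ^ 2
      + (⟪m₂, z⟫ - γ * (Real.sin s * e₂)) ^ 2 := by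
    rw [← real_inner_self_eq_norm_sq, F.1]
    simp only [inner_sub_right, inner_smul_right, hq0, hq1, hq2]
    ring
  have hb0 : ⟪p, z - γ • q⟫ = ⟪p, z⟫ - γ * Real.cos s := by
    rw [inner_sub_right, inner_smul_right, hq0]
  rw [hb0] at hb
  have hβ : 0 ≤ ⟪p, z⟫ - γ * Real.cos s := le_trans (by positivity) hb
  have hb2 : (Real.cos r * ‖z - γ • q‖) ^ 2 ≤ (⟪p, z⟫ - γ * Real.cos s) ^ 2 :=
    pow_le_pow_left₀ (by positivity) hb 2
  rw [mul_pow, hbn] at hb2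
  set c := ⟪p, z⟫
  set f₁ := ⟪m₁, z⟫
  set f₂ := ⟪m₂, z⟫
  obtain ⟨β, hβd⟩ : ∃ β, β = c - γ * Real.cos s := ⟨_, rfl⟩
  rw [← hβd] at hb2 hβ
  have hγc := mul_nonneg hγ hcs.le
  have hc0 : 0 ≤ c := by linarith
  have hL2 : 0 < f₁ ^ 2 + f₂ ^ 2 := by nlinarith
  set L := Real.sqrt (f₁ ^ 2 + f₂ ^ 2) with hL
  have hLL : L ^ 2 = f₁ ^ 2 + f₂ ^ 2 := Real.sq_sqrt hL2.le
  have hL0 : 0 < L := Real.sqrt_pos.2 hL2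
  refine ⟨L, hL0, hLL.symm, ?_⟩
  have hLc : Real.sin r * c < Real.cos r * L := by
    apply lt_of_pow_lt_pow_left₀ 2 (by positivity)
    rw [mul_pow, mul_pow, hLL]
    nlinarith
  set S := Real.sin r
  set C := Real.cos r
  set ss := Real.sin s
  set cs := Real.cos s
  have hlt : S * β < C * L - S * (γ * cs) := by rw [hβd]; linarith
  have hlt2 : (S * β) ^ 2 < (C * L - S * (γ * cs)) ^ 2 :=
    pow_lt_pow_left₀ hlt (by positivity) (by norm_num)
  have hexp : (f₁ - γ * (ss * e₁)) ^ 2 + (f₂ - γ * (ss * e₂)) ^ 2 =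
      L ^ 2 - 2 * γ * ss * (f₁ * e₁ + f₂ * e₂) + γ ^ 2 * ss ^ 2 := by
    rw [hLL]
    linear_combination (γ ^ 2 * ss ^ 2) * he
  have hkey : C ^ 2 * (L ^ 2 - 2 * γ * ss * (f₁ * e₁ + f₂ * e₂) + γ ^ 2 * ss ^ 2) ≤ (S * β) ^ 2 := by
    rw [← hexp]
    have : S ^ 2 * β ^ 2 = β ^ 2 - C ^ 2 * β ^ 2 := by
      linear_combination (β ^ 2) * hsc
    rw [mul_pow, this]
    linarith
  have hpos : 0 < C * ss - S * cs := by
    have := Real.sin_pos_of_pos_of_lt_pi (x := s - r) (by linarith) (by linarith)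
    rw [Real.sin_sub] at this
    linarith
  have hfin : γ ^ 2 * ((C * ss - S * cs) * (C * ss + S * cs)) <
      2 * (γ * C) * (C * ss * (f₁ * e₁ + f₂ * e₂) - S * cs * L) :=
    cap_fin (lt_of_le_of_lt hkey hlt2)
  have h2 : 0 ≤ γ ^ 2 * ((C * ss - S * cs) * (C * ss + S * cs)) := by positivity
  have h3 := lt_of_le_of_lt h2 hfin
  have h4 : 0 ≤ 2 * (γ * C) := by positivity
  have := pos_aux h3 h4
  linarith

set_option maxHeartbeats 1000000 in
/-- One cap, lying in the angular sector opposite to the contact normal `a`. -/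
lemma one_cap {K : Set (E 2)} (hK : IsConvexBody K) {p m₁ m₂ : E 2} (F : Frame p m₁ m₂)
    (hp : ‖p‖ = 1) {r w : ℝ} (hr0 : 0 < r) (hb : gball p r ⊆ K) (hw0 : 0 < w)
    (hw : w ≤ π / 2) (hKw : width K = w) (h2r : 2 * r < w) {a b c : E 2}
    (ha : Contact K p r a) (hbb : Contact K p r b) (hc : Contact K p r c) {l m n : ℝ}
    (hl : 0 < l) (hm : 0 < m) (hn : 0 < n)
    (h1 : l * ⟪m₁, a⟫ + m * ⟪m₁, b⟫ + n * ⟪m₁, c⟫ = 0)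
    (h2 : l * ⟪m₂, a⟫ + m * ⟪m₂, b⟫ + n * ⟪m₂, c⟫ = 0)
    (hab : 0 < ⟪m₁, a⟫ * ⟪m₂, b⟫ - ⟪m₂, a⟫ * ⟪m₁, b⟫)
    (hbc : 0 < ⟪m₁, b⟫ * ⟪m₂, c⟫ - ⟪m₂, b⟫ * ⟪m₁, c⟫)
    (hca : 0 < ⟪m₁, c⟫ * ⟪m₂, a⟫ - ⟪m₂, c⟫ * ⟪m₁, a⟫) :
    ∃ q ∈ K, gdist p q = w - r ∧ ∀ z ∈ sconv (gball p r ∪ {q}) \ gball p r,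
      0 < ⟪m₁, b⟫ * ⟪m₂, z⟫ - ⟪m₂, b⟫ * ⟪m₁, z⟫ ∧
      0 < ⟪m₁, z⟫ * ⟪m₂, c⟫ - ⟪m₂, z⟫ * ⟪m₁, c⟫ := by
  have hpi := pi_pos
  have hr1 : r < π / 2 := by linarith
  have hcr := Real.cos_pos_of_mem_Ioo (x := r) ⟨by linarith, by linarith⟩
  have hsr := Real.sin_pos_of_pos_of_lt_pi hr0 (by linarith)
  have hsc := Real.sin_sq_add_cos_sq r
  have hpK : p ∈ K := hb ((mem_gball_iff hp hr0.le (by linarith)).2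
    ⟨hp, by rw [inner_self_one hp]; exact Real.cos_le_one r⟩)
  have hnorm : ∀ u, Contact K p r u → ⟪m₁, u⟫ ^ 2 + ⟪m₂, u⟫ ^ 2 = Real.cos r ^ 2 := by
    intro u hu
    have := (F.norm_iff u).1 hu.1.1
    rw [hu.2] at this
    linarith
  obtain ⟨Q, hQK, hQ⟩ := far_point hK.1 hK.2.1 hw0 hw hKw ha.1
    (contact_mem hp hr0 hr1 hb ha.1.1 ha.2) ⟨p, hpK, by rw [ha.2]; linarith⟩
  have hQn : ‖Q‖ = 1 := (us_iff Q).1 (hK.1.1 hQK)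
  obtain ⟨s, hs⟩ : ∃ s, s = w - r := ⟨_, rfl⟩
  have hrs : r < s := by linarith
  have hs2 : s < π / 2 := by linarith
  have hcs := Real.cos_pos_of_mem_Ioo (x := s) ⟨by linarith, by linarith⟩
  have hss := Real.sin_pos_of_pos_of_lt_pi (x := s) (by linarith) (by linarith)
  have hscs := Real.sin_sq_add_cos_sq s
  -- `⟪p,Q⟫ ≤ cos s`
  have hcQ : ⟪p, Q⟫ ≤ Real.cos s := by
    have hna : ‖-a‖ = 1 := by rw [norm_neg]; exact ha.1.1
    have tri := InnerProductGeometry.angle_le_angle_add_angle p Q (-a)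
    rw [← gdist_eq_angle hp hna, ← gdist_eq_angle hp hQn, ← gdist_eq_angle hQn hna] at tri
    have e1 : gdist p (-a) = π / 2 - r := by
      rw [gdist, inner_neg_right, ha.2, neg_neg, ← Real.cos_pi_div_two_sub,
        Real.arccos_cos (by linarith) (by linarith)]
    have e2 : gdist Q (-a) ≤ π / 2 - w := by
      rw [gdist_le_iff hQn hna (by linarith) (by linarith), Real.cos_pi_div_two_sub,
        inner_neg_right]
      exact hQ
    have e3 : s ≤ gdist p Q := by linarith
    have hI := inner_mem_Icc hp hQn
    have e4 : Real.cos (gdist p Q) = ⟪p, Q⟫ := Real.cos_arccos hI.1 hI.2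
    rw [← e4]
    exact Real.cos_le_cos_of_nonneg_of_le_pi (by linarith) (Real.arccos_le_pi _) e3
  have hcr' : Real.cos s ≤ Real.cos r :=
    Real.cos_le_cos_of_nonneg_of_le_pi hr0.le (by linarith) hrs.le
  have hQc := (F.norm_iff Q).1 hQn
  have hin : ∀ u, Contact K p r u → ∀ x, ⟪x, u⟫ =
      ⟪m₁, x⟫ * ⟪m₁, u⟫ + ⟪m₂, x⟫ * ⟪m₂, u⟫ - ⟪p, x⟫ * Real.sin r := by
    intro u hu x
    rw [F.1, hu.2]; ring
  have ka := ha.1.2 Q hQK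
  have kb := hbb.1.2 Q hQK
  have kc := hc.1.2 Q hQK
  rw [hin a ha] at ka hQ
  rw [hin b hbb] at kb
  rw [hin c hc] at kc
  set c₀ := ⟪p, Q⟫ with hc₀
  set y₁ := ⟪m₁, Q⟫ with hy₁
  set y₂ := ⟪m₂, Q⟫ with hy₂
  have hc0 : 0 ≤ c₀ := by
    have t1 := mul_nonneg hl.le (sub_nonneg.2 ka)
    have t2 := mul_nonneg hm.le (sub_nonneg.2 kb)
    have t3 := mul_nonneg hn.le (sub_nonneg.2 kc)
    have t4 : 0 ≤ (c₀ * Real.sin r) * (l + m + n) := by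
      have : (c₀ * Real.sin r) * (l + m + n) =
        l * (0 - (y₁ * ⟪m₁, a⟫ + y₂ * ⟪m₂, a⟫ - c₀ * Real.sin r)) +
        m * (0 - (y₁ * ⟪m₁, b⟫ + y₂ * ⟪m₂, b⟫ - c₀ * Real.sin r)) +
        n * (0 - (y₁ * ⟪m₁, c⟫ + y₂ * ⟪m₂, c⟫ - c₀ * Real.sin r)) := by
        linear_combination y₁ * h1 + y₂ * h2
      rw [this]; linarith
    have t5 := nonneg_of_mul_nonneg_left t4 (by linarith)
    exact nonneg_of_mul_nonneg_left t5 hsr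
  have hsw : 2 * (c₀ * Real.sin r) < Real.sin w := by
    have t1 : Real.sin (2 * r) < Real.sin w :=
      Real.sin_lt_sin_of_lt_of_le_pi_div_two (by linarith) hw h2r
    rw [Real.sin_two_mul] at t1
    have t2 := mul_le_mul_of_nonneg_right (hcQ.trans hcr') hsr.le
    linarith
  have hy := cone_third (y₁ := y₁) (y₂ := y₂) (hnorm a ha) (hnorm b hbb) (hnorm c hc) hl hm hn
    h1 h2 hab hca (by linarith) (by linarith)
  have hD2 : Real.sin s ^ 2 ≤ y₁ ^ 2 + y₂ ^ 2 := by
    have := pow_le_pow_left₀ hc0 hcQ 2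
    linarith
  have hDp : 0 < y₁ ^ 2 + y₂ ^ 2 := lt_of_lt_of_le (by positivity) hD2
  obtain ⟨D, hD⟩ : ∃ D, D = Real.sqrt (y₁ ^ 2 + y₂ ^ 2) := ⟨_, rfl⟩
  have hDD : D ^ 2 = y₁ ^ 2 + y₂ ^ 2 := by rw [hD]; exact Real.sq_sqrt hDp.le
  have hD0 : 0 < D := by rw [hD]; exact Real.sqrt_pos.2 hDp
  have hsD : Real.sin s ≤ D := by rw [hD]; exact Real.le_sqrt_of_sq_le hD2
  obtain ⟨q, q0, q1, q2⟩ := F.2 (Real.cos s) (Real.sin s * (y₁ / D)) (Real.sin s * (y₂ / D))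
  have he : (y₁ / D) ^ 2 + (y₂ / D) ^ 2 = 1 := by
    rw [div_pow, div_pow, ← add_div, ← hDD, div_self (by positivity)]
  have hqn : ‖q‖ = 1 := by
    rw [F.norm_iff, q0, q1, q2]
    linear_combination (Real.sin s ^ 2) * he + hscs
  have hγ0 : 0 ≤ Real.sin s / D := by positivity
  have hγ1 : Real.sin s / D ≤ 1 := (div_le_one hD0).2 hsD
  have hqK : q ∈ K := by
    refine bipolar hK.1 hK.2.1 ⟨p, hpK⟩ hqn ?_
    intro u hu hpol
    have p1 := hpol p hpK
    have p2 := hpol Q hQK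
    have e1 : ⟪q, u⟫ = (Real.cos s - Real.sin s / D * c₀) * ⟪p, u⟫ + Real.sin s / D * ⟪Q, u⟫ := by
      rw [F.1 q u, F.1 Q u, q0, q1, q2]
      ring
    have p3 : Real.sin s / D * c₀ ≤ Real.cos s :=
      (mul_le_of_le_one_left hc0 hγ1).trans hcQ
    rw [e1]
    have p4 := mul_nonpos_of_nonneg_of_nonpos (sub_nonneg.2 p3) p1
    have p5 := mul_nonpos_of_nonneg_of_nonpos hγ0 p2
    linarith
  have hgd : gdist p q = w - r := by
    rw [gdist, q0, Real.arccos_cos (by linarith) (by linarith), hs]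
  refine ⟨q, hqK, hgd, ?_⟩
  intro z hz
  obtain ⟨L, hL0, hL, hdir⟩ := cap_dir F hp hr0 hrs hs2 he q0 q1 q2 hz
  have hM : 0 < Real.cos r * Real.sin s := by positivity
  have hκ1 : Real.sin r * Real.cos s / (Real.cos r * Real.sin s) < 1 := by
    rw [div_lt_one hM]
    have := Real.sin_pos_of_pos_of_lt_pi (x := s - r) (by linarith) (by linarith)
    rw [Real.sin_sub] at this
    linarith
  have hκ : ∀ u, Contact K p r u → ⟪m₁, u⟫ * (y₁ / D) + ⟪m₂, u⟫ * (y₂ / D) ≤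
      Real.sin r * Real.cos s / (Real.cos r * Real.sin s) * Real.cos r := by
    intro u hu
    have t := hu.1.2 q hqK
    rw [hin u hu, q0, q1, q2] at t
    have e1 : Real.sin r * Real.cos s / (Real.cos r * Real.sin s) * Real.cos r =
        Real.sin r * Real.cos s / Real.sin s := by
      field_simp
    rw [e1, le_div_iff₀ hss]
    linarith
  exact planar_cap hcr (by positivity) hκ1 he (hnorm b hbb) (hnorm c hc) hbc
    (by
      have : ⟪m₁, b⟫ * (y₂ / D) - ⟪m₂, b⟫ * (y₁ / D) = (⟪m₁, b⟫ * y₂ - ⟪m₂, b⟫ * y₁) / D := by ring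
      rw [this]; exact div_nonneg hy.1 hD0.le)
    (by
      have : y₁ / D * ⟪m₂, c⟫ - y₂ / D * ⟪m₁, c⟫ = (y₁ * ⟪m₂, c⟫ - y₂ * ⟪m₁, c⟫) / D := by ring
      rw [this]; exact div_nonneg hy.2 hD0.le)
    (hκ b hbb) (hκ c hc) hL0 hL
    (by rw [div_mul_eq_mul_div, div_lt_iff₀ hM]; linarith)

/-- the cap-domain construction: for a convex body `K ⊂ S²` of width
`0 < w ≤ π/2` with incircle `B(p, r(K)) ⊆ K`, there are `q₁, q₂, q₃ ∈ K` at geodesic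
distance `w - r(K)` from `p` whose corresponding caps have pairwise disjoint interiors. -/
theorem cap_domain (w : ℝ) (hw0 : 0 < w) (hw : w ≤ π / 2)
    (K : Set (E 2)) (hK : IsConvexBody K) (hKw : width K = w)
    (p : E 2) (hp : p ∈ unitSphere 2) (hball : gball p (inradius K) ⊆ K) :
    ∃ q : Fin 3 → E 2,
      (∀ i, q i ∈ K ∧ gdist p (q i) = w - inradius K) ∧
      ∀ i j, i ≠ j →
        Disjoint
          (sInterior (sconv (gball p (inradius K) ∪ {q i}) \ gball p (inradius K)))
          (sInterior (sconv (gball p (inradius K) ∪ {q j}) \ gball p (inradius K))) := by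
  have hp1 : ‖p‖ = 1 := (us_iff p).1 hp
  have hr0 := inradius_pos hK
  have hr1 := radius_lt hK.1 hp1 hball
  have h2r := two_r_le_width hp1 hr0 hr1 hball (by rw [hKw]; exact hw0)
  obtain ⟨m₁, m₂, F⟩ := exists_frame hp1
  rcases h2r.eq_or_lt with h | h
  · obtain ⟨q, q0, q1, q2⟩ := F.2 (Real.cos (inradius K)) (Real.sin (inradius K)) 0
    have hqn : ‖q‖ = 1 := by
      rw [F.norm_iff, q0, q1, q2]
      linarith [Real.sin_sq_add_cos_sq (inradius K)]
    have hqB : q ∈ gball p (inradius K) :=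
      (mem_gball_iff hp1 hr0.le (by linarith [pi_pos])).2 ⟨hqn, q0.ge⟩
    refine ⟨fun _ => q, fun _ => ⟨hball hqB, ?_⟩, ?_⟩
    · rw [gdist, q0, Real.arccos_cos hr0.le (by linarith [pi_pos])]
      linarith
    · intro i j _
      rw [Set.disjoint_left]
      intro x hx _
      apply hx.1.2
      refine hx.1.1 _ ⟨ball_sconvex hp1 hr0 hr1, ?_⟩
      rintro y (hy | hy)
      · exact hy
      · rw [Set.mem_singleton_iff.1 hy]; exact hqB
  · obtain ⟨u₁, u₂, u₃, c1, c2, c3, l, m, n, hl, hm, hn, e1, e2, d12⟩ :=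
      three_contacts hK F hp1 hball h
    have d23 : 0 < ⟪m₁, u₂⟫ * ⟪m₂, u₃⟫ - ⟪m₂, u₂⟫ * ⟪m₁, u₃⟫ := by
      have : n * (⟪m₁, u₂⟫ * ⟪m₂, u₃⟫ - ⟪m₂, u₂⟫ * ⟪m₁, u₃⟫) =
          l * (⟪m₁, u₁⟫ * ⟪m₂, u₂⟫ - ⟪m₂, u₁⟫ * ⟪m₁, u₂⟫) := by
        linear_combination ⟪m₁, u₂⟫ * e2 - ⟪m₂, u₂⟫ * e1
      exact pos_aux (this ▸ mul_pos hl d12) hn.le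
    have d31 : 0 < ⟪m₁, u₃⟫ * ⟪m₂, u₁⟫ - ⟪m₂, u₃⟫ * ⟪m₁, u₁⟫ := by
      have : n * (⟪m₁, u₃⟫ * ⟪m₂, u₁⟫ - ⟪m₂, u₃⟫ * ⟪m₁, u₁⟫) =
          m * (⟪m₁, u₁⟫ * ⟪m₂, u₂⟫ - ⟪m₂, u₁⟫ * ⟪m₁, u₂⟫) := by
        linear_combination ⟪m₂, u₁⟫ * e1 - ⟪m₁, u₁⟫ * e2
      exact pos_aux (this ▸ mul_pos hm d12) hn.le
    have h' : 2 * inradius K < w := by rw [← hKw]; exact h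
    obtain ⟨q1, k1, g1, z1⟩ := one_cap hK F hp1 hr0 hball hw0 hw hKw h' c1 c2 c3 hl hm hn
      e1 e2 d12 d23 d31
    obtain ⟨q2, k2, g2, z2⟩ := one_cap hK F hp1 hr0 hball hw0 hw hKw h' c2 c3 c1 hm hn hl
      (by linarith) (by linarith) d23 d31 d12
    obtain ⟨q3, k3, g3, z3⟩ := one_cap hK F hp1 hr0 hball hw0 hw hKw h' c3 c1 c2 hn hl hm
      (by linarith) (by linarith) d31 d12 d23
    refine ⟨![q1, q2, q3], ?_, ?_⟩
    · intro i
      fin_cases i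
      · exact ⟨k1, g1⟩
      · exact ⟨k2, g2⟩
      · exact ⟨k3, g3⟩
    · intro i j hij
      rw [Set.disjoint_left]
      intro x hx hy
      have hx1 := hx.1
      have hy1 := hy.1
      fin_cases i <;> fin_cases j
      · exact hij rfl
      · linarith [(z1 x hx1).2, (z2 x hy1).1]
      · linarith [(z1 x hx1).1, (z3 x hy1).2]
      · linarith [(z2 x hx1).1, (z1 x hy1).2]
      · exact hij rfl
      · linarith [(z2 x hx1).2, (z3 x hy1).1]
      · linarith [(z3 x hx1).2, (z1 x hy1).1]
      · linarith [(z3 x hx1).1, (z2 x hy1).2]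
      · exact hij rfl
end
end

section
/- Let K ⊂ S² be a convex body of width w with 0 < w ≤ π/2 whose incircle B = B(p, r(K)) is not all of K, let t₁, t₂, t₃ ∈ ∂K ∩ ∂B be contact points with p in the interior of the spherical triangle [t₁,t₂,t₃], and let q₁, q₂, q₃ ∈ K be points with d(p,qᵢ) = w − r(K) such that the caps (conv(B ∪ {qᵢ})) \ B have pairwise disjoint interiors. Set η = r(K) − r(T_w), where T_w is a regular spherical triangle of width w. Then there exists a constant c_w > 0 depending only on w such that for all i ≠ j: 2π/3 − c_w·η ≤ ∠(tᵢ, p, tⱼ) ≤ 2π/3 + c_w·η and 2π/3 − c_w·η ≤ ∠(qᵢ, p, qⱼ) ≤ 2π/3 + c_w·η. -/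
open scoped RealInnerProductSpace
open Real MeasureTheory

noncomputable section

open SphericalPal

namespace SphericalPal

lemma unit_inner {n : ℕ} {x : E n} (hx : x ∈ unitSphere n) : ⟪x, x⟫ = 1 := by
  have : ‖x‖ = 1 := by simpa [unitSphere] using hx
  rw [real_inner_self_eq_norm_sq, this]; norm_num

lemma unit_norm {n : ℕ} {x : E n} (hx : x ∈ unitSphere n) : ‖x‖ = 1 := by
  simpa [unitSphere] using hx

lemma unit_of_inner {n : ℕ} {x : E n} (hx : ⟪x, x⟫ = 1) : x ∈ unitSphere n := by
  rw [real_inner_self_eq_norm_sq] at hx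
  have : ‖x‖ = 1 := by nlinarith [norm_nonneg x]
  simpa [unitSphere] using this

lemma unit_inner_bounds {n : ℕ} {x y : E n} (hx : x ∈ unitSphere n) (hy : y ∈ unitSphere n) :
    -1 ≤ ⟪x, y⟫ ∧ ⟪x, y⟫ ≤ 1 := by
  have h := abs_real_inner_le_norm x y
  rw [unit_norm hx, unit_norm hy] at h
  have := abs_le.1 h
  constructor <;> linarith [this.1, this.2]

lemma cos_gdist {n : ℕ} {x y : E n} (hx : x ∈ unitSphere n) (hy : y ∈ unitSphere n) :
    Real.cos (gdist x y) = ⟪x, y⟫ :=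
  Real.cos_arccos (unit_inner_bounds hx hy).1 (unit_inner_bounds hx hy).2

lemma norm_sub_le_gdist {n : ℕ} {x y : E n} (hx : x ∈ unitSphere n) (hy : y ∈ unitSphere n) :
    ‖x - y‖ ≤ gdist x y := by
  have h0 : 0 ≤ gdist x y := Real.arccos_nonneg _
  have h1 := Real.one_sub_sq_div_two_le_cos (x := gdist x y)
  rw [cos_gdist hx hy] at h1
  have h2 : ‖x - y‖ ^ 2 = 2 - 2 * ⟪x, y⟫ := by
    rw [norm_sub_sq_real, unit_norm hx, unit_norm hy]; ring
  exact abs_le_of_sq_le_sq' (by nlinarith) h0 |>.2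

lemma seg_of_comb {n : ℕ} {x y z : E n} (hx : x ∈ unitSphere n) (hy : y ∈ unitSphere n)
    (hz : z ∈ unitSphere n) {a b : ℝ} (ha : 0 ≤ a) (hb : 0 ≤ b) (h : z = a • x + b • y) :
    z ∈ seg x y := by
  refine ⟨hz, ?_⟩
  set c := ⟪x, y⟫ with hc
  have hxx := unit_inner hx
  have hyy := unit_inner hy
  have hzz := unit_inner hz
  have hxz : ⟪x, z⟫ = a + b * c := by
    rw [h, inner_add_right, inner_smul_right, inner_smul_right, hxx]; ring
  have hzy : ⟪z, y⟫ = a * c + b := by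
    rw [h, inner_add_left, inner_smul_left, inner_smul_left, hyy, ← hc]; simp
  have hn : a ^ 2 + b ^ 2 + 2 * a * b * c = 1 := by
    have : ⟪z, z⟫ = a * ⟪x, z⟫ + b * ⟪z, y⟫ := by
      have h6 : ⟪z, z⟫ = ⟪a • x + b • y, z⟫ := by rw [← h]
      rw [h6, inner_add_left, inner_smul_left, inner_smul_left, real_inner_comm z y]; simp
    rw [hzz, hxz, hzy] at this; linarith
  obtain ⟨hc1, hc2⟩ := unit_inner_bounds hx hy
  rw [← hc] at hc1 hc2
  have e1 : Real.cos (gdist x z) = a + b * c := by rw [cos_gdist hx hz, hxz]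
  have e2 : Real.cos (gdist z y) = a * c + b := by rw [cos_gdist hz hy, hzy]
  have e3 : Real.cos (gdist x y) = c := by rw [cos_gdist hx hy]
  set A := gdist x z
  set B := gdist z y
  set C := gdist x y
  have hA0 : 0 ≤ A := Real.arccos_nonneg _
  have hB0 : 0 ≤ B := Real.arccos_nonneg _
  have hC0 : 0 ≤ C := Real.arccos_nonneg _
  have hAp : A ≤ π := Real.arccos_le_pi _
  have hBp : B ≤ π := Real.arccos_le_pi _
  have hCp : C ≤ π := Real.arccos_le_pi _
  have sA := Real.sin_nonneg_of_nonneg_of_le_pi hA0 hAp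
  have sB := Real.sin_nonneg_of_nonneg_of_le_pi hB0 hBp
  have sC := Real.sin_nonneg_of_nonneg_of_le_pi hC0 hCp
  have qC : Real.sin C ^ 2 = 1 - c ^ 2 := by rw [Real.sin_sq, e3]
  have s1 : Real.sin A = b * Real.sin C := by
    have : Real.sin A ^ 2 = (b * Real.sin C) ^ 2 := by
      rw [mul_pow, qC, Real.sin_sq, e1]; nlinarith
    exact (pow_left_inj₀ sA (mul_nonneg hb sC) two_ne_zero).1 this
  have s2 : Real.sin B = a * Real.sin C := by
    have : Real.sin B ^ 2 = (a * Real.sin C) ^ 2 := by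
      rw [mul_pow, qC, Real.sin_sq, e2]; nlinarith
    exact (pow_left_inj₀ sB (mul_nonneg ha sC) two_ne_zero).1 this
  have hcos : Real.cos (A + B) = Real.cos C := by
    rw [Real.cos_add, e1, e2, e3, s1, s2]
    have : b * Real.sin C * (a * Real.sin C) = a * b * (1 - c ^ 2) := by rw [← qC]; ring
    rw [this]
    linear_combination c * hn
  have hsin : Real.sin (A + B) = Real.sin C := by
    rw [Real.sin_add, e1, e2, s1, s2]
    linear_combination (Real.sin C) * hn
  by_cases hle : A + B ≤ π
  · exact Real.injOn_cos ⟨by linarith, hle⟩ ⟨hC0, hCp⟩ hcos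
  · exfalso
    push Not at hle
    rcases (by linarith : A + B ≤ 2 * π).lt_or_eq with hlt | heq
    · have : Real.sin (A + B) < 0 := by
        have h5 := Real.sin_pos_of_pos_of_lt_pi (x := A + B - π) (by linarith) (by linarith)
        rw [Real.sin_sub_pi] at h5; linarith
      linarith
    · have hAe : A = π := by linarith
      rw [heq, Real.cos_two_pi, e3] at hcos
      rw [hAe, Real.cos_pi, ← hcos] at e1
      linarith

lemma comb_of_seg {n : ℕ} {x y z u : E n} (hx : x ∈ unitSphere n) (hy : y ∈ unitSphere n)
    (hux : 0 < ⟪u, x⟫) (huy : 0 < ⟪u, y⟫) (h : z ∈ seg x y) :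
    ∃ a b : ℝ, 0 ≤ a ∧ 0 ≤ b ∧ z = a • x + b • y := by
  obtain ⟨hz, hs⟩ := h
  have e1 := cos_gdist hx hz
  have e2 := cos_gdist hz hy
  have e3 := cos_gdist hx hy
  rw [← hs] at e3
  have hC : gdist x y ≤ π := Real.arccos_le_pi _
  rw [← hs] at hC
  have hA0 : 0 ≤ gdist x z := Real.arccos_nonneg _
  have hB0 : 0 ≤ gdist z y := Real.arccos_nonneg _
  set A := gdist x z
  set B := gdist z y
  have hlt : A + B ≠ π := by
    intro hpi
    rw [hpi, Real.cos_pi] at e3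
    have : ⟪x + y, x + y⟫ = 0 := by
      rw [inner_add_left, inner_add_right, inner_add_right, unit_inner hx, unit_inner hy,
        real_inner_comm x y, ← e3]; norm_num
    rw [inner_self_eq_zero] at this
    have h2 : ⟪u, x + y⟫ = 0 := by rw [this, inner_zero_right]
    rw [inner_add_right] at h2; linarith
  have hlt' : A + B < π := lt_of_le_of_ne hC hlt
  have sA := Real.sin_nonneg_of_nonneg_of_le_pi hA0 (by linarith)
  have sB := Real.sin_nonneg_of_nonneg_of_le_pi hB0 (by linarith)
  rcases (add_nonneg hA0 hB0).eq_or_lt with h0 | h0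
  · have hA : A = 0 := by linarith
    refine ⟨1, 0, zero_le_one, le_rfl, ?_⟩
    rw [hA, Real.cos_zero] at e1
    have : ⟪z - x, z - x⟫ = 0 := by
      rw [inner_sub_left, inner_sub_right, inner_sub_right, unit_inner hx, unit_inner hz,
        real_inner_comm x z, ← e1]; norm_num
    rw [inner_self_eq_zero, sub_eq_zero] at this
    simp [this]
  · have sp : 0 < Real.sin (A + B) := Real.sin_pos_of_pos_of_lt_pi h0 hlt'
    have key : Real.sin (A + B) • z - (Real.sin B • x + Real.sin A • y) = 0 := by
      rw [← inner_self_eq_zero (𝕜 := ℝ)]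
      simp only [inner_sub_left, inner_sub_right, inner_add_left, inner_add_right,
        inner_smul_left, inner_smul_right, unit_inner hx, unit_inner hy, unit_inner hz,
        real_inner_comm x z, real_inner_comm x y, real_inner_comm z y]
      rw [real_inner_comm z x] at *
      simp only [← e1, ← e2, ← e3, conj_trivial]
      rw [Real.cos_add, Real.sin_add]
      have q1 := Real.sin_sq_add_cos_sq A
      have q2 := Real.sin_sq_add_cos_sq B
      have c1 : Real.cos A ^ 2 = 1 - Real.sin A ^ 2 := by linarith
      have c2 : Real.cos B ^ 2 = 1 - Real.sin B ^ 2 := by linarith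
      ring_nf
      simp only [c1, c2]
      ring
    refine ⟨Real.sin B / Real.sin (A + B), Real.sin A / Real.sin (A + B),
      div_nonneg sB sp.le, div_nonneg sA sp.le, ?_⟩
    rw [sub_eq_zero] at key
    have : z = (Real.sin (A + B))⁻¹ • (Real.sin (A + B) • z) := by
      rw [smul_smul, inv_mul_cancel₀ sp.ne', one_smul]
    rw [this, key, smul_add, smul_smul, smul_smul]
    congr 2 <;> ring_nf

lemma SConvex.inter_half {n : ℕ} {K : Set (E n)} (hK : SConvex K) (m : E n) :
    SConvex {x ∈ K | 0 ≤ ⟪x, m⟫} := by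
  obtain ⟨h1, ⟨u, hu, hu2⟩, h3⟩ := hK
  refine ⟨fun x hx => h1 hx.1, ⟨u, hu, fun x hx => hu2 x hx.1⟩, ?_⟩
  rintro x ⟨hx, hxm⟩ y ⟨hy, hym⟩ z hz
  refine ⟨h3 x hx y hy hz, ?_⟩
  obtain ⟨a, b, ha, hb, rfl⟩ := comb_of_seg (h1 hx) (h1 hy) (hu2 x hx) (hu2 y hy) hz
  rw [inner_add_left, inner_smul_left, inner_smul_left]
  simp only [conj_trivial]
  positivity

/-- A boundary point of the ball which sees `q` beyond its tangent is interior to the hull. -/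
lemma cap_nhds {n : ℕ} {p q x₀ : E n} {r : ℝ} (hp : p ∈ unitSphere n) (hq : q ∈ unitSphere n)
    (hx : x₀ ∈ unitSphere n) (hr : gdist p x₀ = r)
    (h : ⟪p, q⟫ < Real.cos r * ⟪x₀, q⟫) :
    ∃ δ > 0, ∀ C : Set (E n), SConvex C → gball p r ⊆ C → q ∈ C →
      ∀ z ∈ unitSphere n, ‖z - x₀‖ < δ → z ∈ C := by
  have hcr : Real.cos r = ⟪p, x₀⟫ := by rw [← hr, cos_gdist hp hx]
  have hr0 : 0 ≤ r := hr ▸ Real.arccos_nonneg _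
  have hrp : r ≤ π := hr ▸ Real.arccos_le_pi _
  -- first choose lambda
  obtain ⟨l, hl, hlf⟩ : ∃ l : ℝ, 0 < l ∧ Real.cos r * ‖x₀ - l • q‖ < ⟪p, x₀ - l • q⟫ := by
    have hd : HasDerivAt (fun l : ℝ => ⟪p, x₀ - l • q⟫ - Real.cos r * ‖x₀ - l • q‖)
        (-⟪p, q⟫ - Real.cos r * (-⟪x₀, q⟫)) 0 := by
      have g1 : HasDerivAt (fun l : ℝ => x₀ - l • q) (-q) 0 := by
        simpa using ((hasDerivAt_id (0 : ℝ)).smul_const q).const_sub x₀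
      have g2 : HasDerivAt (fun l : ℝ => ⟪p, x₀ - l • q⟫) (-⟪p, q⟫) 0 := by
        have := (hasDerivAt_const (0 : ℝ) p).inner ℝ g1
        simpa using this
      have g3 : HasDerivAt (fun l : ℝ => ‖x₀ - l • q‖ ^ 2) (2 * ⟪x₀, -q⟫) 0 := by
        simpa using g1.norm_sq
      have g4 : HasDerivAt (fun l : ℝ => ‖x₀ - l • q‖) (-⟪x₀, q⟫) 0 := by
        have := g3.sqrt (by simp [unit_norm hx])
        simp only [Real.sqrt_sq (norm_nonneg _)] at this
        convert this using 1
        simp [unit_norm hx]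
        ring
      exact g2.sub (g4.const_mul _)
    have hpos : 0 < -⟪p, q⟫ - Real.cos r * (-⟪x₀, q⟫) := by linarith
    have hev := hd.tendsto_slope.eventually (lt_mem_nhds hpos)
    have hev2 : ∀ᶠ l in nhdsWithin (0 : ℝ) (Set.Ioi 0),
        0 < slope (fun l : ℝ => ⟪p, x₀ - l • q⟫ - Real.cos r * ‖x₀ - l • q‖) 0 l :=
      hev.filter_mono (nhdsWithin_mono _ (fun y hy => ne_of_gt hy))
    obtain ⟨l, hl1, hl2⟩ := (hev2.and self_mem_nhdsWithin).exists
    refine ⟨l, hl2, ?_⟩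
    have hl2' : 0 < l := hl2
    rw [slope_def_field] at hl1
    have := (div_pos_iff_of_pos_right (by simpa using hl2')).1 hl1
    simp only [zero_smul, sub_zero, unit_norm hx, hcr] at this
    rw [hcr]
    linarith
  have hcont : Continuous (fun z : E n => ⟪p, z - l • q⟫ - Real.cos r * ‖z - l • q‖) := by
    fun_prop
  have hev : ∀ᶠ z in nhds x₀, 0 < ⟪p, z - l • q⟫ - Real.cos r * ‖z - l • q‖ :=
    hcont.continuousAt.eventually (lt_mem_nhds (by linarith))
  obtain ⟨δ, hδ, hball⟩ := Metric.eventually_nhds_iff.1 hev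
  refine ⟨δ, hδ, ?_⟩
  intro C hC hB hqC z hz hzd
  have hf := hball (by rwa [dist_eq_norm])
  set y := z - l • q with hy
  have hyne : y ≠ 0 := by
    intro h0; rw [h0] at hf; simp at hf
  have hyn : 0 < ‖y‖ := norm_pos_iff.2 hyne
  have hbu : ‖y‖⁻¹ • y ∈ unitSphere n := by
    simp [unitSphere, norm_smul, hyn.ne']
  have hb : ‖y‖⁻¹ • y ∈ gball p r := by
    refine ⟨hbu, ?_⟩
    rw [gdist, ← Real.arccos_cos hr0 hrp]
    apply Real.arccos_le_arccos
    rw [inner_smul_right, inv_mul_eq_div, le_div_iff₀ hyn]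
    linarith
  apply hC.2.2 _ (hB hb) _ hqC
  refine seg_of_comb hbu hq hz hyn.le hl.le ?_
  rw [smul_smul, mul_inv_cancel₀ hyn.ne', one_smul, hy]; abel

end SphericalPal

namespace SphericalPal

lemma arccos_lip {x : ℝ} (h1 : -1 ≤ x) (h2 : x ≤ 1) :
    |Real.arccos x - 2 * π / 3| ≤ π * |x + 1 / 2| := by
  set θ := Real.arccos x with hθ
  have hx : Real.cos θ = x := Real.cos_arccos h1 h2
  have hθ0 : 0 ≤ θ := Real.arccos_nonneg _
  have hθp : θ ≤ π := Real.arccos_le_pi _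
  have hpi := Real.pi_pos
  have hc : Real.cos (2 * π / 3) = -1 / 2 := by
    have : 2 * π / 3 = π - π / 3 := by ring
    rw [this, Real.cos_pi_sub, Real.cos_pi_div_three]; norm_num
  have e : x + 1 / 2 = -2 * Real.sin ((θ + 2 * π / 3) / 2) * Real.sin ((θ - 2 * π / 3) / 2) := by
    rw [← Real.cos_sub_cos, hx, hc]; ring
  have s1 : 1 / 2 ≤ Real.sin ((θ + 2 * π / 3) / 2) := by
    rw [← Real.cos_sub_pi_div_two, ← Real.cos_abs, ← Real.cos_pi_div_three]
    apply Real.cos_le_cos_of_nonneg_of_le_pi (abs_nonneg _) (by linarith)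
    rw [abs_le]; constructor <;> linarith
  have s2 : 2 / π * |(θ - 2 * π / 3) / 2| ≤ |Real.sin ((θ - 2 * π / 3) / 2)| := by
    apply Real.mul_abs_le_abs_sin
    rw [abs_le]; constructor <;> linarith
  rw [e, abs_mul, abs_mul]
  have : |(-2 : ℝ)| = 2 := by norm_num
  rw [this, abs_of_nonneg (by linarith : 0 ≤ Real.sin ((θ + 2 * π / 3) / 2))]
  have h3 : 2 / π * |(θ - 2 * π / 3) / 2| = |θ - 2 * π / 3| / π := by
    rw [abs_div, abs_of_pos (by norm_num : (0 : ℝ) < 2)]; field_simp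
  rw [h3, div_le_iff₀ hpi] at s2
  have h4 := abs_nonneg (Real.sin ((θ - 2 * π / 3) / 2))
  nlinarith [mul_nonneg h4 hpi.le]

lemma exists_frame {p a c : E 2} (hp : p ∈ unitSphere 2) (ha : a ∈ unitSphere 2)
    (hpa : ⟪p, a⟫ = 0) :
    ∃ b : E 2, b ∈ unitSphere 2 ∧ ⟪p, b⟫ = 0 ∧ ⟪a, b⟫ = 0 ∧ 0 ≤ ⟪c, b⟫ ∧
      ∀ v w : E 2, ⟪p, v⟫ = 0 → ⟪v, w⟫ = ⟪v, a⟫ * ⟪w, a⟫ + ⟪v, b⟫ * ⟪w, b⟫ := by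
  have key : ∃ b : E 2, b ∈ unitSphere 2 ∧ ⟪p, b⟫ = 0 ∧ ⟪a, b⟫ = 0 ∧
      ∀ v w : E 2, ⟪p, v⟫ = 0 → ⟪v, w⟫ = ⟪v, a⟫ * ⟪w, a⟫ + ⟪v, b⟫ * ⟪w, b⟫ := by
    have horth : Orthonormal ℝ (({0, 1} : Set (Fin 3)).domRestrict ![p, a, 0]) := by
      rw [orthonormal_iff_ite]
      rintro ⟨i, hi⟩ ⟨j, hj⟩
      simp only [Set.mem_insert_iff, Set.mem_singleton_iff] at hi hj
      rcases hi with rfl | rfl <;> rcases hj with rfl | rfl <;>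
        simp [Set.domRestrict, unit_norm hp, unit_norm ha, hpa, real_inner_comm p a]
    obtain ⟨b, hb⟩ := horth.exists_orthonormalBasis_extension_of_card_eq
      (by simp)
    have h0 : b 0 = p := by simpa using hb 0 (by simp)
    have h1 : b 1 = a := by simpa using hb 1 (by simp)
    have ho := orthonormal_iff_ite.1 b.orthonormal
    refine ⟨b 2, unit_of_inner (by simpa using ho 2 2), ?_, ?_, ?_⟩
    · rw [← h0]; simpa using ho 0 2
    · rw [← h1]; simpa using ho 1 2
    · intro v w hv
      have := b.sum_inner_mul_inner v w
      rw [Fin.sum_univ_three, h0, h1, real_inner_comm p v, hv] at this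
      rw [← this, real_inner_comm w a, real_inner_comm w (b 2)]; ring
  obtain ⟨b, h1, h2, h3, h4⟩ := key
  rcases le_total 0 ⟪c, b⟫ with h | h
  · exact ⟨b, h1, h2, h3, h, h4⟩
  · refine ⟨-b, ?_, by simp [h2], by simp [h3], by simpa using h, ?_⟩
    · simpa [unitSphere] using h1
    · intro v w hv; rw [h4 v w hv]; simp

/-- coordinates of the exact frame -/
def gx : Fin 3 → ℝ := ![1, -1 / 2, -1 / 2]
def gy : Fin 3 → ℝ := ![0, √3 / 2, -(√3 / 2)]

lemma real_frame {a₁ b₁ a₂ b₂ ε : ℝ} (h1 : a₁ ^ 2 + b₁ ^ 2 = 1) (h2 : a₂ ^ 2 + b₂ ^ 2 = 1)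
    (hb : 0 ≤ b₁) (he0 : 0 ≤ ε) (he : ε < 1 / 1000) (ha1 : |a₁ + 1 / 2| ≤ 6 * ε)
    (ha2 : |a₂ + 1 / 2| ≤ 6 * ε)
    (h12 : |a₁ * a₂ + b₁ * b₂ + 1 / 2| ≤ 6 * ε) :
    |b₁ - √3 / 2| ≤ 9 * ε ∧ |b₂ + √3 / 2| ≤ 9 * ε := by
  have hs : (√3) ^ 2 = 3 := Real.sq_sqrt (by norm_num)
  have hs0 : 1.7 ≤ √3 := by
    apply Real.le_sqrt_of_sq_le; norm_num
  rw [abs_le] at ha1 ha2 h12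
  have gen : ∀ a b : ℝ, a ^ 2 + b ^ 2 = 1 → 0 ≤ b → -(6 * ε) ≤ a + 1 / 2 → a + 1 / 2 ≤ 6 * ε →
      |b - √3 / 2| ≤ 9 * ε := by
    intro a b h hb h3 h4
    have hm : (b - √3 / 2) * (b + √3 / 2) = (1 / 2 - a) * (1 / 2 + a) := by nlinarith
    have hu : (1 / 2 - a) * (1 / 2 + a) ≤ 7 * ε := by nlinarith
    have hl : -(7 * ε) ≤ (1 / 2 - a) * (1 / 2 + a) := by nlinarith
    rw [abs_le]
    constructor
    · by_contra hh
      push Not at hh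
      nlinarith
    · by_contra hh
      push Not at hh
      nlinarith
  have hneg : b₁ * b₂ < 0 := by nlinarith
  have hb2 : b₂ ≤ 0 := by
    by_contra hh
    push Not at hh
    nlinarith [mul_nonneg hb hh.le]
  refine ⟨gen _ _ h1 hb ha1.1 ha1.2, ?_⟩
  have := gen a₂ (-b₂) (by linarith [h2, neg_sq b₂]) (by linarith) ha2.1 ha2.2
  rw [← abs_neg] at this
  convert this using 2
  ring

lemma real_near {x y δ : ℝ} (h : x ^ 2 + y ^ 2 = 1) (hd0 : 0 ≤ δ) (hd : δ ≤ 1 / 4)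
    (hk : ∀ k, x * gx k + y * gy k ≤ 1 / 2 + δ) :
    ∃ k, |x + gx k| ≤ 3 * δ ∧ |y + gy k| ≤ 3 * δ := by
  have hs : (√3) ^ 2 = 3 := Real.sq_sqrt (by norm_num)
  have fin : ∀ k, gx k ^ 2 + gy k ^ 2 = 1 → 1 + (x * gx k + y * gy k) ≤ 4 * δ ^ 2 →
      ∃ k, |x + gx k| ≤ 3 * δ ∧ |y + gy k| ≤ 3 * δ := by
    intro k h1 h2
    have : (x + gx k) ^ 2 + (y + gy k) ^ 2 ≤ 8 * δ ^ 2 := by nlinarith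
    exact ⟨k, abs_le_of_sq_le_sq (by nlinarith [sq_nonneg (y + gy k)]) (by linarith),
      abs_le_of_sq_le_sq (by nlinarith [sq_nonneg (x + gx k)]) (by linarith)⟩
  have h0 := hk 0
  have h1 := hk 1
  have h2 := hk 2
  have gen : ∀ X Y Z : ℝ, X + Y + Z = 0 → X ^ 2 + Y ^ 2 + Z ^ 2 = 3 / 2 → X ≤ 1 / 2 + δ →
      Y ≤ 1 / 2 + δ → Z ≤ 0 → 1 + Z ≤ 4 * δ ^ 2 := by
    intro X Y Z hS hQ hX hY hZ
    have hp := mul_nonneg (sub_nonneg.2 hX) (sub_nonneg.2 hY)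
    have hZe : Z = -(X + Y) := by linarith
    subst hZe
    have : (1 - (X + Y)) * ((X + Y) + 1 / 2 - δ) ≤ δ ^ 2 := by nlinarith
    by_cases hh : 1 - (X + Y) ≤ 0
    · nlinarith
    · push Not at hh
      nlinarith [mul_nonneg hh.le (by linarith : 0 ≤ (X + Y) + 1 / 4 - δ)]
  simp only [gx, gy, Matrix.cons_val_zero, Matrix.cons_val_one, Matrix.cons_val] at h0 h1 h2
  set s := √3
  by_cases c0 : x ≤ 0
  · refine fin 0 (by simp [gx, gy]) ?_
    have := gen _ _ x (by ring) (by nlinarith) h1 h2 c0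
    simpa [gx, gy] using this
  by_cases c1 : x * (-1 / 2) + y * (s / 2) ≤ 0
  · refine fin 1 (by simp [gx, gy]; nlinarith) ?_
    have := gen _ _ _ (by ring) (by nlinarith) h0 h2 c1
    simpa [gx, gy] using this
  · refine fin 2 (by simp [gx, gy]; nlinarith) ?_
    have := gen _ _ _ (by ring) (by nlinarith) h0 h1
      (by nlinarith : x * (-1 / 2) + y * (-(s / 2)) ≤ 0)
    simpa [gx, gy] using this

lemma gxy_dot (k l : Fin 3) (h : k ≠ l) : gx k * gx l + gy k * gy l = -1 / 2 := by
  have hs : √3 * √3 = 3 := Real.mul_self_sqrt (by norm_num)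
  fin_cases k <;> fin_cases l <;> simp [gx, gy] at h ⊢ <;> nlinarith

lemma gxy_unit (k : Fin 3) : gx k * gx k + gy k * gy k = 1 := by
  have hs : √3 * √3 = 3 := Real.mul_self_sqrt (by norm_num)
  fin_cases k <;> simp [gx, gy] <;> nlinarith

lemma gx_le (k : Fin 3) : |gx k| ≤ 1 := by
  apply abs_le_of_sq_le_sq (by nlinarith [gxy_unit k, mul_self_nonneg (gy k)]) (by norm_num)

lemma gy_le (k : Fin 3) : |gy k| ≤ 1 := by
  apply abs_le_of_sq_le_sq (by nlinarith [gxy_unit k, mul_self_nonneg (gx k)]) (by norm_num)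

lemma mul_close {a b g h d : ℝ} (ha : |a + g| ≤ d) (hb : |b + h| ≤ d) (hb1 : |b| ≤ 1)
    (hg1 : |g| ≤ 1) : |a * b - g * h| ≤ 2 * d := by
  have e : a * b - g * h = (a + g) * b - g * (b + h) := by ring
  rw [e]
  have h1 : |(a + g) * b| ≤ d := by
    rw [abs_mul]; nlinarith [abs_nonneg (a + g), abs_nonneg b]
  have h2 : |g * (b + h)| ≤ d := by
    rw [abs_mul]; nlinarith [abs_nonneg (b + h), abs_nonneg g]
  linarith [abs_sub ((a + g) * b) (g * (b + h))]

lemma planar {p : E 2} {f e : Fin 3 → E 2} {k ε : ℝ} (hp : p ∈ unitSphere 2)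
    (hf : ∀ i, f i ∈ unitSphere 2) (he : ∀ i, e i ∈ unitSphere 2)
    (hpf : ∀ i, ⟪p, f i⟫ = 0) (hpe : ∀ i, ⟪p, e i⟫ = 0)
    (hk0 : 0 ≤ k) (hk : k ≤ 1 / 2 + ε)
    (hff : ∀ i j, i ≠ j → ⟪f i, f j⟫ ≤ 2 * k ^ 2 - 1)
    (hef : ∀ i j, ⟪e i, f j⟫ ≤ k)
    (hpos : ∀ m ∈ unitSphere 2, ⟪p, m⟫ = 0 → ∃ i, ⟪e i, m⟫ < 0) :
    ∀ i j, i ≠ j → |⟪e i, e j⟫ + 1 / 2| ≤ 1500 * ε ∧ |⟪f i, f j⟫ + 1 / 2| ≤ 1500 * ε := by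
  have hsum : 0 ≤ 3 + 2 * (⟪f 0, f 1⟫ + ⟪f 1, f 2⟫ + ⟪f 0, f 2⟫) := by
    have : 0 ≤ ⟪f 0 + f 1 + f 2, f 0 + f 1 + f 2⟫ := real_inner_self_nonneg
    simp only [inner_add_left, inner_add_right, unit_inner (hf _), real_inner_comm (f 0) (f 1),
      real_inner_comm (f 1) (f 2), real_inner_comm (f 0) (f 2)] at this
    linarith
  have h01 := hff 0 1 (by decide)
  have h12 := hff 1 2 (by decide)
  have h02 := hff 0 2 (by decide)
  have hkh : 1 / 2 ≤ k := by nlinarith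
  have hε0 : 0 ≤ ε := by linarith
  by_cases hεs : 1 / 1000 ≤ ε
  · intro i j _
    obtain ⟨q1, q2⟩ := unit_inner_bounds (he i) (he j)
    obtain ⟨q3, q4⟩ := unit_inner_bounds (hf i) (hf j)
    constructor <;> rw [abs_le] <;> constructor <;> linarith
  push Not at hεs
  have hk2 : 2 * k ^ 2 - 1 ≤ -1 / 2 + 3 * ε := by nlinarith
  have hfl : ∀ i j, i ≠ j → |⟪f i, f j⟫ + 1 / 2| ≤ 6 * ε := by
    have a01 : |⟪f 0, f 1⟫ + 1 / 2| ≤ 6 * ε := by rw [abs_le]; constructor <;> linarith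
    have a12 : |⟪f 1, f 2⟫ + 1 / 2| ≤ 6 * ε := by rw [abs_le]; constructor <;> linarith
    have a02 : |⟪f 0, f 2⟫ + 1 / 2| ≤ 6 * ε := by rw [abs_le]; constructor <;> linarith
    have a10 := a01; have a21 := a12; have a20 := a02
    rw [real_inner_comm] at a10 a21 a20
    intro i j hij
    fin_cases i <;> fin_cases j <;> first | exact absurd rfl hij | assumption
  obtain ⟨b, hb, hpb, hfb, hcb, hdec⟩ := exists_frame (c := f 1) hp (hf 0) (hpf 0)
  have hfu : ∀ v ∈ unitSphere 2, ⟪p, v⟫ = 0 → ⟪v, f 0⟫ ^ 2 + ⟪v, b⟫ ^ 2 = 1 := by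
    intro v hv hpv
    have := hdec v v hpv
    rw [unit_inner hv] at this; nlinarith
  obtain ⟨B1, B2⟩ := real_frame (hfu _ (hf 1) (hpf 1)) (hfu _ (hf 2) (hpf 2)) hcb hε0 hεs
    (hfl 1 0 (by decide)) (hfl 2 0 (by decide))
    (by rw [← hdec _ _ (hpf 1)]; exact hfl 1 2 (by decide))
  have A1 := hfl 1 0 (by decide)
  have A2 := hfl 2 0 (by decide)
  have hnear : ∀ i, ∃ k, |⟪e i, f 0⟫ + gx k| ≤ 48 * ε ∧ |⟪e i, b⟫ + gy k| ≤ 48 * ε := by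
    intro i
    have hb1 : |⟪e i, f 0⟫| ≤ 1 := abs_le.2 (unit_inner_bounds (he i) (hf 0))
    have hb2 : |⟪e i, b⟫| ≤ 1 := abs_le.2 (unit_inner_bounds (he i) hb)
    have small : ∀ x u d : ℝ, |x| ≤ 1 → |u| ≤ d → x * u ≤ d := by
      intro x u d h1 h2
      have := abs_mul x u
      have h3 := le_abs_self (x * u)
      nlinarith [abs_nonneg x, abs_nonneg u]
    have h := real_near (δ := 16 * ε) (hfu _ (he i) (hpe i)) (by linarith) (by linarith) (by
      intro l
      fin_cases l
      · have := hef i 0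
        simp [gx, gy]; linarith
      · have h1 := hef i 1
        rw [hdec _ _ (hpe i)] at h1
        rw [← abs_neg] at A1 B1
        have h2 := small _ _ _ hb1 A1
        have h3 := small _ _ _ hb2 B1
        simp [gx, gy]; linarith
      · have h1 := hef i 2
        rw [hdec _ _ (hpe i)] at h1
        rw [← abs_neg] at A2 B2
        have h2 := small _ _ _ hb1 A2
        have h3 := small _ _ _ hb2 B2
        simp [gx, gy]; linarith)
    obtain ⟨l, h1, h2⟩ := h
    exact ⟨l, by linarith, by linarith⟩
  choose σ hσ1 hσ2 using hnear
  have hsurj : Function.Surjective σ := by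
    intro l
    by_contra hno
    push Not at hno
    have hm := hpos (gx l • f 0 + gy l • b) (unit_of_inner (by
      simp only [inner_add_left, inner_add_right, inner_smul_left, inner_smul_right,
        unit_inner (hf 0), unit_inner hb, hfb, real_inner_comm (f 0) b, conj_trivial]
      linarith [gxy_unit l])) (by
      simp only [inner_add_right, inner_smul_right, hpf, hpb]; ring)
    obtain ⟨i, hi⟩ := hm
    rw [inner_add_right, inner_smul_right, inner_smul_right] at hi
    have hd := gxy_dot (σ i) l (hno i)
    have g1 : |(⟪e i, f 0⟫ + gx (σ i)) * gx l| ≤ 48 * ε := by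
      rw [abs_mul]
      nlinarith [abs_nonneg (⟪e i, f 0⟫ + gx (σ i)), abs_nonneg (gx l), gx_le l, hσ1 i]
    have g2 : |(⟪e i, b⟫ + gy (σ i)) * gy l| ≤ 48 * ε := by
      rw [abs_mul]
      nlinarith [abs_nonneg (⟪e i, b⟫ + gy (σ i)), abs_nonneg (gy l), gy_le l, hσ2 i]
    rw [abs_le] at g1 g2
    nlinarith [g1.1, g2.1]
  have hinj : Function.Injective σ := Finite.injective_iff_surjective.2 hsurj
  intro i j hij
  refine ⟨?_, (hfl i j hij).trans (by linarith)⟩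
  have hne : σ i ≠ σ j := fun h => hij (hinj h)
  have hd := gxy_dot _ _ hne
  rw [hdec _ _ (hpe i)]
  have m1 := mul_close (hσ1 i) (hσ1 j) (abs_le.2 (unit_inner_bounds (he j) (hf 0))) (gx_le _)
  have m2 := mul_close (hσ2 i) (hσ2 j) (abs_le.2 (unit_inner_bounds (he j) hb)) (gy_le _)
  rw [abs_le] at m1 m2 ⊢
  constructor <;> linarith [m1.1, m2.1, m1.2, m2.2]

end SphericalPal

namespace SphericalPal

lemma quad_diff {c a₁ a₂ b₂ b₃ : ℝ} (hc0 : 0 ≤ c) (hc1 : c < 1)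
    (h1 : 0 ≤ a₁) (h2 : 0 ≤ a₂) (h3 : 0 ≤ b₂) (h4 : 0 ≤ b₃)
    (hN : 0 ≤ c * (a₁ * b₃ + a₂ * b₃ + a₁ * b₂) - (1 + c) * (a₂ * b₂)) :
    (1 + c) * (c * (a₁ * b₃ + a₂ * b₃ + a₁ * b₂) - (1 + c) * (a₂ * b₂)) ^ 2 ≤
      2 * c ^ 2 * (((1 + c) * (a₁ ^ 2 + a₂ ^ 2) - 2 * c * (a₁ * a₂)) *
        ((1 + c) * (b₂ ^ 2 + b₃ ^ 2) - 2 * c * (b₂ * b₃))) := by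
  have hid : 2 * c ^ 2 * (((1 + c) * (a₁ ^ 2 + a₂ ^ 2) - 2 * c * (a₁ * a₂)) *
        ((1 + c) * (b₂ ^ 2 + b₃ ^ 2) - 2 * c * (b₂ * b₃))) -
      (1 + c) * (c * (a₁ * b₃ + a₂ * b₃ + a₁ * b₂) - (1 + c) * (a₂ * b₂)) ^ 2 =
      c ^ 2 * (1 + 2 * c) * (1 + c) * (a₁ * b₃ - a₂ * b₃ - a₁ * b₂) ^ 2 +
      (a₂ * b₂) * (1 + 2 * c) * (1 - c) * (2 * c * (1 - c) * (a₁ * b₃) +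
        2 * c * (1 + c) * (a₂ * b₃ + a₁ * b₂) - (1 + c) ^ 2 * (a₂ * b₂)) := by ring
  have hP : 0 ≤ a₁ * b₃ := by positivity
  have hX : 0 ≤ a₂ * b₃ := by positivity
  have hY : 0 ≤ a₁ * b₂ := by positivity
  have hZ : 0 ≤ a₂ * b₂ := by positivity
  have hPZ : (a₁ * b₃) * (a₂ * b₂) = (a₂ * b₃) * (a₁ * b₂) := by ring
  generalize a₁ * b₃ = P at *
  generalize a₂ * b₃ = X at *
  generalize a₁ * b₂ = Y at *
  generalize a₂ * b₂ = Z at *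
  have hbr : 0 ≤ 2 * c * (1 - c) * P + 2 * c * (1 + c) * (X + Y) - (1 + c) ^ 2 * Z := by
    have hN2 := mul_nonneg (by linarith : 0 ≤ 1 + c) hN
    by_cases hq : P ≤ X + Y ∨ c ≤ 1 / 3
    · have : 0 ≤ c * ((1 - 3 * c) * P + (1 + c) * (X + Y)) := by
        apply mul_nonneg hc0
        rcases hq with hq | hq
        · nlinarith
        · have := mul_nonneg (by linarith : 0 ≤ 1 - 3 * c) hP
          have := mul_nonneg (by linarith : 0 ≤ 1 + c) (add_nonneg hX hY)
          linarith
      nlinarith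
    · push Not at hq
      have hPp : 0 < P := by linarith
      have hZ4 : Z ≤ (X + Y) / 4 := by
        by_contra hh
        push Not at hh
        nlinarith [sq_nonneg (X - Y)]
      have e1 : (1 + c) ^ 2 * Z ≤ (1 + c) ^ 2 * ((X + Y) / 4) :=
        mul_le_mul_of_nonneg_left hZ4 (by positivity)
      have e2 : 0 ≤ (1 + c) * (X + Y) * (7 * c - 1) :=
        mul_nonneg (mul_nonneg (by linarith) (by linarith)) (by linarith [hq.2])
      have e3 : 0 ≤ 2 * c * (1 - c) * P := mul_nonneg (mul_nonneg (by linarith) (by linarith)) hP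
      nlinarith
  have : 0 ≤ c ^ 2 * (1 + 2 * c) * (1 + c) * (P - X - Y) ^ 2 := by positivity
  have h5 : 0 ≤ Z * (1 + 2 * c) * (1 - c) *
      (2 * c * (1 - c) * P + 2 * c * (1 + c) * (X + Y) - (1 + c) ^ 2 * Z) :=
    mul_nonneg (mul_nonneg (mul_nonneg hZ (by linarith)) (by linarith)) hbr
  linarith

lemma quad_same {c a₁ a₂ b₁ b₂ : ℝ} (hc0 : 0 ≤ c)
    (h1 : 0 ≤ a₁) (h2 : 0 ≤ a₂) (h3 : 0 ≤ b₁) (h4 : 0 ≤ b₂)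
    (hN : 0 ≤ c * (a₁ * b₂ + a₂ * b₁) - (1 + c) * (a₁ * b₁ + a₂ * b₂)) :
    (1 + c) * (c * (a₁ * b₂ + a₂ * b₁) - (1 + c) * (a₁ * b₁ + a₂ * b₂)) ^ 2 ≤
      2 * c ^ 2 * (((1 + c) * (a₁ ^ 2 + a₂ ^ 2) - 2 * c * (a₁ * a₂)) *
        ((1 + c) * (b₁ ^ 2 + b₂ ^ 2) - 2 * c * (b₁ * b₂))) := by
  set N := c * (a₁ * b₂ + a₂ * b₁) - (1 + c) * (a₁ * b₁ + a₂ * b₂) with hNd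
  have hid : ((1 + c) * (a₁ ^ 2 + a₂ ^ 2) - 2 * c * (a₁ * a₂)) *
        ((1 + c) * (b₁ ^ 2 + b₂ ^ 2) - 2 * c * (b₁ * b₂)) =
      N ^ 2 + (1 + 2 * c) * (a₁ * b₂ - a₂ * b₁) ^ 2 := by rw [hNd]; ring
  have hs : 0 ≤ a₁ * b₂ := by positivity
  have ht : 0 ≤ a₂ * b₁ := by positivity
  have hp : 0 ≤ a₁ * b₁ + a₂ * b₂ := by positivity
  have hpp : 4 * ((a₁ * b₂) * (a₂ * b₁)) ≤ (a₁ * b₁ + a₂ * b₂) ^ 2 := by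
    nlinarith [sq_nonneg (a₁ * b₁ - a₂ * b₂)]
  rw [hid]
  have hNle : N ^ 2 ≤ c ^ 2 * (a₁ * b₂ - a₂ * b₁) ^ 2 := by
    clear hid
    generalize a₁ * b₂ = s at *
    generalize a₂ * b₁ = t at *
    generalize a₁ * b₁ + a₂ * b₂ = p at *
    rw [← mul_pow]
    rcases le_total s t with h | h
    · have : 2 * s ≤ p := abs_le_of_sq_le_sq' (by nlinarith) hp |>.2
      have h6 : N ≤ c * (t - s) := by nlinarith
      nlinarith
    · have : 2 * t ≤ p := abs_le_of_sq_le_sq' (by nlinarith) hp |>.2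
      have h6 : N ≤ c * (s - t) := by nlinarith
      nlinarith
  have h7 : 0 ≤ (1 + 2 * c) * (c ^ 2 * (a₁ * b₂ - a₂ * b₁) ^ 2 - N ^ 2) :=
    mul_nonneg (by linarith) (by linarith)
  nlinarith [mul_nonneg (sq_nonneg c) (sq_nonneg N), mul_nonneg hc0 (sq_nonneg N), sq_nonneg N]

lemma quad {c a₁ a₂ a₃ b₁ b₂ b₃ Qa Qb N : ℝ} (hc0 : 0 ≤ c) (hc1 : c < 1)
    (h1 : 0 ≤ a₁) (h2 : 0 ≤ a₂) (h3 : 0 ≤ a₃) (k1 : 0 ≤ b₁) (k2 : 0 ≤ b₂) (k3 : 0 ≤ b₃)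
    (ha : a₁ = 0 ∨ a₂ = 0 ∨ a₃ = 0) (hb : b₁ = 0 ∨ b₂ = 0 ∨ b₃ = 0)
    (hQa : Qa = (1 + 2 * c) * (a₁ ^ 2 + a₂ ^ 2 + a₃ ^ 2) - c * (a₁ + a₂ + a₃) ^ 2)
    (hQb : Qb = (1 + 2 * c) * (b₁ ^ 2 + b₂ ^ 2 + b₃ ^ 2) - c * (b₁ + b₂ + b₃) ^ 2)
    (hN : N = c * ((a₁ + a₂ + a₃) * (b₁ + b₂ + b₃)) -
      (1 + 2 * c) * (a₁ * b₁ + a₂ * b₂ + a₃ * b₃)) (hN0 : 0 ≤ N) :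
    (1 + c) * N ^ 2 ≤ 2 * c ^ 2 * (Qa * Qb) := by
  subst hQa hQb hN
  rcases ha with rfl | rfl | rfl <;> rcases hb with rfl | rfl | rfl
  · have := quad_same hc0 h2 h3 k2 k3 (by linarith); convert this using 1 <;> ring
  · have := quad_diff hc0 hc1 h2 h3 k3 k1 (by linarith); convert this using 1 <;> ring
  · have := quad_diff hc0 hc1 h3 h2 k2 k1 (by linarith); convert this using 1 <;> ring
  · have := quad_diff hc0 hc1 h1 h3 k3 k2 (by linarith); convert this using 1 <;> ring
  · have := quad_same hc0 h1 h3 k1 k3 (by linarith); convert this using 1 <;> ring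
  · have := quad_diff hc0 hc1 h3 h1 k1 k2 (by linarith); convert this using 1 <;> ring
  · have := quad_diff hc0 hc1 h1 h2 k2 k3 (by linarith); convert this using 1 <;> ring
  · have := quad_diff hc0 hc1 h2 h1 k1 k3 (by linarith); convert this using 1 <;> ring
  · have := quad_same hc0 h1 h2 k1 k2 (by linarith); convert this using 1 <;> ring

lemma breadth_eq {u v : E 2} (hu : u ∈ unitSphere 2) (hv : v ∈ unitSphere 2) (h1 : u ≠ v)
    (h2 : u ≠ -v) : breadth u v = Real.arccos (-⟪u, v⟫) := by
  set d := ⟪u, v⟫ with hd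
  obtain ⟨d1, d2⟩ := unit_inner_bounds hu hv
  rw [← hd] at d1 d2
  have uu := unit_inner hu
  have vv := unit_inner hv
  have hvu : ⟪v, u⟫ = d := by rw [real_inner_comm]
  have n1 : d ≠ 1 := by
    intro h
    apply h1
    have : ⟪u - v, u - v⟫ = 0 := by
      simp only [inner_sub_left, inner_sub_right, uu, vv, hvu, ← hd, h]; norm_num
    rwa [inner_self_eq_zero, sub_eq_zero] at this
  have n2 : d ≠ -1 := by
    intro h
    apply h2
    have : ⟪u + v, u + v⟫ = 0 := by
      simp only [inner_add_left, inner_add_right, uu, vv, hvu, ← hd, h]; norm_num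
    rwa [inner_self_eq_zero, add_eq_zero_iff_eq_neg] at this
  have hpos : 0 < 1 - d ^ 2 := by
    have : d < 1 := lt_of_le_of_ne d2 n1
    have : -1 < d := lt_of_le_of_ne d1 (Ne.symm n2)
    nlinarith
  have N1 : ‖d • u - v‖ = √(1 - d ^ 2) := by
    rw [norm_eq_sqrt_real_inner]
    congr 1
    simp only [inner_sub_left, inner_sub_right, inner_smul_left, inner_smul_right, uu, vv, hvu,
      ← hd, conj_trivial]; ring
  have N2 : ‖d • v - u‖ = √(1 - d ^ 2) := by
    rw [norm_eq_sqrt_real_inner]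
    congr 1
    simp only [inner_sub_left, inner_sub_right, inner_smul_left, inner_smul_right, uu, vv, hvu,
      ← hd, conj_trivial]; ring
  rw [breadth, gdist, luneFaceCenter, luneFaceCenter, hvu, ← hd, N1, N2]
  congr 1
  simp only [inner_sub_left, inner_sub_right, inner_smul_left, inner_smul_right, uu, vv, hvu,
      ← hd, conj_trivial]
  have hs : √(1 - d ^ 2) * √(1 - d ^ 2) = 1 - d ^ 2 := Real.mul_self_sqrt hpos.le
  have hs0 : √(1 - d ^ 2) ≠ 0 := (Real.sqrt_pos.2 hpos).ne'
  field_simp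
  nlinarith

/-- Gram data of a regular triangle. -/
structure RegFrame (v : Fin 3 → E 2) (c : ℝ) : Prop where
  lin : LinearIndependent ℝ v
  gram : ∀ i j, ⟪v i, v j⟫ = if i = j then 1 else c

def nrm (v : Fin 3 → E 2) (c : ℝ) (i : Fin 3) : E 2 :=
  (1 + 2 * c) • v i - c • (v 0 + v 1 + v 2)

namespace RegFrame
variable {v : Fin 3 → E 2} {c : ℝ}

lemma unit (h : RegFrame v c) (i : Fin 3) : v i ∈ unitSphere 2 :=
  unit_of_inner (by simpa using h.gram i i)

lemma sum_inner (h : RegFrame v c) (j : Fin 3) : ⟪v 0 + v 1 + v 2, v j⟫ = 1 + 2 * c := by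
  rw [inner_add_left, inner_add_left, h.gram, h.gram, h.gram]
  fin_cases j <;> simp <;> ring

lemma sum_self (h : RegFrame v c) :
    ⟪v 0 + v 1 + v 2, v 0 + v 1 + v 2⟫ = 3 * (1 + 2 * c) := by
  rw [inner_add_right, inner_add_right, h.sum_inner, h.sum_inner, h.sum_inner]; ring

lemma c_lt (h : RegFrame v c) : c < 1 := by
  have h1 : 0 < ⟪v 0 - v 1, v 0 - v 1⟫ := by
    apply real_inner_self_pos.2
    rw [sub_ne_zero]
    exact fun hh => absurd (h.lin.injective hh) (by decide)
  rw [inner_sub_left, inner_sub_right, inner_sub_right, h.gram, h.gram, h.gram, h.gram] at h1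
  simp at h1
  linarith

lemma c_gt (h : RegFrame v c) : 0 < 1 + 2 * c := by
  have h1 : 0 < ⟪v 0 + v 1 + v 2, v 0 + v 1 + v 2⟫ := by
    apply real_inner_self_pos.2
    intro hh
    have := Fintype.linearIndependent_iff.1 h.lin (fun _ => 1)
      (by simpa [Fin.sum_univ_three] using hh) 0
    norm_num at this
  rw [h.sum_self] at h1; linarith

lemma nrm_inner (h : RegFrame v c) (i j : Fin 3) :
    ⟪nrm v c i, v j⟫ = if i = j then (1 - c) * (1 + 2 * c) else 0 := by
  rw [nrm, inner_sub_left, inner_smul_left, inner_smul_left, h.sum_inner, h.gram]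
  simp only [conj_trivial]
  split_ifs <;> ring

lemma nrm_self (h : RegFrame v c) (i : Fin 3) :
    ⟪nrm v c i, nrm v c i⟫ = (1 + c) * ((1 - c) * (1 + 2 * c)) := by
  have : ⟪nrm v c i, nrm v c i⟫ = (1 + 2 * c) * ⟪nrm v c i, v i⟫ -
      c * (⟪nrm v c i, v 0⟫ + ⟪nrm v c i, v 1⟫ + ⟪nrm v c i, v 2⟫) := by
    rw [← inner_add_right, ← inner_add_right, ← inner_smul_right, ← inner_smul_right,
      ← inner_sub_right]; rfl
  rw [this, h.nrm_inner, h.nrm_inner, h.nrm_inner, h.nrm_inner]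
  fin_cases i <;> simp <;> ring

lemma eq_zero (h : RegFrame v c) {y : E 2} (hy : ∀ i, ⟪v i, y⟫ = 0) : y = 0 := by
  have hspan := h.lin.span_eq_top_of_card_eq_finrank (by simp)
  have : y ∈ Submodule.span ℝ (Set.range v) := by rw [hspan]; trivial
  have h2 : ∀ z ∈ Submodule.span ℝ (Set.range v), ⟪z, y⟫ = 0 := by
    intro z hz
    induction hz using Submodule.span_induction with
    | mem x hx => obtain ⟨i, rfl⟩ := hx; exact hy i
    | zero => simp
    | add a b _ _ ha hb => rw [inner_add_left, ha, hb, add_zero]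
    | smul a x _ hx => rw [inner_smul_left, hx, mul_zero]
  exact inner_self_eq_zero.1 (h2 y this)

lemma expand' (h : RegFrame v c) (x : E 2) :
    ((1 - c) * (1 + 2 * c)) • x =
      ⟪x, v 0⟫ • nrm v c 0 + ⟪x, v 1⟫ • nrm v c 1 + ⟪x, v 2⟫ • nrm v c 2 := by
  rw [← sub_eq_zero]
  apply h.eq_zero
  intro i
  rw [inner_sub_right, inner_add_right, inner_add_right, inner_smul_right, inner_smul_right,
    inner_smul_right, inner_smul_right, real_inner_comm (nrm v c 0), real_inner_comm (nrm v c 1),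
    real_inner_comm (nrm v c 2), h.nrm_inner, h.nrm_inner, h.nrm_inner]
  fin_cases i <;> simp [real_inner_comm] <;> ring

lemma expand (h : RegFrame v c) (x : E 2) :
    ((1 - c) * (1 + 2 * c)) • x =
      ⟪x, nrm v c 0⟫ • v 0 + ⟪x, nrm v c 1⟫ • v 1 + ⟪x, nrm v c 2⟫ • v 2 := by
  rw [h.expand' x]
  simp only [nrm, inner_sub_right, inner_add_right, inner_smul_right]
  module

lemma inner_eq (h : RegFrame v c) (x y : E 2) :
    ((1 - c) * (1 + 2 * c)) * ⟪x, y⟫ =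
      (1 + 2 * c) * (⟪x, v 0⟫ * ⟪y, v 0⟫ + ⟪x, v 1⟫ * ⟪y, v 1⟫ + ⟪x, v 2⟫ * ⟪y, v 2⟫) -
      c * ((⟪x, v 0⟫ + ⟪x, v 1⟫ + ⟪x, v 2⟫) * (⟪y, v 0⟫ + ⟪y, v 1⟫ + ⟪y, v 2⟫)) := by
  have e : ((1 - c) * (1 + 2 * c)) * ⟪x, y⟫ = ⟪((1 - c) * (1 + 2 * c)) • x, y⟫ := by
    rw [inner_smul_left]; simp
  rw [e, h.expand' x]
  simp only [nrm, inner_sub_left, inner_add_left, inner_smul_left, conj_trivial]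
  rw [real_inner_comm y (v 0), real_inner_comm y (v 1), real_inner_comm y (v 2)]
  ring

/-- The triangle lies in the region cut out by the normals. -/
lemma sub (h : RegFrame v c) {x : E 2} (hx : x ∈ sconv {v 0, v 1, v 2}) :
    x ∈ unitSphere 2 ∧ ∀ i, 0 ≤ ⟪x, nrm v c i⟫ := by
  have hD : 0 < (1 - c) * (1 + 2 * c) := mul_pos (by linarith [h.c_lt]) h.c_gt
  have hpos : ∀ y ∈ unitSphere 2, (∀ i, 0 ≤ ⟪y, nrm v c i⟫) → 0 < ⟪v 0 + v 1 + v 2, y⟫ := by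
    intro y hy hn
    have e := congrArg (fun z => ⟪v 0 + v 1 + v 2, z⟫) (h.expand y)
    simp only [inner_add_right, inner_smul_right, h.sum_inner] at e
    have hne : 0 < ⟪y, nrm v c 0⟫ + ⟪y, nrm v c 1⟫ + ⟪y, nrm v c 2⟫ := by
      by_contra hh
      have z0 : ⟪y, nrm v c 0⟫ = 0 := by linarith [hn 0, hn 1, hn 2]
      have z1 : ⟪y, nrm v c 1⟫ = 0 := by linarith [hn 0, hn 1, hn 2]
      have z2 : ⟪y, nrm v c 2⟫ = 0 := by linarith [hn 0, hn 1, hn 2]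
      have e2 := h.expand y
      rw [z0, z1, z2] at e2
      simp only [zero_smul, add_zero, smul_eq_zero, hD.ne', false_or] at e2
      have := unit_norm hy
      rw [e2] at this; simp at this
    have hh := mul_pos hne h.c_gt
    by_contra hcon
    push Not at hcon
    nlinarith [mul_nonneg hD.le (neg_nonneg.2 hcon)]
  refine hx {x | x ∈ unitSphere 2 ∧ ∀ i, 0 ≤ ⟪x, nrm v c i⟫} ⟨⟨fun y hy => hy.1, ?_, ?_⟩, ?_⟩
  · have hS : 0 < ‖v 0 + v 1 + v 2‖ := by
      apply norm_pos_iff.2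
      intro hh
      have := hpos (v 0) (h.unit 0) (by
        intro i; rw [real_inner_comm, h.nrm_inner]; split_ifs <;> linarith)
      rw [hh] at this; simp at this
    refine ⟨‖v 0 + v 1 + v 2‖⁻¹ • (v 0 + v 1 + v 2), ?_, ?_⟩
    · rw [unitSphere, mem_sphere_zero_iff_norm, norm_smul, norm_inv, norm_norm,
        inv_mul_cancel₀ hS.ne']
    rintro y ⟨hy, hn⟩
    rw [inner_smul_left]
    exact mul_pos (by simpa using hS) (hpos y hy hn)
  · rintro y ⟨hy, hyn⟩ z ⟨hz, hzn⟩ m hm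
    refine ⟨hm.1, fun i => ?_⟩
    obtain ⟨a, b, ha, hb, rfl⟩ := comb_of_seg hy hz (hpos y hy hyn) (hpos z hz hzn) hm
    rw [inner_add_left, inner_smul_left, inner_smul_left]
    have := hyn i
    have := hzn i
    simp only [conj_trivial]
    positivity
  · have : ∀ j, v j ∈ {x | x ∈ unitSphere 2 ∧ ∀ i, 0 ≤ ⟪x, nrm v c i⟫} := by
      intro j
      refine ⟨h.unit j, fun i => ?_⟩
      rw [real_inner_comm, h.nrm_inner]; split_ifs <;> linarith
    rintro y (rfl | rfl | rfl) <;> apply this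

/-- Touching a supporting circle forces some coordinate to vanish. -/
lemma touch (h : RegFrame v c) {x u : E 2} (hx : x ∈ sconv {v 0, v 1, v 2})
    (hu : ∀ i, ⟪v i, u⟫ ≤ 0) (hxu : ⟪x, u⟫ = 0) :
    ⟪v 0, u⟫ = 0 ∨ ⟪v 1, u⟫ = 0 ∨ ⟪v 2, u⟫ = 0 := by
  obtain ⟨hx1, hn⟩ := h.sub hx
  have hD : 0 < (1 - c) * (1 + 2 * c) := mul_pos (by linarith [h.c_lt]) h.c_gt
  have e := h.expand x
  have e2 := congrArg (fun z => ⟪z, u⟫) e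
  simp only [inner_add_left, inner_smul_left, hxu, conj_trivial, mul_zero] at e2
  by_contra hcon
  push Not at hcon
  obtain ⟨c0, c1, c2⟩ := hcon
  have d0 := lt_of_le_of_ne (hu 0) c0
  have d1 := lt_of_le_of_ne (hu 1) c1
  have d2 := lt_of_le_of_ne (hu 2) c2
  have p0 := mul_nonneg (hn 0) (neg_nonneg.2 d0.le)
  have p1 := mul_nonneg (hn 1) (neg_nonneg.2 d1.le)
  have p2 := mul_nonneg (hn 2) (neg_nonneg.2 d2.le)
  have z0 : ⟪x, nrm v c 0⟫ = 0 := by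
    have : ⟪x, nrm v c 0⟫ * ⟪v 0, u⟫ = 0 := by linarith
    exact (mul_eq_zero.1 this).resolve_right c0
  have z1 : ⟪x, nrm v c 1⟫ = 0 := by
    have : ⟪x, nrm v c 1⟫ * ⟪v 1, u⟫ = 0 := by linarith
    exact (mul_eq_zero.1 this).resolve_right c1
  have z2 : ⟪x, nrm v c 2⟫ = 0 := by
    have : ⟪x, nrm v c 2⟫ * ⟪v 2, u⟫ = 0 := by linarith
    exact (mul_eq_zero.1 this).resolve_right c2
  rw [z0, z1, z2] at e
  simp only [zero_smul, add_zero, smul_eq_zero, hD.ne', false_or] at e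
  have := unit_norm hx1
  rw [e] at this; simp at this

lemma lune_bound (h : RegFrame v c) {u z : E 2}
    (hl : IsSupportingLune (sconv {v 0, v 1, v 2}) u z) :
    (c < 0 → -⟪u, z⟫ ≤ c) ∧
    (0 ≤ c → ⟪u, z⟫ ≤ 0 → (1 + c) * ⟪u, z⟫ ^ 2 ≤ 2 * c ^ 2) := by
  obtain ⟨hu, hz, _, _, hsub, ⟨x, hx, hx2⟩, ⟨y, hy, hy2⟩⟩ := hl
  have hc1 := h.c_lt
  have hc2 := h.c_gt
  have hD : 0 < (1 - c) * (1 + 2 * c) := mul_pos (by linarith [h.c_lt]) h.c_gt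
  have hv : ∀ i, v i ∈ sconv {v 0, v 1, v 2} := by
    intro i C hC
    apply hC.2
    fin_cases i <;> simp
  have hvu : ∀ i, ⟪v i, u⟫ ≤ 0 := fun i => (hsub (hv i)).2.1
  have hvz : ∀ i, ⟪v i, z⟫ ≤ 0 := fun i => (hsub (hv i)).2.2
  have tu := h.touch hx hvu hx2.2.1
  have tz := h.touch hy hvz hy2.2.1
  have Iuu := h.inner_eq u u
  have Izz := h.inner_eq z z
  have Iuz := h.inner_eq u z
  rw [unit_inner hu] at Iuu
  rw [unit_inner hz] at Izz
  simp only [real_inner_comm (v _) u, real_inner_comm (v _) z] at Iuu Izz Iuz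
  have u0 := hvu 0; have u1 := hvu 1; have u2 := hvu 2
  have z0 := hvz 0; have z1 := hvz 1; have z2 := hvz 2
  generalize ⟪v 0, u⟫ = a0 at *
  generalize ⟪v 1, u⟫ = a1 at *
  generalize ⟪v 2, u⟫ = a2 at *
  generalize ⟪v 0, z⟫ = b0 at *
  generalize ⟪v 1, z⟫ = b1 at *
  generalize ⟪v 2, z⟫ = b2 at *
  generalize ⟪u, z⟫ = d at *
  constructor
  · intro hc
    have cross : ∀ p q : ℝ, p ≤ 0 → q ≤ 0 → 0 ≤ p * q := fun p q => mul_nonneg_of_nonpos_of_nonpos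
    have sq : ∀ p q r : ℝ, p ≤ 0 → q ≤ 0 → r ≤ 0 →
        (1 - c) * (1 + 2 * c) * 1 = (1 + 2 * c) * (p * p + q * q + r * r) -
          c * ((p + q + r) * (p + q + r)) → (1 - c) * (1 + 2 * c) ≤ (p + q + r) ^ 2 := by
      intro p q r hp hq hr he
      have h1 : p * p + q * q + r * r ≤ (p + q + r) ^ 2 := by
        nlinarith [cross p q hp hq, cross p r hp hr, cross q r hq hr]
      have h2 := mul_le_mul_of_nonneg_left h1 hc2.le
      nlinarith [sq_nonneg (p + q + r)]
    have sa := sq _ _ _ u0 u1 u2 Iuu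
    have sb := sq _ _ _ z0 z1 z2 Izz
    have hpr : (1 - c) * (1 + 2 * c) ≤ (a0 + a1 + a2) * (b0 + b1 + b2) := by
      apply abs_le_of_sq_le_sq' _ (cross _ _ (by linarith) (by linarith)) |>.2
      have h9 := mul_le_mul sa sb hD.le (sq_nonneg _)
      rw [← mul_pow, ← pow_two] at h9
      exact h9
    have h3 : 0 ≤ a0 * b0 + a1 * b1 + a2 * b2 := by
      have := cross _ _ u0 z0
      have := cross _ _ u1 z1
      have := cross _ _ u2 z2
      linarith
    have h4 := mul_nonneg hc2.le h3
    have h5 := mul_le_mul_of_nonneg_left hpr (neg_nonneg.2 hc.le)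
    have h6 : ((1 - c) * (1 + 2 * c)) * (-c) ≤ ((1 - c) * (1 + 2 * c)) * d := by linarith
    have := le_of_mul_le_mul_left h6 hD
    linarith
  · intro hc hd
    have := quad (N := -((1 - c) * (1 + 2 * c) * d)) hc hc1 (neg_nonneg.2 u0) (neg_nonneg.2 u1)
      (neg_nonneg.2 u2) (neg_nonneg.2 z0) (neg_nonneg.2 z1) (neg_nonneg.2 z2)
      (by simpa using tu) (by simpa using tz) rfl rfl (by rw [Iuz]; ring)
      (by nlinarith [mul_nonneg hD.le (neg_nonneg.2 hd)])
    have e1 : (1 + 2 * c) * ((-a0) ^ 2 + (-a1) ^ 2 + (-a2) ^ 2) - c * (-a0 + -a1 + -a2) ^ 2 =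
        (1 - c) * (1 + 2 * c) := by rw [← mul_one ((1 - c) * (1 + 2 * c)), Iuu]; ring
    have e2 : (1 + 2 * c) * ((-b0) ^ 2 + (-b1) ^ 2 + (-b2) ^ 2) - c * (-b0 + -b1 + -b2) ^ 2 =
        (1 - c) * (1 + 2 * c) := by rw [← mul_one ((1 - c) * (1 + 2 * c)), Izz]; ring
    rw [e1, e2] at this
    have hD2 : 0 < ((1 - c) * (1 + 2 * c)) ^ 2 := by positivity
    refine le_of_mul_le_mul_left (a := ((1 - c) * (1 + 2 * c)) ^ 2) ?_ hD2
    nlinarith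

end RegFrame
end SphericalPal

namespace SphericalPal

lemma gball_normal {p N : E 2} {ρ : ℝ} (hp : p ∈ unitSphere 2) (h0 : 0 ≤ ρ) (h1 : ρ ≤ π / 2)
    (hB : ∀ x ∈ gball p ρ, 0 ≤ ⟪x, N⟫) : Real.sin ρ * ‖N‖ ≤ ⟪p, N⟫ := by
  have hs : 0 ≤ Real.sin ρ := Real.sin_nonneg_of_nonneg_of_le_pi h0 (by linarith [Real.pi_pos])
  have hc : 0 ≤ Real.cos ρ := Real.cos_nonneg_of_mem_Icc ⟨by linarith, h1⟩
  have hpN : 0 ≤ ⟪p, N⟫ := hB p ⟨hp, by rw [gdist, unit_inner hp, Real.arccos_one]; exact h0⟩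
  set m := N - ⟪p, N⟫ • p with hm
  have pp := unit_inner hp
  have hpm : ⟪p, m⟫ = 0 := by
    rw [hm, inner_sub_right, inner_smul_right, pp]; ring
  have hmN : ⟪m, N⟫ = ‖m‖ ^ 2 := by
    have : N = m + ⟪p, N⟫ • p := by rw [hm]; abel
    conv_lhs => rw [this]
    rw [inner_add_right, inner_smul_right, real_inner_comm p m, hpm, real_inner_self_eq_norm_sq]
    ring
  have hNN : ‖N‖ ^ 2 = ⟪p, N⟫ ^ 2 + ‖m‖ ^ 2 := by
    rw [← hmN, hm, inner_sub_left, inner_smul_left, real_inner_self_eq_norm_sq]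
    simp only [conj_trivial]; ring
  have hle1 := Real.sin_le_one ρ
  rcases (norm_nonneg m).eq_or_lt with hz | hz
  · have : ‖N‖ = ⟪p, N⟫ := by
      rw [← hz] at hNN
      exact (pow_left_inj₀ (norm_nonneg _) hpN two_ne_zero).1 (by linarith)
    rw [this]; nlinarith
  · set y := Real.cos ρ • p - Real.sin ρ • (‖m‖⁻¹ • m) with hy
    have hmm : ⟪m, m⟫ = ‖m‖ ^ 2 := real_inner_self_eq_norm_sq m
    have hyu : y ∈ unitSphere 2 := by
      apply unit_of_inner
      rw [hy]
      simp only [inner_sub_left, inner_sub_right, inner_smul_left, inner_smul_right, pp, hpm,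
        real_inner_comm p m, hmm, conj_trivial]
      field_simp
      linear_combination ‖m‖ * Real.sin_sq_add_cos_sq ρ
    have hyp : ⟪p, y⟫ = Real.cos ρ := by
      rw [hy, inner_sub_right, inner_smul_right, inner_smul_right, inner_smul_right, pp, hpm]; ring
    have := hB y ⟨hyu, by
      rw [gdist, hyp, Real.arccos_cos h0 (by linarith [Real.pi_pos])]⟩
    rw [hy, inner_sub_left, inner_smul_left, inner_smul_left, inner_smul_left, hmN] at this
    simp only [conj_trivial] at this
    have e : Real.sin ρ * (‖m‖⁻¹ * ‖m‖ ^ 2) = Real.sin ρ * ‖m‖ := by field_simp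
    rw [e] at this
    apply abs_le_of_sq_le_sq' _ hpN |>.2
    rw [mul_pow, hNN]
    have h5 : (Real.sin ρ * ‖m‖) ^ 2 ≤ (Real.cos ρ * ⟪p, N⟫) ^ 2 :=
      pow_le_pow_left₀ (by positivity) (by linarith) 2
    have h6 := Real.sin_sq_add_cos_sq ρ
    have h7 : ⟪p, N⟫ ^ 2 = (Real.sin ρ ^ 2 + Real.cos ρ ^ 2) * ⟪p, N⟫ ^ 2 := by rw [h6, one_mul]
    rw [mul_pow, mul_pow] at h5
    linarith

lemma exists_orth {p : E 2} : ∃ x ∈ unitSphere 2, ⟪p, x⟫ = 0 := by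
  by_cases hp : p = 0
  · refine ⟨EuclideanSpace.single 0 1, by simp [unitSphere], by simp [hp]⟩
  by_cases h : p 0 = 0 ∧ p 1 = 0
  · refine ⟨EuclideanSpace.single 0 1, by simp [unitSphere], ?_⟩
    simp [EuclideanSpace.inner_single_right, h.1]
  · have hpos : 0 < p 0 ^ 2 + p 1 ^ 2 := by
      by_contra hh
      apply h
      constructor <;> nlinarith [sq_nonneg (p 0), sq_nonneg (p 1)]
    set y : E 2 := !₂[p 1, - p 0, 0] with hy
    have hyn : ‖y‖ ≠ 0 := by
      intro h0
      have : ‖y‖ ^ 2 = p 0 ^ 2 + p 1 ^ 2 := by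
        rw [EuclideanSpace.norm_sq_eq, Fin.sum_univ_three]
        simp [hy]; ring
      rw [h0] at this; linarith
    refine ⟨‖y‖⁻¹ • y, ?_, ?_⟩
    · rw [unitSphere, mem_sphere_zero_iff_norm, norm_smul, norm_inv, norm_norm,
        inv_mul_cancel₀ hyn]
    · rw [inner_smul_right]
      have : ⟪p, y⟫ = 0 := by
        rw [PiLp.inner_apply, Fin.sum_univ_three]
        simp [hy]; ring
      rw [this, mul_zero]

lemma RegFrame.ball_le {v : Fin 3 → E 2} {c : ℝ} (h : RegFrame v c) {p : E 2} {ρ : ℝ}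
    (hp : p ∈ unitSphere 2) (h0 : 0 ≤ ρ) (hB : gball p ρ ⊆ sconv {v 0, v 1, v 2}) :
    ρ ≤ Real.arcsin (√((1 - c) / (3 * (1 + c)))) := by
  have hc1 := h.c_lt
  have hc2 := h.c_gt
  have hD : 0 < (1 - c) * (1 + 2 * c) := mul_pos (by linarith) hc2
  have hc3 : 0 < 1 + c := by linarith
  have h1 : ρ ≤ π / 2 := by
    by_contra hh
    push Not at hh
    obtain ⟨x, hx, hpx⟩ := exists_orth (p := p)
    have hx' : -x ∈ unitSphere 2 := by simpa [unitSphere] using hx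
    have m1 : x ∈ gball p ρ := ⟨hx, by rw [gdist, hpx, Real.arccos_zero]; exact hh.le⟩
    have m2 : -x ∈ gball p ρ := ⟨hx', by
      rw [gdist, inner_neg_right, hpx, neg_zero, Real.arccos_zero]; exact hh.le⟩
    have s1 := (h.sub (hB m1)).2
    have s2 := (h.sub (hB m2)).2
    have e := h.expand x
    have z : ∀ i, ⟪x, nrm v c i⟫ = 0 := by
      intro i
      have := s2 i
      rw [inner_neg_left] at this
      linarith [s1 i]
    rw [z, z, z] at e
    simp only [zero_smul, add_zero, smul_eq_zero, hD.ne', false_or] at e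
    have := unit_norm hx
    rw [e] at this; simp at this
  have key : ∀ i, Real.sin ρ * ‖nrm v c i‖ ≤ ⟪p, nrm v c i⟫ := fun i =>
    gball_normal hp h0 h1 (fun x hx => (h.sub (hB hx)).2 i)
  have hn : ∀ i, ‖nrm v c i‖ = √((1 + c) * ((1 - c) * (1 + 2 * c))) := fun i => by
    rw [norm_eq_sqrt_real_inner, h.nrm_self]
  have hS : ‖v 0 + v 1 + v 2‖ ^ 2 = 3 * (1 + 2 * c) := by
    rw [← real_inner_self_eq_norm_sq, h.sum_self]
  have hsum : ⟪p, nrm v c 0⟫ + ⟪p, nrm v c 1⟫ + ⟪p, nrm v c 2⟫ =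
      (1 - c) * ⟪p, v 0 + v 1 + v 2⟫ := by
    simp only [nrm, inner_sub_right, inner_add_right, inner_smul_right]; ring
  have hCS : ⟪p, v 0 + v 1 + v 2⟫ ≤ ‖v 0 + v 1 + v 2‖ := by
    have := real_inner_le_norm p (v 0 + v 1 + v 2)
    rwa [unit_norm hp, one_mul] at this
  have k0 := key 0
  have k1 := key 1
  have k2 := key 2
  rw [hn] at k0 k1 k2
  set M := √((1 + c) * ((1 - c) * (1 + 2 * c))) with hM
  have hM2 : M ^ 2 = (1 + c) * ((1 - c) * (1 + 2 * c)) := Real.sq_sqrt (by positivity)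
  have hM0 : 0 ≤ M := Real.sqrt_nonneg _
  have hs : 0 ≤ Real.sin ρ := Real.sin_nonneg_of_nonneg_of_le_pi h0 (by linarith [Real.pi_pos])
  have hle : 3 * (Real.sin ρ * M) ≤ (1 - c) * ‖v 0 + v 1 + v 2‖ := by
    have := mul_le_mul_of_nonneg_left hCS (by linarith : 0 ≤ 1 - c)
    linarith
  have hsq := pow_le_pow_left₀ (by positivity) hle 2
  rw [mul_pow, mul_pow, mul_pow, hM2, hS] at hsq
  have hfin : Real.sin ρ ^ 2 ≤ (1 - c) / (3 * (1 + c)) := by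
    rw [le_div_iff₀ (by linarith)]
    refine le_of_mul_le_mul_left (a := 3 * ((1 - c) * (1 + 2 * c))) ?_ (by linarith)
    nlinarith
  rw [← Real.arcsin_sin (by linarith) h1]
  exact Real.arcsin_le_arcsin (Real.le_sqrt_of_sq_le hfin)

lemma RegFrame.main {v : Fin 3 → E 2} {c w : ℝ} (h : RegFrame v c) (hw0 : 0 < w)
    (hw : w ≤ π / 2) (hwd : width (sconv {v 0, v 1, v 2}) = w) :
    ∃ r₁, inradius (sconv {v 0, v 1, v 2}) ≤ r₁ ∧ r₁ ≤ w ∧ Real.sin w ≤ 3 * Real.sin (w - 2 * r₁) := by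
  have hc1 := h.c_lt
  have hc2 := h.c_gt
  have hpi := Real.pi_pos
  set B := {b | ∃ u z : E 2, IsSupportingLune (sconv {v 0, v 1, v 2}) u z ∧ b = breadth u z} with hB
  have hne : B.Nonempty := by
    by_contra hh
    rw [Set.not_nonempty_iff_eq_empty] at hh
    have : width (sconv {v 0, v 1, v 2}) = 0 := by
      rw [width, ← hB, hh, Real.sInf_empty]
    linarith
  have hlow : ∀ x : ℝ, (∀ u z, IsSupportingLune (sconv {v 0, v 1, v 2}) u z →
      x ≤ Real.arccos (-⟪u, z⟫)) → x ≤ w := by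
    intro x hx
    rw [← hwd, width, ← hB]
    apply le_csInf hne
    rintro b ⟨u, z, hl, rfl⟩
    rw [breadth_eq hl.1 hl.2.1 hl.2.2.1 hl.2.2.2.1]
    exact hx u z hl
  have hc0 : 0 ≤ c := by
    by_contra hh
    push Not at hh
    have := hlow (Real.arccos c) (fun u z hl => Real.arccos_le_arccos ((h.lune_bound hl).1 hh))
    have h2 : π / 2 < Real.arccos c := by
      rw [← Real.arccos_zero]
      exact Real.arccos_lt_arccos (by linarith) hh (by norm_num)
    linarith
  set s := √((1 - c) / (3 * (1 + c))) with hs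
  set r₁ := Real.arcsin s with hr₁
  set A := √((1 + 2 * c) / 3) with hA
  set R₁ := Real.arccos A with hR₁
  have hs0 : 0 ≤ s := Real.sqrt_nonneg _
  have hA0 : 0 ≤ A := Real.sqrt_nonneg _
  have hs2 : s ^ 2 = (1 - c) / (3 * (1 + c)) :=
    Real.sq_sqrt (div_nonneg (by linarith) (by linarith))
  have hA2 : A ^ 2 = (1 + 2 * c) / 3 := Real.sq_sqrt (by positivity)
  have hs1 : s ≤ 1 := by
    apply abs_le_of_sq_le_sq' _ zero_le_one |>.2
    rw [hs2, div_le_iff₀ (by linarith)]; linarith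
  have hA1 : A ≤ 1 := by
    apply abs_le_of_sq_le_sq' _ zero_le_one |>.2
    rw [hA2]; linarith
  have sr : Real.sin r₁ = s := Real.sin_arcsin (by linarith) hs1
  have cR : Real.cos R₁ = A := Real.cos_arccos (by linarith) hA1
  have hr0 : 0 ≤ r₁ := Real.arcsin_nonneg.2 hs0
  have hr2 : r₁ ≤ π / 2 := Real.arcsin_le_pi_div_two _
  have hR0 : 0 ≤ R₁ := Real.arccos_nonneg _
  have hR2 : R₁ ≤ π / 2 := Real.arccos_le_pi_div_two.2 hA0
  have hcr0 : 0 ≤ Real.cos r₁ := Real.cos_nonneg_of_mem_Icc ⟨by linarith, hr2⟩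
  have hsR0 : 0 ≤ Real.sin R₁ := Real.sin_nonneg_of_nonneg_of_le_pi hR0 (by linarith)
  set a := Real.cos r₁ with ha
  set S := Real.sin R₁ with hS
  have ha2 : a ^ 2 = (2 + 4 * c) / (3 * (1 + c)) := by
    have := Real.sin_sq_add_cos_sq r₁
    rw [sr, hs2] at this
    have e : (2 + 4 * c) / (3 * (1 + c)) = 1 - (1 - c) / (3 * (1 + c)) := by
      field_simp; ring
    rw [e]; linarith
  have hS2 : S ^ 2 = 2 * (1 - c) / 3 := by
    have := Real.sin_sq_add_cos_sq R₁
    rw [cR, hA2] at this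
    linarith
  have hrel : a * S = 2 * (s * A) := by
    apply (pow_left_inj₀ (mul_nonneg hcr0 hsR0) (by positivity) two_ne_zero).1
    rw [mul_pow, mul_pow, mul_pow, ha2, hS2, hs2, hA2]
    field_simp; ring
  have hcosh : Real.cos (r₁ + R₁) = a * A - s * S := by rw [Real.cos_add, sr, cR]
  have hcosh2 : (1 + c) * (a * A - s * S) ^ 2 = 2 * c ^ 2 := by
    have e : (a * A - s * S) ^ 2 = a ^ 2 * A ^ 2 + s ^ 2 * S ^ 2 - 2 * (a * S) * (s * A) := by ring
    have e2 : 2 * (a * S) * (s * A) = 4 * (s ^ 2 * A ^ 2) := by rw [hrel]; ring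
    rw [e, e2, ha2, hS2, hs2, hA2]
    field_simp; ring
  have hcosh0 : 0 ≤ a * A - s * S := by
    rw [sub_nonneg]
    apply abs_le_of_sq_le_sq' _ (mul_nonneg hcr0 hA0) |>.2
    rw [mul_pow, mul_pow, ha2, hS2, hs2, hA2, div_mul_div_comm, div_mul_div_comm]
    apply div_le_div_of_nonneg_right _ (by linarith)
    nlinarith
  have hh : r₁ + R₁ ≤ w := by
    apply hlow
    intro u z hl
    rw [← Real.arccos_cos (by linarith : 0 ≤ r₁ + R₁) (by linarith), hcosh]
    apply Real.arccos_le_arccos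
    by_cases hd : ⟪u, z⟫ ≤ 0
    · have := (h.lune_bound hl).2 hc0 hd
      rw [← hcosh2] at this
      have h8 := le_of_mul_le_mul_left this (by linarith)
      apply abs_le_of_sq_le_sq' _ hcosh0 |>.2
      rw [neg_sq]; exact h8
    · push Not at hd; linarith
  refine ⟨r₁, ?_, by linarith, ?_⟩
  · apply Real.sSup_le _ hr0
    rintro ρ ⟨h0, p, hp, hsub⟩
    exact h.ball_le hp h0 hsub
  · have m1 : S ≤ Real.sin (w - r₁) :=
      Real.sin_le_sin_of_le_of_le_pi_div_two (by linarith) (by linarith) (by linarith)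
    have m2 : Real.cos (w - r₁) ≤ A := by
      rw [← cR]
      exact Real.cos_le_cos_of_nonneg_of_le_pi hR0 (by linarith) (by linarith)
    have e1 : Real.sin w = Real.sin (w - r₁) * a + Real.cos (w - r₁) * s := by
      rw [ha, ← sr, ← Real.sin_add]; congr 1; ring
    have e2 : Real.sin (w - 2 * r₁) = Real.sin (w - r₁) * a - Real.cos (w - r₁) * s := by
      rw [ha, ← sr, ← Real.sin_sub]; congr 1; ring
    rw [e1, e2]
    have g1 := mul_le_mul_of_nonneg_right m1 hcr0
    have g2 := mul_le_mul_of_nonneg_right m2 hs0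
    linarith

lemma triangle_main {T : Set (E 2)} {w : ℝ} (hw0 : 0 < w) (hw : w ≤ π / 2)
    (hT : IsRegularTriangle T) (hwd : width T = w) :
    ∃ r₁, inradius T ≤ r₁ ∧ r₁ ≤ w ∧ Real.sin w ≤ 3 * Real.sin (w - 2 * r₁) := by
  obtain ⟨v₁, v₂, v₃, h1, h2, h3, hlin, g1, g2, rfl⟩ := hT
  have e1 := congrArg Real.cos g1
  have e2 := congrArg Real.cos g2
  rw [cos_gdist h1 h2, cos_gdist h2 h3] at e1
  rw [cos_gdist h2 h3, cos_gdist h1 h3] at e2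
  have hF : RegFrame ![v₁, v₂, v₃] ⟪v₁, v₂⟫ := by
    refine ⟨hlin, ?_⟩
    intro i j
    fin_cases i <;> fin_cases j <;>
      simp [unit_norm h1, unit_norm h2, unit_norm h3, e1, e2, real_inner_comm v₁ v₂,
        real_inner_comm v₂ v₃, real_inner_comm v₁ v₃]
  exact hF.main hw0 hw hwd

end SphericalPal

namespace SphericalPal

lemma polar_unit {p e : E 2} (hp : p ∈ unitSphere 2) (he : e ∈ unitSphere 2)
    (hpe : ⟪p, e⟫ = 0) (r : ℝ) : Real.cos r • p + Real.sin r • e ∈ unitSphere 2 := by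
  apply unit_of_inner
  have hep : ⟪e, p⟫ = 0 := by rw [real_inner_comm]; exact hpe
  simp only [inner_add_left, inner_add_right, real_inner_smul_left, real_inner_smul_right,
    unit_inner hp, unit_inner he, hpe, hep]
  linear_combination Real.sin_sq_add_cos_sq r

lemma polar_inner {p e f : E 2} (hp : p ∈ unitSphere 2)
    (hpe : ⟪p, e⟫ = 0) (hpf : ⟪p, f⟫ = 0) (r R : ℝ) :
    ⟪Real.cos r • p + Real.sin r • e, Real.cos R • p + Real.sin R • f⟫
      = Real.cos r * Real.cos R + Real.sin r * Real.sin R * ⟪e, f⟫ := by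
  have hep : ⟪e, p⟫ = 0 := by rw [real_inner_comm]; exact hpe
  simp only [inner_add_left, inner_add_right, real_inner_smul_left, real_inner_smul_right,
    unit_inner hp, hpf, hep]
  ring

lemma polar_inner_p {p e : E 2} (hp : p ∈ unitSphere 2)
    (hpe : ⟪p, e⟫ = 0) (r : ℝ) :
    ⟪p, Real.cos r • p + Real.sin r • e⟫ = Real.cos r := by
  simp only [inner_add_right, real_inner_smul_right, unit_inner hp, hpe]
  ring

lemma polar_decomp {p t : E 2} {r : ℝ} (hp : p ∈ unitSphere 2) (ht : t ∈ unitSphere 2)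
    (hr : gdist p t = r) (hs : 0 < Real.sin r) :
    ∃ e ∈ unitSphere 2, ⟪p, e⟫ = 0 ∧ t = Real.cos r • p + Real.sin r • e := by
  have hc : ⟪p, t⟫ = Real.cos r := by rw [← hr, cos_gdist hp ht]
  have hc' : ⟪t, p⟫ = Real.cos r := by rw [real_inner_comm]; exact hc
  refine ⟨(Real.sin r)⁻¹ • (t - Real.cos r • p), ?_, ?_, ?_⟩
  · apply unit_of_inner
    simp only [inner_sub_left, inner_sub_right, real_inner_smul_left, real_inner_smul_right,
      unit_inner hp, unit_inner ht, hc, hc']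
    field_simp
    linear_combination -Real.sin_sq_add_cos_sq r
  · simp only [inner_sub_right, real_inner_smul_right, unit_inner hp, hc]
    ring
  · rw [smul_inv_smul₀ hs.ne']; abel

lemma sangle_polar {p e f : E 2} {r : ℝ} (hp : p ∈ unitSphere 2) (he : e ∈ unitSphere 2)
    (hf : f ∈ unitSphere 2) (hpe : ⟪p, e⟫ = 0) (hpf : ⟪p, f⟫ = 0) (hs : 0 < Real.sin r) :
    sangle (Real.cos r • p + Real.sin r • e) p (Real.cos r • p + Real.sin r • f)
      = Real.arccos ⟪e, f⟫ := by
  rw [sangle, polar_inner_p hp hpe, polar_inner_p hp hpf, add_sub_cancel_left,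
    add_sub_cancel_left, InnerProductGeometry.angle_smul_left_of_pos _ _ hs,
    InnerProductGeometry.angle_smul_right_of_pos _ _ hs, InnerProductGeometry.angle,
    unit_norm he, unit_norm hf]
  norm_num

lemma cap_int {p m f : E 2} {r R : ℝ} (hp : p ∈ unitSphere 2) (hm : m ∈ unitSphere 2)
    (hf : f ∈ unitSphere 2) (hpm : ⟪p, m⟫ = 0) (hpf : ⟪p, f⟫ = 0) (hr0 : 0 < r) (hr : r < π)
    (hs : 0 < Real.sin r)
    (h : Real.sin r * Real.cos R < Real.cos r * Real.sin R * ⟪m, f⟫) :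
    ∃ σ > 0, ∀ s, 0 < s → s < σ → Real.cos (r + s) • p + Real.sin (r + s) • m ∈
      sInterior (sconv (gball p r ∪ {Real.cos R • p + Real.sin R • f}) \ gball p r) := by
  have hq := polar_unit hp hf hpf R
  have hx0 := polar_unit hp hm hpm r
  obtain ⟨δ, hδ, hC⟩ := cap_nhds (r := r) hp hq hx0
    (by rw [gdist, polar_inner_p hp hpm, Real.arccos_cos hr0.le hr.le])
    (by
      rw [polar_inner_p hp hpf, polar_inner hp hpm hpf]
      have e0 : Real.cos R = (Real.sin r ^ 2 + Real.cos r ^ 2) * Real.cos R := by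
        rw [Real.sin_sq_add_cos_sq, one_mul]
      have e1 := mul_lt_mul_of_pos_left h hs
      linarith)
  refine ⟨min δ (π - r), lt_min hδ (by linarith), ?_⟩
  intro s hs0 hsσ
  have hsδ := lt_of_lt_of_le hsσ (min_le_left _ _)
  have hsπ := lt_of_lt_of_le hsσ (min_le_right _ _)
  have hx := polar_unit hp hm hpm (r + s)
  have hpx := polar_inner_p hp hpm (r + s)
  have hxx := polar_inner hp hpm hpm (r + s) r
  set x := Real.cos (r + s) • p + Real.sin (r + s) • m with hxdef
  set x₀ := Real.cos r • p + Real.sin r • m with hx₀def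
  have hd : ‖x - x₀‖ ≤ s := by
    refine (norm_sub_le_gdist hx hx0).trans ?_
    rw [gdist, hxx, unit_inner hm, mul_one, ← Real.cos_sub, add_sub_cancel_left,
      Real.arccos_cos hs0.le (by linarith)]
  have hlt : Real.cos (r + s) < Real.cos r :=
    Real.cos_lt_cos_of_nonneg_of_le_pi hr0.le (by linarith) (by linarith)
  have key : ∀ y ∈ unitSphere 2, gdist x y < min (δ - s) (Real.cos r - Real.cos (r + s)) →
      y ∈ sconv (gball p r ∪ {Real.cos R • p + Real.sin R • f}) \ gball p r := by
    intro y hy hxy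
    have h1 := lt_of_lt_of_le hxy (min_le_left _ _)
    have h2 := lt_of_lt_of_le hxy (min_le_right _ _)
    have h3 := norm_sub_le_gdist hx hy
    rw [norm_sub_rev] at h3
    refine ⟨?_, ?_⟩
    · rintro C ⟨hCc, hCs⟩
      refine hC C hCc (fun z hz => hCs (Or.inl hz)) (hCs (Or.inr rfl)) y hy ?_
      have : y - x₀ = (y - x) + (x - x₀) := by abel
      rw [this]
      have := norm_add_le (y - x) (x - x₀)
      linarith
    · rintro ⟨-, hb⟩
      have e1 : Real.cos r ≤ ⟪p, y⟫ := by
        rw [← cos_gdist hp hy]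
        exact Real.cos_le_cos_of_nonneg_of_le_pi (Real.arccos_nonneg _) hr.le hb
      have e2 : ⟪p, y⟫ = ⟪p, x⟫ + ⟪p, y - x⟫ := by rw [inner_sub_right]; ring
      have e3 := real_inner_le_norm p (y - x)
      rw [unit_norm hp, one_mul] at e3
      linarith
  refine ⟨key x hx ?_, _, lt_min (by linarith) (by linarith), key⟩
  rw [gdist, unit_inner hx, Real.arccos_one]
  exact lt_min (by linarith) (by linarith)

lemma caps_disjoint {p f g : E 2} {r R k : ℝ} (hp : p ∈ unitSphere 2)
    (hf : f ∈ unitSphere 2) (hg : g ∈ unitSphere 2) (hpf : ⟪p, f⟫ = 0) (hpg : ⟪p, g⟫ = 0)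
    (hr0 : 0 < r) (hr : r < π) (hs : 0 < Real.sin r) (hcS : 0 < Real.cos r * Real.sin R)
    (hk : Real.sin r * Real.cos R = Real.cos r * Real.sin R * k) (hk0 : 0 ≤ k)
    (hd : Disjoint
      (sInterior (sconv (gball p r ∪ {Real.cos R • p + Real.sin R • f}) \ gball p r))
      (sInterior (sconv (gball p r ∪ {Real.cos R • p + Real.sin R • g}) \ gball p r))) :
    ⟪f, g⟫ ≤ 2 * k ^ 2 - 1 := by
  have hff := unit_inner hf
  have hgg := unit_inner hg
  have hN : ‖f + g‖ ^ 2 = 2 + 2 * ⟪f, g⟫ := by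
    rw [← real_inner_self_eq_norm_sq]
    simp only [inner_add_left, inner_add_right, hff, hgg, real_inner_comm f g]
    ring
  by_contra hcon
  push Not at hcon
  have hN0 : 2 * k < ‖f + g‖ := by
    apply lt_of_pow_lt_pow_left₀ 2 (norm_nonneg _)
    rw [hN]; nlinarith
  have hpos : 0 < ‖f + g‖ := by linarith
  set m := ‖f + g‖⁻¹ • (f + g) with hm
  have hmu : m ∈ unitSphere 2 := by
    apply unit_of_inner
    rw [hm, real_inner_smul_left, real_inner_smul_right, real_inner_self_eq_norm_sq]
    field_simp
  have hpm : ⟪p, m⟫ = 0 := by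
    rw [hm, real_inner_smul_right, inner_add_right, hpf, hpg]; ring
  have hmf : ⟪m, f⟫ = ‖f + g‖ / 2 := by
    rw [hm, real_inner_smul_left, inner_add_left, hff, real_inner_comm f g]
    field_simp
    rw [hN]; ring
  have hmg : ⟪m, g⟫ = ‖f + g‖ / 2 := by
    rw [hm, real_inner_smul_left, inner_add_left, hgg]
    field_simp
    rw [hN]; ring
  obtain ⟨σ₁, h1, H1⟩ := cap_int (R := R) hp hmu hf hpm hpf hr0 hr hs (by
    rw [hk, hmf]; exact mul_lt_mul_of_pos_left (by linarith) hcS)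
  obtain ⟨σ₂, h2, H2⟩ := cap_int (R := R) hp hmu hg hpm hpg hr0 hr hs (by
    rw [hk, hmg]; exact mul_lt_mul_of_pos_left (by linarith) hcS)
  have h3 : 0 < min σ₁ σ₂ := lt_min h1 h2
  have m1 := min_le_left σ₁ σ₂
  have m2 := min_le_right σ₁ σ₂
  exact Set.disjoint_left.1 hd (H1 (min σ₁ σ₂ / 2) (by linarith) (by linarith))
    (H2 (min σ₁ σ₂ / 2) (by linarith) (by linarith))

lemma contact_pos {K : Set (E 2)} {p : E 2} {t : Fin 3 → E 2} (hK : SConvex K)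
    (hp : p ∈ unitSphere 2) (ht : ∀ i, t i ∈ K)
    (hpt : p ∈ sInterior (sconv {t 0, t 1, t 2})) {m : E 2} (hm : m ∈ unitSphere 2)
    (hpm : ⟪p, m⟫ = 0) : ∃ i, ⟪t i, m⟫ < 0 := by
  by_contra hcon
  push Not at hcon
  obtain ⟨-, ε, hε, H⟩ := hpt
  have hmp : ⟪m, p⟫ = 0 := by rw [real_inner_comm]; exact hpm
  set δ := min (ε / 2) 1 with hδ
  have hδ0 : 0 < δ := lt_min (by linarith) one_pos
  have hδ1 : δ ≤ 1 := min_le_right _ _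
  have hδε : δ ≤ ε / 2 := min_le_left _ _
  have hpi := Real.pi_gt_three
  have hpm' : ⟪p, -m⟫ = 0 := by rw [inner_neg_right, hpm, neg_zero]
  have hm' : -m ∈ unitSphere 2 := unit_of_inner (by rw [inner_neg_neg, unit_inner hm])
  have hz := polar_unit hp hm' hpm' δ
  have := H _ hz (by
    rw [gdist, polar_inner_p hp hpm', Real.arccos_cos hδ0.le (by linarith)]; linarith)
  have h2 := (this {x ∈ K | 0 ≤ ⟪x, m⟫} ⟨hK.inter_half m, by
    rintro x (rfl | rfl | rfl)
    · exact ⟨ht 0, hcon 0⟩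
    · exact ⟨ht 1, hcon 1⟩
    · exact ⟨ht 2, hcon 2⟩⟩).2
  rw [inner_add_left, real_inner_smul_left, real_inner_smul_left, hpm, inner_neg_left,
    unit_inner hm] at h2
  have := Real.sin_pos_of_pos_of_lt_pi hδ0 (by linarith)
  linarith

lemma core {K : Set (E 2)} {p : E 2} {t q : Fin 3 → E 2} {r w r₁ : ℝ} (hw0 : 0 < w)
    (hw : w ≤ π / 2) (hK : SConvex K) (hp : p ∈ unitSphere 2) (hB : gball p r ⊆ K)
    (ht : ∀ i, t i ∈ K ∧ gdist p (t i) = r ∧ t i ∉ sInterior K)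
    (hpt : p ∈ sInterior (sconv {t 0, t 1, t 2}))
    (hq : ∀ i, q i ∈ K ∧ gdist p (q i) = w - r)
    (hd : ∀ i j, i ≠ j →
        Disjoint (sInterior (sconv (gball p r ∪ {q i}) \ gball p r))
          (sInterior (sconv (gball p r ∪ {q j}) \ gball p r)))
    (hr1w : r₁ ≤ w) (hr1 : Real.sin w ≤ 3 * Real.sin (w - 2 * r₁))
    (i j : Fin 3) (hij : i ≠ j) :
    |sangle (t i) p (t j) - 2 * π / 3| ≤ 4500 * π / Real.sin w * (r - r₁) ∧
    |sangle (q i) p (q j) - 2 * π / 3| ≤ 4500 * π / Real.sin w * (r - r₁) := by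
  have hpi := Real.pi_pos
  have hsw : 0 < Real.sin w := Real.sin_pos_of_pos_of_lt_pi hw0 (by linarith)
  have htu : ∀ i, t i ∈ unitSphere 2 := fun i => hK.1 (ht i).1
  have hqu : ∀ i, q i ∈ unitSphere 2 := fun i => hK.1 (hq i).1
  have hr0 : 0 ≤ r := (ht 0).2.1 ▸ Real.arccos_nonneg _
  have hR0 : 0 ≤ w - r := (hq 0).2 ▸ Real.arccos_nonneg _
  have hpos := fun m hm hpm => contact_pos hK hp (fun i => (ht i).1) hpt (m := m) hm hpm
  have hrpos : 0 < r := by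
    rcases hr0.eq_or_lt with h | h
    · exfalso
      obtain ⟨m, hm, hpm⟩ := exists_orth (p := p)
      obtain ⟨i, hi⟩ := hpos m hm hpm
      have e1 : ⟪p, t i⟫ = 1 := by
        rw [← cos_gdist hp (htu i), (ht i).2.1, ← h, Real.cos_zero]
      have e2 : p = t i := (inner_eq_one_iff_of_norm_eq_one (unit_norm hp) (unit_norm (htu i))).1 e1
      rw [← e2, hpm] at hi
      exact lt_irrefl _ hi
    · exact h
  have habs : ∀ a b : ℝ, Real.sin a - Real.sin b ≤ |a - b| := fun a b => by
    have h := Real.abs_sin_sub_sin_le a b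
    exact (le_abs_self _).trans h
  rcases lt_or_ge (w / 2) r with hcase | hcase
  · have h1 : Real.sin (w - 2 * r) ≤ 0 :=
      Real.sin_nonpos_of_nonpos_of_neg_pi_le (by linarith) (by linarith)
    have hrr : r₁ ≤ r := by
      by_contra hh
      push Not at hh
      have := Real.sin_nonpos_of_nonpos_of_neg_pi_le (x := w - 2 * r₁) (by linarith) (by linarith)
      linarith
    have h2 := habs (w - 2 * r₁) (w - 2 * r)
    rw [abs_of_nonneg (by linarith)] at h2
    have h3 : Real.sin w ≤ 6 * (r - r₁) := by linarith
    have h4 : π ≤ 4500 * π / Real.sin w * (r - r₁) := by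
      rw [div_mul_eq_mul_div, le_div_iff₀ hsw]
      nlinarith
    have h5 : ∀ x y : E 2, |sangle x p y - 2 * π / 3| ≤ π := by
      intro x y
      have a1 := InnerProductGeometry.angle_nonneg (x - ⟪p, x⟫ • p) (y - ⟪p, y⟫ • p)
      have a2 := InnerProductGeometry.angle_le_pi (x - ⟪p, x⟫ • p) (y - ⟪p, y⟫ • p)
      rw [sangle, abs_le]
      constructor <;> linarith
    exact ⟨(h5 _ _).trans h4, (h5 _ _).trans h4⟩
  · have hsr : 0 < Real.sin r := Real.sin_pos_of_pos_of_lt_pi hrpos (by linarith)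
    have hcr : 0 < Real.cos r := Real.cos_pos_of_mem_Ioo ⟨by linarith, by linarith⟩
    set R := w - r with hR
    have hsR : 0 < Real.sin R := Real.sin_pos_of_pos_of_lt_pi (by linarith) (by linarith)
    have hcR : 0 < Real.cos R := Real.cos_pos_of_mem_Ioo ⟨by linarith, by linarith⟩
    have hcS := mul_pos hcr hsR
    set k := Real.sin r * Real.cos R / (Real.cos r * Real.sin R) with hk
    have hk0 : 0 ≤ k := by positivity
    have hkk : Real.sin r * Real.cos R = Real.cos r * Real.sin R * k := by
      rw [hk]; field_simp
    have es : Real.sin w = Real.cos r * Real.sin R + Real.sin r * Real.cos R := by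
      have : w = R + r := by rw [hR]; ring
      rw [this, Real.sin_add]; ring
    have ed : Real.sin (w - 2 * r) = Real.cos r * Real.sin R - Real.sin r * Real.cos R := by
      have : w - 2 * r = R - r := by rw [hR]; ring
      rw [this, Real.sin_sub]; ring
    have hd0 : 0 ≤ Real.sin (w - 2 * r) :=
      Real.sin_nonneg_of_nonneg_of_le_pi (by linarith) (by linarith)
    choose e he hpe hte using fun i => polar_decomp hp (htu i) (ht i).2.1 hsr
    choose f hf hpf hqf using fun i => polar_decomp hp (hqu i) (hq i).2 hsR
    have hff : ∀ i j, i ≠ j → ⟪f i, f j⟫ ≤ 2 * k ^ 2 - 1 := by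
      intro i j hij
      have := hd i j hij
      rw [hqf i, hqf j] at this
      exact caps_disjoint hp (hf i) (hf j) (hpf i) (hpf j) hrpos (by linarith) hsr hcS hkk hk0 this
    have hef : ∀ i j, ⟪e i, f j⟫ ≤ k := by
      intro i j
      have hn : ¬ (⟪p, q j⟫ < Real.cos r * ⟪t i, q j⟫) := by
        intro hlt
        obtain ⟨δ, hδ, H⟩ := cap_nhds hp (hqu j) (htu i) (ht i).2.1 hlt
        refine (ht i).2.2 ⟨(ht i).1, δ, hδ, fun y hy hg => H K hK hB (hq j).1 y hy ?_⟩
        have := norm_sub_le_gdist (htu i) hy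
        rw [norm_sub_rev]; linarith
      rw [hqf j, polar_inner_p hp (hpf j), hte i, polar_inner hp (hpe i) (hpf j)] at hn
      push Not at hn
      have h1 := Real.sin_sq_add_cos_sq r
      have h2 : Real.sin r * (Real.cos r * Real.sin R * ⟪e i, f j⟫) ≤
          Real.sin r * (Real.sin r * Real.cos R) := by nlinarith
      have h3 := le_of_mul_le_mul_left h2 hsr
      rw [hkk] at h3
      exact le_of_mul_le_mul_left h3 hcS
    have hpos2 : ∀ m ∈ unitSphere 2, ⟪p, m⟫ = 0 → ∃ i, ⟪e i, m⟫ < 0 := by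
      intro m hm hpm
      obtain ⟨i, hi⟩ := hpos m hm hpm
      refine ⟨i, ?_⟩
      rw [hte i, inner_add_left, real_inner_smul_left, real_inner_smul_left, hpm] at hi
      by_contra hh
      push Not at hh
      have := mul_nonneg hsr.le hh
      linarith
    have hP := fun (ε : ℝ) (hε : k ≤ 1 / 2 + ε) =>
      planar hp hf he hpf hpe hk0 hε hff hef hpos2
    have hkhalf : 1 / 2 ≤ k := by
      by_contra hh
      push Not at hh
      have := (hP (k - 1 / 2) (by linarith) i j hij).1
      have := abs_nonneg (⟪e i, e j⟫ + 1 / 2)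
      linarith
    have hk2 : Real.cos r * Real.sin R ≤ 2 * (Real.sin r * Real.cos R) := by
      rw [hkk]; nlinarith
    have hrr : r₁ ≤ r := by
      by_contra hh
      push Not at hh
      have := Real.sin_lt_sin_of_lt_of_le_pi_div_two (x := w - 2 * r₁) (y := w - 2 * r)
        (by linarith) (by linarith) (by linarith)
      linarith
    have h2 := habs (w - 2 * r₁) (w - 2 * r)
    rw [abs_of_nonneg (by linarith)] at h2
    have h3 : Real.sin w ≤ 6 * (r - r₁) + 3 * Real.sin (w - 2 * r) := by linarith
    have hkε : k ≤ 1 / 2 + 3 * (r - r₁) / Real.sin w := by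
      have : k - 1 / 2 ≤ 3 * (r - r₁) / Real.sin w := by
        rw [le_div_iff₀ hsw]
        have g1 : Real.cos r * Real.sin R * (k - 1 / 2) ≤ 3 / 2 * (r - r₁) := by
          rw [mul_sub, ← hkk]; linarith
        have g2 : Real.sin w ≤ 2 * (Real.cos r * Real.sin R) := by linarith
        nlinarith
      linarith
    have hfin := hP _ hkε i j hij
    have hc : ∀ x : ℝ, -1 ≤ x → x ≤ 1 → |x + 1 / 2| ≤ 1500 * (3 * (r - r₁) / Real.sin w) →
        |Real.arccos x - 2 * π / 3| ≤ 4500 * π / Real.sin w * (r - r₁) := by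
      intro x hx1 hx2 hx
      refine (arccos_lip hx1 hx2).trans ((mul_le_mul_of_nonneg_left hx hpi.le).trans_eq ?_)
      ring
    constructor
    · rw [hte i, hte j, sangle_polar hp (he i) (he j) (hpe i) (hpe j) hsr]
      obtain ⟨b1, b2⟩ := unit_inner_bounds (he i) (he j)
      exact hc _ b1 b2 hfin.1
    · rw [hqf i, hqf j, sangle_polar hp (hf i) (hf j) (hpf i) (hpf j) hsR]
      obtain ⟨b1, b2⟩ := unit_inner_bounds (hf i) (hf j)
      exact hc _ b1 b2 hfin.2

end SphericalPal

/-- the angles between contact points, and between the cap peaks, at the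
incenter are within `c_w·η` of `2π/3`, where `η = r(K) - r(T_w)`. -/
theorem contact_point_angles (w : ℝ) (hw0 : 0 < w) (hw : w ≤ π / 2) :
    ∃ c > 0, ∀ (K : Set (E 2)) (p : E 2) (t q : Fin 3 → E 2) (T_w : Set (E 2)),
      IsConvexBody K → width K = w →
      p ∈ unitSphere 2 → gball p (inradius K) ⊆ K → gball p (inradius K) ≠ K →
      (∀ i, t i ∈ K ∧ gdist p (t i) = inradius K ∧ t i ∉ sInterior K) →
      p ∈ sInterior (sconv {t 0, t 1, t 2}) →
      (∀ i, q i ∈ K ∧ gdist p (q i) = w - inradius K) →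
      (∀ i j, i ≠ j →
        Disjoint
          (sInterior (sconv (gball p (inradius K) ∪ {q i}) \ gball p (inradius K)))
          (sInterior (sconv (gball p (inradius K) ∪ {q j}) \ gball p (inradius K)))) →
      IsRegularTriangle T_w → width T_w = w →
      ∀ i j, i ≠ j →
        (2 * π / 3 - c * (inradius K - inradius T_w) ≤ sangle (t i) p (t j) ∧
          sangle (t i) p (t j) ≤ 2 * π / 3 + c * (inradius K - inradius T_w)) ∧
        (2 * π / 3 - c * (inradius K - inradius T_w) ≤ sangle (q i) p (q j) ∧
          sangle (q i) p (q j) ≤ 2 * π / 3 + c * (inradius K - inradius T_w)) := by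
  have hpi := Real.pi_pos
  have hsw : 0 < Real.sin w := Real.sin_pos_of_pos_of_lt_pi hw0 (by linarith)
  refine ⟨4500 * π / Real.sin w, by positivity, ?_⟩
  intro K p t q T hK _ hp hB _ ht hpt hq hd hT hTw i j hij
  obtain ⟨r₁, h1, h2, h3⟩ := triangle_main hw0 hw hT hTw
  obtain ⟨a, b⟩ := core hw0 hw hK.1 hp hB ht hpt hq hd h2 h3 i j hij
  have hc : 4500 * π / Real.sin w * (inradius K - r₁) ≤
      4500 * π / Real.sin w * (inradius K - inradius T) :=
    mul_le_mul_of_nonneg_left (by linarith) (by positivity)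
  rw [abs_le] at a b
  refine ⟨⟨?_, ?_⟩, ?_, ?_⟩ <;> linarith [a.1, a.2, b.1, b.2]
end
end
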